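/- Let (u, π, v, θ) be a smooth solution of the stationary 3D tropical climate model. Suppose p ∈ [3, 9/2], q ∈ [1, 2), r ∈ [1, 2), α ∈ [0, 3/p − 2/3], β ∈ [0, 3/q − 1/2], γ ∈ [0, 3/r − 1/2], and the inequalities α + ((4p−6)q/((6−q)p))·β ≤ 1, α + ((4p−6)r/((6−r)p))·γ ≤ 1, and (2q/(6−q))·β + (2r/(6−r))·γ ≤ 1 hold. Assume there exists a sequence R_j → +∞ such that X_{α,p,R_j} → 0 as j → ∞ and the limits lim_{j→∞} Y_{β,q,R_j} and lim_{j→∞} Z_{γ,r,R_j} exist and are finite. Then u = 0, v = 0 and θ = 0 identically on ℝ³. -/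

import Mathlib

open MeasureTheory Filter Metric

noncomputable section

abbrev R3 : Type := EuclideanSpace ℝ (Fin 3)

/-- Partial derivative of `f` in the `j`-th coordinate direction. -/
def pd (f : R3 → ℝ) (j : Fin 3) (x : R3) : ℝ :=
  fderiv ℝ f x (EuclideanSpace.single j 1)

/-- Laplacian of `f`. -/
def lap (f : R3 → ℝ) (x : R3) : ℝ := ∑ j, pd (pd f j) j x

/-- The stationary 3D tropical climate model:
`-Δu + (u·∇)u + ∇π + div(v⊗v) = 0`, `-Δv + (u·∇)v + ∇θ + (v·∇)u = 0`,
`-Δθ + u·∇θ + div v = 0`, `div u = 0`. -/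
def TCM (u v : R3 → R3) (pr θ : R3 → ℝ) : Prop :=
  (∀ i x, -lap (fun y => u y i) x + (∑ j, u x j * pd (fun y => u y i) j x)
      + pd pr i x + (∑ j, pd (fun y => v y j * v y i) j x) = 0) ∧
  (∀ i x, -lap (fun y => v y i) x + (∑ j, u x j * pd (fun y => v y i) j x)
      + pd θ i x + (∑ j, v x j * pd (fun y => u y i) j x) = 0) ∧
  (∀ x, -lap θ x + (∑ j, u x j * pd θ j x) + (∑ j, pd (fun y => v y j) j x) = 0) ∧
  (∀ x, (∑ j, pd (fun y => u y j) j x) = 0)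

/-- The annulus `B_{2R} \ B_R`. -/
def annulus (R : ℝ) : Set R3 := ball (0 : R3) (2 * R) \ ball 0 R

/-- `L^p` norm of a scalar function on a set `E`. -/
def lpS (g : R3 → ℝ) (p : ℝ) (E : Set R3) : ℝ := (∫ x in E, |g x| ^ p) ^ (1 / p)

/-- `X_{α,p,R} = R^{-α} ‖f‖_{L^p(B_{2R} \ B_R)}` for a vector field `f`. -/
def XnV (f : R3 → R3) (a p R : ℝ) : ℝ := R ^ (-a) * lpS (fun x => ‖f x‖) p (annulus R)

/-- `X_{α,p,R} = R^{-α} ‖f‖_{L^p(B_{2R} \ B_R)}` for a scalar function `f`. -/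
def XnS (f : R3 → ℝ) (a p R : ℝ) : ℝ := R ^ (-a) * lpS f p (annulus R)

set_option linter.unusedVariables false
set_option linter.unusedSimpArgs false
set_option linter.unusedSectionVars false
lemma mll {a b c : ℝ} (h : b ≤ c) (k : 0 ≤ a) : a * b ≤ a * c := mul_le_mul_of_nonneg_left h k
lemma mlr {a b c : ℝ} (h : b ≤ c) (k : 0 ≤ a) : b * a ≤ c * a := mul_le_mul_of_nonneg_right h k
lemma evf {X : Type*} {P : X → Prop} {l : Filter X} (h : ∀ x, P x) : ∀ᶠ x in l, P x := Eventually.of_forall h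
lemma rnn {x : ℝ} (h : 0 ≤ x) (y : ℝ) : 0 ≤ x ^ y := Real.rpow_nonneg h y
lemma rnc (x : ℝ) (n : ℕ) : x ^ (n : ℝ) = x ^ n := Real.rpow_natCast x n
lemma rmu {x : ℝ} (h : 0 ≤ x) (y z : ℝ) : x ^ (y * z) = (x ^ y) ^ z := Real.rpow_mul h y z
lemma rle' {x y z : ℝ} (h : 0 ≤ x) (k : x ≤ y) (l : 0 ≤ z) : x ^ z ≤ y ^ z := Real.rpow_le_rpow h k l
lemma rlx {x y z : ℝ} (h : 1 ≤ x) (k : y ≤ z) : x ^ y ≤ x ^ z := Real.rpow_le_rpow_of_exponent_le h k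
lemma nrn {x : ℝ} (h : 0 ≤ x) : ‖x‖ = x := Real.norm_of_nonneg h
lemma iz {f : R3 → ℝ} {x : R3} (h : x ∉ tsupport f) : f x = 0 := image_eq_zero_of_notMem_tsupport h
lemma icm {X : Type*} {mX : MeasurableSpace X} {μ : Measure X} (r : ℝ) (f : X → ℝ) : ∫ x, r * f x ∂μ = r * ∫ x, f x ∂μ := integral_const_mul r f

abbrev Sm (f : R3 → ℝ) : Prop := ContDiff ℝ (⊤ : ℕ∞) f
abbrev CS (f : R3 → ℝ) : Prop := HasCompactSupport f
lemma Sm.diff {f : R3 → ℝ} (hf : Sm f) : Differentiable ℝ f := hf.differentiable (by simp)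
lemma Sm.cont {f : R3 → ℝ} (hf : Sm f) : Continuous f := hf.continuous
lemma Sm.pd {f : R3 → ℝ} (hf : Sm f) (j : Fin 3) : Sm (pd f j) := by
  unfold _root_.pd
  have h : ContDiff ℝ (⊤ : ℕ∞) (fderiv ℝ f) := hf.fderiv_right (by simp)
  exact h.clm_apply contDiff_const
lemma CS.pd {f : R3 → ℝ} (hf : CS f) (j : Fin 3) : CS (pd f j) :=
  (hf.fderiv (𝕜 := ℝ)).comp_left (g := fun L : R3 →L[ℝ] ℝ => L (EuclideanSpace.single j 1)) (by simp)
lemma tsupport_pd_subset (f : R3 → ℝ) (j : Fin 3) : tsupport (pd f j) ⊆ tsupport f := by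
  refine closure_minimal ?_ (isClosed_tsupport f)
  intro x hx
  by_contra h
  apply hx
  have : x ∉ Function.support (fderiv ℝ f) := fun h2 => h (support_fderiv_subset ℝ h2)
  simp only [Function.mem_support, not_not] at this
  simp [_root_.pd, this]
lemma pd_zero_off {f : R3 → ℝ} {x : R3} (j : Fin 3) (hx : x ∉ tsupport f) : pd f j x = 0 := by
  by_contra h
  exact hx (tsupport_pd_subset f j (subset_tsupport _ h))
lemma pd_add {f g : R3 → ℝ} (hf : Sm f) (hg : Sm g) (j : Fin 3) (x : R3) :
    pd (fun y => f y + g y) j x = pd f j x + pd g j x := by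
  simp [pd, fderiv_fun_add (hf.diff x) (hg.diff x)]
lemma pd_sub {f g : R3 → ℝ} (hf : Sm f) (hg : Sm g) (j : Fin 3) (x : R3) :
    pd (fun y => f y - g y) j x = pd f j x - pd g j x := by
  simp [pd, fderiv_fun_sub (hf.diff x) (hg.diff x)]
lemma pd_mul {f g : R3 → ℝ} (hf : Sm f) (hg : Sm g) (j : Fin 3) (x : R3) :
    pd (fun y => f y * g y) j x = pd f j x * g x + f x * pd g j x := by
  simp [pd, fderiv_fun_mul (hf.diff x) (hg.diff x)]; ring
lemma pd_cmul {f : R3 → ℝ} (hf : Sm f) (c : ℝ) (j : Fin 3) (x : R3) :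
    pd (fun y => c * f y) j x = c * pd f j x := by
  simp [pd, fderiv_const_mul (hf.diff x)]
lemma pd_neg (f : R3 → ℝ) (j : Fin 3) (x : R3) :
    pd (fun y => - f y) j x = - pd f j x := by
  simp [pd]
lemma pd_sum {f : Fin 3 → R3 → ℝ} (hf : ∀ i, Sm (f i)) (j : Fin 3) (x : R3) :
    pd (fun y => ∑ i, f i y) j x = ∑ i, pd (f i) j x := by
  simp [pd, fderiv_fun_sum (fun i _ => (hf i).diff x)]
lemma pd_comm {f : R3 → ℝ} (hf : Sm f) (i j : Fin 3) (x : R3) :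
    pd (pd f i) j x = pd (pd f j) i x := by
  have hd : DifferentiableAt ℝ (fderiv ℝ f) x :=
    ((hf.fderiv_right (m := (⊤ : ℕ∞)) (by simp)).differentiable (by simp)) x
  have key : ∀ k l : Fin 3, pd (pd f k) l x =
      fderiv ℝ (fderiv ℝ f) x (EuclideanSpace.single l 1) (EuclideanSpace.single k 1) := by
    intro k l
    unfold pd
    rw [fderiv_clm_apply hd (by fun_prop)]
    simp
  rw [key, key]
  have hs : IsSymmSndFDerivAt ℝ f x := by
    apply ContDiffAt.isSymmSndFDerivAt (n := (⊤ : ℕ∞)) hf.contDiffAt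
    simp
    exact WithTop.coe_le_coe.2 (le_top : (2 : ℕ∞) ≤ ⊤)
  exact hs.eq _ _
lemma cs_int {f : R3 → ℝ} (hf : Continuous f) (h : CS f) : Integrable f :=
  hf.integrable_of_hasCompactSupport h
lemma CS.mulr {f g : R3 → ℝ} (h : CS g) : CS (fun x => f x * g x) := HasCompactSupport.mul_left h
lemma CS.mull {f g : R3 → ℝ} (h : CS f) : CS (fun x => f x * g x) := HasCompactSupport.mul_right h
lemma ibp {f g : R3 → ℝ} (hf : Sm f) (hg : Sm g) (h : CS g) (j : Fin 3) :
    ∫ x, f x * pd g j x = - ∫ x, pd f j x * g x := by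
  apply integral_mul_fderiv_eq_neg_fderiv_mul_of_integrable
  · exact cs_int ((hf.pd j).cont.mul hg.cont) h.mulr
  · exact cs_int (hf.cont.mul (hg.pd j).cont) (CS.pd h j).mulr
  · exact cs_int (hf.cont.mul hg.cont) h.mulr
  · intro x _; exact hf.diff x
  · intro x _; exact hg.diff x
lemma int_pd {g : R3 → ℝ} (hg : Sm g) (h : CS g) (j : Fin 3) : ∫ x, pd g j x = 0 := by
  have := ibp (f := fun _ => 1) contDiff_const hg h j
  simpa [pd] using this
def cv (K f : R3 → ℝ) (x : R3) : ℝ := ∫ y, K y * f (x - y)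
lemma cv_eq (K f : R3 → ℝ) : cv K f = convolution K f (ContinuousLinearMap.mul ℝ ℝ) volume := by
  ext x; rfl
lemma cv_sm {K f : R3 → ℝ} (hK : LocallyIntegrable K) (hf : Sm f) (h : CS f) : Sm (cv K f) := by
  rw [cv_eq]
  exact h.contDiff_convolution_right (n := ⊤) _ hK hf
lemma pd_cv {K f : R3 → ℝ} (hK : LocallyIntegrable K) (hf : Sm f) (h : CS f) (j : Fin 3) :
    pd (cv K f) j = cv K (pd f j) := by
  ext x
  have h1 := h.hasFDerivAt_convolution_right (ContinuousLinearMap.mul ℝ ℝ) (μ := volume) hK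
    (hf.of_le (by simp)) x
  rw [← cv_eq] at h1
  unfold pd
  rw [h1.fderiv]
  have h2 := (h.fderiv (𝕜 := ℝ)).convolutionExists_right
    ((ContinuousLinearMap.mul ℝ ℝ).precompR R3) hK (hf.continuous_fderiv (by simp)) x
  rw [convolution_def, ContinuousLinearMap.integral_apply h2]
  rfl
lemma cv_swap (K f : R3 → ℝ) (x : R3) : cv K f x = ∫ y, K (x - y) * f y := by
  unfold cv
  rw [← integral_sub_left_eq_self _ volume x]
  simp
def gc : ℝ := (∫ z : R3, Real.exp (-(1/4) * ‖z‖ ^ 2))⁻¹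
def om (z : R3) : ℝ := gc * Real.exp (-(1/4) * ‖z‖ ^ 2)
lemma gauss_integral {b : ℝ} (hb : 0 < b) : (∫ z : R3, Real.exp (-b * ‖z‖ ^ 2)) = (Real.pi / b) ^ ((3:ℝ)/2) := by
  have h := GaussianFourier.integral_rexp_neg_mul_sq_norm (V := R3) hb
  simpa using h
lemma gc_pos : 0 < gc := by
  unfold gc; rw [gauss_integral (by norm_num)]; positivity
lemma gauss_integrable {b : ℝ} (hb : 0 < b) : Integrable (fun z : R3 => Real.exp (-b * ‖z‖ ^ 2)) := by
  by_contra h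
  have h1 := gauss_integral hb
  rw [integral_undef h] at h1
  have : 0 < (Real.pi / b) ^ ((3:ℝ)/2) := by positivity
  linarith
lemma om_pos (z : R3) : 0 < om z := mul_pos gc_pos (Real.exp_pos _)
lemma om_sm : Sm om := by
  unfold om
  exact contDiff_const.mul ((contDiff_const.mul (contDiff_norm_sq ℝ)).exp)
lemma om_le (z : R3) : om z ≤ gc := by
  unfold om
  have : Real.exp (-(1/4) * ‖z‖ ^ 2) ≤ 1 := by
    rw [Real.exp_le_one_iff]; nlinarith [sq_nonneg ‖z‖]
  nlinarith [gc_pos]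
lemma om_int : Integrable om := (gauss_integrable (by norm_num)).const_mul _
lemma om_integral : ∫ z, om z = 1 := by
  unfold om
  rw [icm]
  unfold gc
  apply inv_mul_cancel₀
  rw [gauss_integral (by norm_num)]; positivity
lemma om_norm_int : Integrable (fun z => ‖z‖ * om z) := by
  have h1 : Integrable (fun z : R3 => 8 * gc * Real.exp (-(1/8) * ‖z‖ ^ 2)) :=
    (gauss_integrable (by norm_num)).const_mul _
  refine h1.mono' (by have := om_sm.cont; fun_prop) (evf fun z => ?_)
  rw [nrn (mul_nonneg (norm_nonneg _) (om_pos z).le)]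
  unfold om
  have h2 : Real.exp (-(1/4) * ‖z‖ ^ 2) = Real.exp (-(1/8) * ‖z‖ ^ 2) * Real.exp (-(1/8) * ‖z‖ ^ 2) := by
    rw [← Real.exp_add]; congr 1; ring
  have h3 : ‖z‖ * Real.exp (-(1/8) * ‖z‖ ^ 2) ≤ 8 := by
    have h4 := Real.add_one_le_exp ((1/8) * ‖z‖ ^ 2)
    rw [neg_mul, Real.exp_neg, ← div_eq_mul_inv, div_le_iff₀ (Real.exp_pos _)]
    nlinarith [sq_nonneg (‖z‖ - 1)]
  rw [h2]
  have h5 : 0 < gc * Real.exp (-(1/8) * ‖z‖ ^ 2) := mul_pos gc_pos (Real.exp_pos _)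
  nlinarith
lemma pd_om (j : Fin 3) (z : R3) : pd om j z = -(1/2) * (z j * om z) := by
  unfold pd om
  have h : HasFDerivAt (fun z : R3 => gc * Real.exp (-(1/4) * ‖z‖ ^ 2))
      (gc • (Real.exp (-(1/4) * ‖z‖ ^ 2) • ((-(1/4) : ℝ) • ((2:ℕ) • innerSL ℝ z)))) z :=
    (((hasStrictFDerivAt_norm_sq z).hasFDerivAt.const_mul (-(1/4))).exp).const_mul gc
  rw [h.fderiv]
  simp [EuclideanSpace.inner_single_right]
  ring
def hp (t : ℝ) (f : R3 → ℝ) (x : R3) : ℝ := ∫ z, om z * f (x - t • z)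
def kt (t : ℝ) (y : R3) : ℝ := (t ^ 3)⁻¹ * om (t⁻¹ • y)
lemma kt_cont (t : ℝ) : Continuous (kt t) := by
  unfold kt; have := om_sm.cont; fun_prop
lemma hp_eq {t : ℝ} (ht : 0 < t) (f : R3 → ℝ) : hp t f = cv (kt t) f := by
  ext x
  unfold hp cv kt
  have h := Measure.integral_comp_smul_of_nonneg (μ := (volume : Measure R3))
    (fun y : R3 => (t ^ 3)⁻¹ * om (t⁻¹ • y) * f (x - y)) t (hR := ht.le)
  have h2 : (∫ z : R3, (t ^ 3)⁻¹ * om (t⁻¹ • (t • z)) * f (x - t • z)) = (t^3)⁻¹ * ∫ z, om z * f (x - t • z) := by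
    rw [← icm]
    congr 1; ext z
    rw [smul_smul, inv_mul_cancel₀ ht.ne', one_smul]; ring
  rw [h2] at h
  simp only [finrank_euclideanSpace, Fintype.card_fin, smul_eq_mul] at h
  have h3 : (t^3)⁻¹ ≠ 0 := by positivity
  exact mul_left_cancel₀ h3 h
lemma hp_sm {t : ℝ} (ht : 0 < t) {f : R3 → ℝ} (hf : Sm f) (h : CS f) : Sm (hp t f) := by
  rw [hp_eq ht]; exact cv_sm (kt_cont t).locallyIntegrable hf h
lemma pd_hp {t : ℝ} (ht : 0 < t) {f : R3 → ℝ} (hf : Sm f) (h : CS f) (j : Fin 3) :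
    pd (hp t f) j = hp t (pd f j) := by
  rw [hp_eq ht, hp_eq ht]; exact pd_cv (kt_cont t).locallyIntegrable hf h j
lemma cs_bdd {f : R3 → ℝ} (hf : Continuous f) (h : CS f) : ∃ C, 0 ≤ C ∧ ∀ x, |f x| ≤ C := by
  obtain ⟨C, hC⟩ := hf.bounded_above_of_compact_support h
  exact ⟨C, (norm_nonneg _).trans (hC 0), hC⟩
lemma hp_integrand_int {f : R3 → ℝ} (hf : Continuous f) (h : CS f) (t : ℝ) (x : R3) :
    Integrable (fun z => om z * f (x - t • z)) := by
  obtain ⟨C, hC0, hC⟩ := cs_bdd hf h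
  refine (om_int.mul_const C).mono' ?_ (evf fun z => ?_)
  · exact (om_sm.cont.mul (by fun_prop)).aestronglyMeasurable
  · rw [norm_mul, nrn (om_pos z).le]
    exact mll (hC _) (om_pos z).le
lemma hp_cont {f : R3 → ℝ} (hf : Continuous f) (h : CS f) :
    Continuous (fun q : ℝ × R3 => hp q.1 f q.2) := by
  obtain ⟨C, hC0, hC⟩ := cs_bdd hf h
  unfold hp
  refine continuous_of_dominated (bound := fun z => om z * C) ?_ ?_ ?_ ?_
  · intro q
    exact (om_sm.cont.mul (by fun_prop)).aestronglyMeasurable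
  · intro q
    refine evf fun z => ?_
    rw [norm_mul, nrn (om_pos z).le]
    exact mll (hC _) (om_pos z).le
  · exact om_int.mul_const C
  · refine evf fun z => ?_
    fun_prop
lemma hp_bdd {f : R3 → ℝ} (hf : Continuous f) (h : CS f) {C : ℝ} (hC : ∀ x, |f x| ≤ C) (t : ℝ) (x : R3) :
    |hp t f x| ≤ C := by
  unfold hp
  calc |∫ z, om z * f (x - t • z)| ≤ ∫ z, om z * C := by
        rw [← Real.norm_eq_abs]
        refine norm_integral_le_of_norm_le (om_int.mul_const C) (evf fun z => ?_)
        rw [norm_mul, nrn (om_pos z).le]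
        exact mll (hC _) (om_pos z).le
    _ = C := by rw [integral_mul_const, om_integral, one_mul]
lemma hp_decay {f : R3 → ℝ} (hf : Continuous f) (h : CS f) {t : ℝ} (ht : 0 < t) (x : R3) :
    |hp t f x| ≤ gc * (t ^ 3)⁻¹ * ∫ y, |f y| := by
  rw [hp_eq ht, cv_swap]
  rw [← icm, ← Real.norm_eq_abs]
  refine norm_integral_le_of_norm_le ((cs_int hf h).abs.const_mul _) (evf fun y => ?_)
  rw [norm_mul]
  refine mlr ?_ (norm_nonneg _)
  unfold kt
  rw [nrn (mul_nonneg (by positivity) (om_pos _).le)]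
  have := om_le (t⁻¹ • (x - y))
  have h3 : 0 < (t^3)⁻¹ := by positivity
  nlinarith
lemma aff_sm {f : R3 → ℝ} (hf : Sm f) (x : R3) (t : ℝ) : Sm (fun z => f (x - t • z)) :=
  hf.comp (contDiff_const.sub (contDiff_id.const_smul t))
lemma aff_cs {f : R3 → ℝ} (hf : CS f) (x : R3) {t : ℝ} (ht : t ≠ 0) : CS (fun z => f (x - t • z)) := by
  have := hf.comp_homeomorph ((Homeomorph.smulOfNeZero t ht).trans (Homeomorph.subLeft x))
  exact this
lemma pd_aff {f : R3 → ℝ} (hf : Sm f) (x : R3) (t : ℝ) (j : Fin 3) (z : R3) :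
    pd (fun z => f (x - t • z)) j z = - t * pd f j (x - t • z) := by
  unfold pd
  have h1 : HasFDerivAt (fun z : R3 => x - t • z) (-(t • ContinuousLinearMap.id ℝ R3)) z := by
    simpa using ((hasFDerivAt_id z).const_smul t).const_sub x
  have h := (hf.diff (x - t • z)).hasFDerivAt.comp z h1
  have h2 : fderiv ℝ (fun z => f (x - t • z)) z = _ := h.fderiv
  rw [h2]
  simp
lemma fderiv_eq_sum (f : R3 → ℝ) (x v : R3) : fderiv ℝ f x v = ∑ j, v j * pd f j x := by
  unfold pd
  have hv : v = ∑ j, v j • EuclideanSpace.single j (1:ℝ) := by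
    ext i; simp [Finset.sum_apply, Pi.single_apply]
  conv_lhs => rw [hv]
  simp [map_sum]
lemma hp_deriv {f : R3 → ℝ} (hf : Sm f) (h : CS f) (x : R3) {t : ℝ} (ht : 0 < t) :
    HasDerivAt (fun t => hp t f x) (2 * t * ∑ j, hp t (pd (pd f j) j) x) t := by
  obtain ⟨C, hC0, hC⟩ : ∃ C, 0 ≤ C ∧ ∀ x, ‖fderiv ℝ f x‖ ≤ C := by
    obtain ⟨C, hC⟩ := (hf.continuous_fderiv (by simp)).bounded_above_of_compact_support (h.fderiv (𝕜 := ℝ))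
    exact ⟨C, (norm_nonneg _).trans (hC 0), hC⟩
  have hc1 := hf.continuous_fderiv (by simp)
  have hc := hf.cont
  have ho := om_sm.cont
  have key := hasDerivAt_integral_of_dominated_loc_of_deriv_le (μ := (volume : Measure R3))
    (F := fun t z => om z * f (x - t • z)) (F' := fun t z => om z * fderiv ℝ f (x - t • z) (-z))
    (x₀ := t) (s := Set.univ) (bound := fun z => C * (‖z‖ * om z)) univ_mem
    (evf fun s => (hp_integrand_int hc h s x).aestronglyMeasurable)
    (hp_integrand_int hc h t x)
    (by
      refine Continuous.aestronglyMeasurable ?_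
      fun_prop)
    (evf fun z s _ => by
      rw [norm_mul, nrn (om_pos z).le]
      have := (fderiv ℝ f (x - s • z)).le_opNorm (-z)
      rw [norm_neg] at this
      have h2 := mlr (hC (x - s • z)) (norm_nonneg z)
      nlinarith [om_pos z])
    (om_norm_int.const_mul C)
    (evf fun z s _ => by
      have h1 : HasDerivAt (fun s : ℝ => x - s • z) (-z) s := by
        simpa using ((hasDerivAt_id s).smul_const z).const_sub x
      exact ((hf.diff (x - s • z)).hasFDerivAt.comp_hasDerivAt s h1).const_mul (om z))
  have h2 := key.2
  suffices hs : (2 * t * ∑ j, hp t (pd (pd f j) j) x) = ∫ (a : R3), om a * (fderiv ℝ f (x - t • a)) (-a) by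
    rw [hs]; exact h2
  have e1 : ∀ j, ∫ z, om z * ((-z) j * pd f j (x - t • z)) = 2 * t * hp t (pd (pd f j) j) x := by
    intro j
    have e2 : ∀ z : R3, om z * ((-z) j * pd f j (x - t • z)) = 2 * (pd om j z * pd f j (x - t • z)) := by
      intro z; rw [pd_om, PiLp.neg_apply]; ring
    simp_rw [e2]
    rw [icm]
    have e3 := ibp om_sm (aff_sm (hf.pd j) x t) (aff_cs (CS.pd h j) x ht.ne') j
    have e4 : ∫ z, om z * pd (fun z => pd f j (x - t • z)) j z = - t * hp t (pd (pd f j) j) x := by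
      unfold hp
      rw [← icm]
      congr 1; ext z
      rw [pd_aff (hf.pd j)]; ring
    rw [e4] at e3
    linarith
  have e0 : (fun z => om z * fderiv ℝ f (x - t • z) (-z)) = fun z => ∑ j, om z * ((-z) j * pd f j (x - t • z)) := by
    ext z; rw [fderiv_eq_sum, Finset.mul_sum]
  rw [e0, Finset.mul_sum]
  rw [integral_finset_sum]
  · exact Finset.sum_congr rfl fun j _ => (e1 j).symm
  · intro j _
    have hcc := ((hf.pd j).cont)
    obtain ⟨D, hD0, hD⟩ := cs_bdd hcc (CS.pd h j)
    refine (om_norm_int.const_mul D).mono' ?_ (evf fun z => ?_)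
    · refine Continuous.aestronglyMeasurable ?_
      fun_prop
    · rw [norm_mul, nrn (om_pos z).le, norm_mul]
      have a1 : ‖(-z) j‖ ≤ ‖z‖ := by
        rw [← norm_neg z]; exact PiLp.norm_apply_le (-z) j
      have a2 := hD (x - t • z)
      have a3 : ‖(-z) j‖ * ‖pd f j (x - t • z)‖ ≤ ‖z‖ * D := mul_le_mul a1 a2 (norm_nonneg _) (norm_nonneg _)
      nlinarith [om_pos z]
lemma hp_pos {f : R3 → ℝ} (hf : Continuous f) (h : CS f) (h0 : ∀ x, 0 ≤ f x) (h1 : ∃ x, f x ≠ 0)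
    {t : ℝ} (ht : 0 < t) (x : R3) : 0 < hp t f x := by
  obtain ⟨x0, hx0⟩ := h1
  unfold hp
  apply Continuous.integral_pos_of_hasCompactSupport_nonneg_nonzero (x := t⁻¹ • (x - x0))
  · exact om_sm.cont.mul (by fun_prop)
  · exact (aff_cs h x ht.ne').mulr
  · intro z; exact mul_nonneg (om_pos z).le (h0 _)
  · rw [smul_smul, mul_inv_cancel₀ ht.ne', one_smul]
    simpa using ⟨(om_pos _).ne', hx0⟩
lemma tangent {m c s : ℝ} (hm : 1 ≤ m) (hc : 0 < c) (hs : 0 ≤ s) :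
    c ^ m + m * c ^ (m - 1) * (s - c) ≤ s ^ m := by
  have h := one_add_mul_self_le_rpow_one_add (s := s / c - 1) (by
    have : 0 ≤ s / c := by positivity
    linarith) hm
  have e1 : (1 + (s / c - 1)) = s / c := by ring
  rw [e1, Real.div_rpow hs hc.le, le_div_iff₀ (by positivity)] at h
  have e2 : c ^ m = c ^ (m - 1) * c := by
    rw [← Real.rpow_add_one hc.ne']; ring_nf
  calc c ^ m + m * c ^ (m - 1) * (s - c) = (1 + m * (s / c - 1)) * c ^ m := by
        rw [e2]; field_simp
    _ ≤ _ := h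
lemma rpow_cs {f : R3 → ℝ} (h : CS f) {m : ℝ} (hm : 0 < m) : CS (fun x => |f x| ^ m) :=
  h.comp_left (g := fun y => |y| ^ m) (by simp [Real.zero_rpow hm.ne'])
lemma rpow_ct {f : R3 → ℝ} (h : Continuous f) {m : ℝ} (hm : 0 < m) : Continuous (fun x => |f x| ^ m) :=
  h.abs.rpow_const (fun x => Or.inr hm.le)
lemma hp_mono {f g : R3 → ℝ} (hf : Continuous f) (h : CS f) (hg : Continuous g) (h' : CS g)
    (hfg : ∀ x, f x ≤ g x) (t : ℝ) (x : R3) : hp t f x ≤ hp t g x :=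
  integral_mono (hp_integrand_int hf h t x) (hp_integrand_int hg h' t x)
    (fun z => mll (hfg _) (om_pos z).le)
lemma hp_abs {f : R3 → ℝ} (t : ℝ) (x : R3) :
    |hp t f x| ≤ hp t (fun x => |f x|) x := by
  unfold hp
  have := norm_integral_le_integral_norm (μ := (volume : Measure R3)) (fun z => om z * f (x - t • z))
  simp only [Real.norm_eq_abs, abs_mul, abs_of_pos (om_pos _)] at this
  exact this
lemma hp_nonneg {f : R3 → ℝ} (h : ∀ x, 0 ≤ f x) (t : ℝ) (x : R3) : 0 ≤ hp t f x :=
  integral_nonneg fun z => mul_nonneg (om_pos z).le (h _)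
lemma jensen {f : R3 → ℝ} (hf : Continuous f) (h : CS f) {m : ℝ} (hm : 1 ≤ m) (t : ℝ) (x : R3) :
    |hp t f x| ^ m ≤ hp t (fun x => |f x| ^ m) x := by
  have hm0 : 0 < m := by linarith
  have h0 : |hp t f x| ^ m ≤ (hp t (fun x => |f x|) x) ^ m :=
    rle' (abs_nonneg _) (hp_abs t x) hm0.le
  refine h0.trans ?_
  have ha : CS (fun x => |f x|) := h.comp_left (g := fun y => |y|) (by simp)
  set c := hp t (fun x => |f x|) x with hc
  have hc0 : 0 ≤ c := hp_nonneg (fun x => abs_nonneg _) t x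
  rcases hc0.eq_or_lt with hc1 | hc1
  · rw [← hc1, Real.zero_rpow hm0.ne']
    exact hp_nonneg (fun x => by positivity) t x
  have i1 := hp_integrand_int hf.abs ha t x
  have i2 := hp_integrand_int (rpow_ct hf hm0) (rpow_cs h hm0) t x
  have key : ∫ z, (om z * (c ^ m - m * c ^ (m - 1) * c) + m * c ^ (m - 1) * (om z * |f (x - t • z)|)) ≤
      hp t (fun x => |f x| ^ m) x := by
    refine integral_mono ((om_int.mul_const _).add (i1.const_mul _)) i2 fun z => ?_
    have := tangent hm hc1 (abs_nonneg (f (x - t • z)))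
    have h3 := mll this (om_pos z).le
    simp only
    nlinarith
  rw [integral_add (om_int.mul_const _) (i1.const_mul _), integral_mul_const, om_integral, icm] at key
  have : ∫ z, om z * |f (x - t • z)| = c := rfl
  rw [this] at key
  linarith
lemma kt_integral {t : ℝ} (ht : 0 < t) : ∫ y, kt t y = 1 := by
  have h : hp t (fun _ => 1) 0 = cv (kt t) (fun _ => 1) 0 := by rw [hp_eq ht]
  simp only [hp, cv, mul_one, om_integral] at h
  exact h.symm
lemma kt_int {t : ℝ} (ht : 0 < t) : Integrable (kt t) := by
  by_contra h
  have := kt_integral ht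
  rw [integral_undef h] at this
  norm_num at this
lemma hp_integrable {t : ℝ} (ht : 0 < t) {f : R3 → ℝ} (hf : Integrable f) : Integrable (hp t f) := by
  rw [hp_eq ht, cv_eq]
  exact (kt_int ht).integrable_convolution _ hf
lemma hp_integral {t : ℝ} (ht : 0 < t) {f : R3 → ℝ} (hf : Integrable f) : ∫ x, hp t f x = ∫ x, f x := by
  rw [hp_eq ht, cv_eq, integral_convolution _ (kt_int ht) hf, kt_integral ht]
  simp
lemma hp_contr {f : R3 → ℝ} (hf : Continuous f) (h : CS f) {m : ℝ} (hm : 1 ≤ m) {t : ℝ} (ht : 0 < t) :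
    Integrable (fun x => |hp t f x| ^ m) ∧ ∫ x, |hp t f x| ^ m ≤ ∫ x, |f x| ^ m := by
  have hm0 : 0 < m := by linarith
  have i1 : Integrable (fun x => |f x| ^ m) := cs_int (rpow_ct hf hm0) (rpow_cs h hm0)
  have i2 := hp_integrable ht i1
  have c1 : Continuous (hp t f) := (hp_cont hf h).comp (by fun_prop : Continuous fun x : R3 => (t, x))
  have i3 : Integrable (fun x => |hp t f x| ^ m) := by
    refine i2.mono' (rpow_ct c1 hm0).aestronglyMeasurable (evf fun x => ?_)
    rw [nrn (by positivity)]
    exact jensen hf h hm t x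
  refine ⟨i3, ?_⟩
  rw [← hp_integral ht i1]
  exact integral_mono i3 i2 fun x => jensen hf h hm t x
lemma pd_rpow {G : R3 → ℝ} (hG : Sm G) (h0 : ∀ x, 0 < G x) (s : ℝ) (j : Fin 3) (x : R3) :
    pd (fun y => G y ^ s) j x = s * G x ^ (s - 1) * pd G j x := by
  unfold pd
  have h := (hG.diff x).hasFDerivAt.rpow_const (p := s) (Or.inl (h0 x).ne')
  rw [h.fderiv]
  simp
lemma sm_rpow {G : R3 → ℝ} (hG : Sm G) (h0 : ∀ x, 0 < G x) (s : ℝ) : Sm (fun y => G y ^ s) :=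
  hG.rpow_const_of_ne (fun x => (h0 x).ne')
lemma pd_sq {F : R3 → ℝ} (hF : Sm F) (j : Fin 3) (x : R3) : pd (fun y => F y ^ 2) j x = 2 * F x * pd F j x := by
  have := pd_mul hF hF j x
  simp_rw [← sq] at this
  rw [this]; ring
lemma hess_alg {τ a g x y : ℝ} (ht1 : 1/2 ≤ τ) (ht2 : τ ≤ 5/7) (hg : 0 < g) (ha : a ^ 2 ≤ g ^ (2 * (1 - τ))) :
    g ^ τ * x ^ 2 + g ^ (-τ) * y ^ 2 ≤
      2 * g ^ τ * x ^ 2 + 4 * τ * a * g ^ (τ - 1) * (x * y) +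
      (20 * (2 - τ) * (1 - τ) * g ^ (-τ) + τ * (τ - 1) * a ^ 2 * g ^ (τ - 2)) * y ^ 2 := by
  set S := g ^ τ with hS
  have hS0 : 0 < S := by positivity
  have e1 : g ^ (-τ) = S⁻¹ := Real.rpow_neg hg.le τ
  have e2 : a ^ 2 * g ^ (τ - 2) ≤ S⁻¹ := by
    calc a ^ 2 * g ^ (τ - 2) ≤ g ^ (2 * (1 - τ)) * g ^ (τ - 2) := by gcongr
      _ = g ^ (-τ) := by rw [← Real.rpow_add hg]; ring_nf
      _ = S⁻¹ := e1
  have e3 : (a * g ^ (τ - 1)) ^ 2 ≤ 1 := by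
    calc (a * g ^ (τ - 1)) ^ 2 = a ^ 2 * (g ^ (τ - 1)) ^ 2 := by ring
      _ ≤ g ^ (2 * (1 - τ)) * (g ^ (τ - 1)) ^ 2 := by gcongr
      _ = 1 := by
        rw [← rnc (g ^ (τ - 1)) 2, ← rmu hg.le, ← Real.rpow_add hg]
        have : 2 * (1 - τ) + (τ - 1) * ((2:ℕ):ℝ) = 0 := by push_cast; ring
        rw [this, Real.rpow_zero]
  set b := a * g ^ (τ - 1) with hb
  have hb1 : |b| ≤ 1 := abs_le_one_iff_mul_self_le_one.2 (by nlinarith)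
  rw [abs_le] at hb1
  rw [e1]
  set r := S⁻¹ with hr
  have hr0 : 0 < r := by positivity
  have hrs : r * S = 1 := inv_mul_cancel₀ hS0.ne'
  have q1 : 0 ≤ S * (x + 2 * τ * b * r * y) ^ 2 := by positivity
  have q2 : S * (x + 2 * τ * b * r * y) ^ 2 = S * x ^ 2 + 4 * τ * b * (r * S) * (x * y) + 4 * τ ^ 2 * b ^ 2 * r * (r * S) * y ^ 2 := by ring
  rw [q2, hrs] at q1
  have q3 : τ ^ 2 * b ^ 2 ≤ 1 * 1 := by
    refine mul_le_mul (by nlinarith) e3 (sq_nonneg _) zero_le_one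
  have q4 : 5 * r ≤ 20 * (2 - τ) * (1 - τ) * r + τ * (τ - 1) * (a ^ 2 * g ^ (τ - 2)) := by
    have : τ * (1 - τ) * (a ^ 2 * g ^ (τ - 2)) ≤ τ * (1 - τ) * r :=
      mll e2 (by nlinarith)
    nlinarith
  have q5 := mlr q4 (sq_nonneg y)
  have q6 : τ ^ 2 * b ^ 2 * (r * y ^ 2) ≤ 1 * 1 * (r * y ^ 2) := mlr q3 (by positivity)
  have e5 : 4 * τ * a * g ^ (τ - 1) * (x * y) = 4 * τ * b * (x * y) := by rw [hb]; ring
  have e6 : τ * (τ - 1) * a ^ 2 * g ^ (τ - 2) = τ * (τ - 1) * (a ^ 2 * g ^ (τ - 2)) := by ring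
  rw [e5, e6]
  nlinarith
def Wq (τ : ℝ) (F G : R3 → ℝ) (x : R3) : ℝ := 20 * G x ^ (2 - τ) + F x ^ 2 * G x ^ τ
def Qa (τ : ℝ) (F G : R3 → ℝ) (x : R3) : ℝ := 2 * (F x * G x ^ τ)
def Qg (τ : ℝ) (F G : R3 → ℝ) (x : R3) : ℝ := 20 * (2 - τ) * G x ^ (1 - τ) + τ * (F x ^ 2 * G x ^ (τ - 1))
section
variable {τ : ℝ} {F G : R3 → ℝ}
lemma Wq_sm (hF : Sm F) (hG : Sm G) (h0 : ∀ x, 0 < G x) : Sm (Wq τ F G) :=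
  (contDiff_const.mul (sm_rpow hG h0 _)).add ((hF.pow 2).mul (sm_rpow hG h0 _))
lemma Qa_sm (hF : Sm F) (hG : Sm G) (h0 : ∀ x, 0 < G x) : Sm (Qa τ F G) :=
  contDiff_const.mul (hF.mul (sm_rpow hG h0 _))
lemma Qg_sm (hF : Sm F) (hG : Sm G) (h0 : ∀ x, 0 < G x) : Sm (Qg τ F G) :=
  (contDiff_const.mul (sm_rpow hG h0 _)).add (contDiff_const.mul ((hF.pow 2).mul (sm_rpow hG h0 _)))
lemma pd_Wq (hF : Sm F) (hG : Sm G) (h0 : ∀ x, 0 < G x) (j : Fin 3) (x : R3) :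
    pd (Wq τ F G) j x = Qa τ F G x * pd F j x + Qg τ F G x * pd G j x := by
  unfold Wq Qa Qg
  rw [pd_add (contDiff_const.mul (sm_rpow hG h0 _)) ((hF.pow 2).mul (sm_rpow hG h0 _)),
    pd_cmul (sm_rpow hG h0 _), pd_mul (hF.pow 2) (sm_rpow hG h0 _), pd_rpow hG h0, pd_rpow hG h0, pd_sq hF]
  have : (2 - τ - 1) = 1 - τ := by ring
  rw [this]; ring
lemma pd_Qa (hF : Sm F) (hG : Sm G) (h0 : ∀ x, 0 < G x) (j : Fin 3) (x : R3) :
    pd (Qa τ F G) j x = 2 * G x ^ τ * pd F j x + 2 * τ * F x * G x ^ (τ - 1) * pd G j x := by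
  unfold Qa
  rw [pd_cmul (hF.mul (sm_rpow hG h0 _)), pd_mul hF (sm_rpow hG h0 _), pd_rpow hG h0]; ring
lemma pd_Qg (hF : Sm F) (hG : Sm G) (h0 : ∀ x, 0 < G x) (j : Fin 3) (x : R3) :
    pd (Qg τ F G) j x = 2 * τ * F x * G x ^ (τ - 1) * pd F j x +
      (20 * (2 - τ) * (1 - τ) * G x ^ (-τ) + τ * (τ - 1) * F x ^ 2 * G x ^ (τ - 2)) * pd G j x := by
  unfold Qg
  rw [pd_add (contDiff_const.mul (sm_rpow hG h0 _)) (contDiff_const.mul ((hF.pow 2).mul (sm_rpow hG h0 _))),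
    pd_cmul (sm_rpow hG h0 _), pd_cmul ((hF.pow 2).mul (sm_rpow hG h0 _)),
    pd_mul (hF.pow 2) (sm_rpow hG h0 _), pd_rpow hG h0, pd_rpow hG h0, pd_sq hF]
  have e1 : (1 - τ - 1) = -τ := by ring
  have e2 : (τ - 1 - 1) = τ - 2 := by ring
  rw [e1, e2]; ring
lemma bell1 (hF : Sm F) (hG : Sm G) (h0 : ∀ x, 0 < G x) {η : R3 → ℝ} (hη : Sm η) (hc : CS η)
    (hη0 : ∀ x, 0 ≤ η x) (ht1 : 1/2 ≤ τ) (ht2 : τ ≤ 5/7)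
    (hFG : ∀ x, F x ^ 2 ≤ G x ^ (2 * (1 - τ))) (j : Fin 3) :
    ∫ x, η x * (Qa τ F G x * pd (pd F j) j x + Qg τ F G x * pd (pd G j) j x) ≤
      (∫ x, Wq τ F G x * pd (pd η j) j x) -
      ∫ x, η x * (G x ^ τ * pd F j x ^ 2 + G x ^ (-τ) * pd G j x ^ 2) := by
  have sA := Qa_sm (τ := τ) hF hG h0
  have sB := Qg_sm (τ := τ) hF hG h0
  have sW := Wq_sm (τ := τ) hF hG h0
  have i1 := ibp (hF.pd j) (hη.mul sA) hc.mull j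
  have i2 := ibp (hG.pd j) (hη.mul sB) hc.mull j
  have i3 := ibp sW (hη.pd j) (hc.pd j) j
  have cp : ∀ {k l : R3 → ℝ}, Continuous k → Continuous l → CS k → Integrable (fun x => k x * l x) :=
    fun h1 h2 h3 => cs_int (h1.mul h2) h3.mull
  have cq : ∀ {k l : R3 → ℝ}, Continuous k → Continuous l → CS l → Integrable (fun x => k x * l x) :=
    fun h1 h2 h3 => cs_int (h1.mul h2) h3.mulr
  have e0 : ∫ x, η x * (Qa τ F G x * pd (pd F j) j x + Qg τ F G x * pd (pd G j) j x) =
      (∫ x, pd (pd F j) j x * (η x * Qa τ F G x)) + ∫ x, pd (pd G j) j x * (η x * Qg τ F G x) := by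
    have k1 : Integrable (fun x => pd (pd F j) j x * (η x * Qa τ F G x)) :=
      cq ((hF.pd j).pd j).cont (hη.cont.mul sA.cont) hc.mull
    have k2 : Integrable (fun x => pd (pd G j) j x * (η x * Qg τ F G x)) :=
      cq ((hG.pd j).pd j).cont (hη.cont.mul sB.cont) hc.mull
    rw [← integral_add k1 k2]
    congr 1; ext x; ring
  have j1 : Integrable (fun x => pd F j x * pd (fun y => η y * Qa τ F G y) j x) :=
    cq (hF.pd j).cont (Sm.pd (hη.mul sA) j).cont (CS.pd hc.mull j)
  have j2 : Integrable (fun x => pd G j x * pd (fun y => η y * Qg τ F G y) j x) :=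
    cq (hG.pd j).cont (Sm.pd (hη.mul sB) j).cont (CS.pd hc.mull j)
  have j3 : Integrable (fun x => pd (Wq τ F G) j x * pd η j x) := cq (sW.pd j).cont (hη.pd j).cont (hc.pd j)
  have j4 : Integrable (fun x => η x * (G x ^ τ * pd F j x ^ 2 + G x ^ (-τ) * pd G j x ^ 2)) := by
    refine cp hη.cont ?_ hc
    exact ((sm_rpow hG h0 _).cont.mul ((hF.pd j).cont.pow 2)).add ((sm_rpow hG h0 _).cont.mul ((hG.pd j).cont.pow 2))
  have fin : ∫ x, (pd (Wq τ F G) j x * pd η j x + η x * (G x ^ τ * pd F j x ^ 2 + G x ^ (-τ) * pd G j x ^ 2)) ≤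
      ∫ x, (pd F j x * pd (fun y => η y * Qa τ F G y) j x + pd G j x * pd (fun y => η y * Qg τ F G y) j x) := by
    refine integral_mono (j3.add j4) (j1.add j2) fun x => ?_
    simp only
    rw [pd_Wq hF hG h0, pd_mul hη sA, pd_mul hη sB, pd_Qa hF hG h0, pd_Qg hF hG h0]
    have := hess_alg (x := pd F j x) (y := pd G j x) ht1 ht2 (h0 x) (hFG x)
    have h3 := mll this (hη0 x)
    nlinarith
  rw [integral_add j3 j4, integral_add j1 j2] at fin
  linarith
lemma bell2 (hF : Sm F) (hG : Sm G) (h0 : ∀ x, 0 < G x) {η : R3 → ℝ} (hη : Sm η) (hc : CS η)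
    (hη0 : ∀ x, 0 ≤ η x) (ht1 : 1/2 ≤ τ) (ht2 : τ ≤ 5/7)
    (hFG : ∀ x, F x ^ 2 ≤ G x ^ (2 * (1 - τ))) (i j : Fin 3) :
    (∫ x, η x * (Qa τ F G x * lap F x + Qg τ F G x * lap G x)) + (∫ x, η x * (|pd F i x| * |pd G j x|)) ≤
      ∫ x, Wq τ F G x * lap η x := by
  have sA := Qa_sm (τ := τ) hF hG h0
  have sB := Qg_sm (τ := τ) hF hG h0
  have sW := Wq_sm (τ := τ) hF hG h0
  have b := Finset.sum_le_sum (s := Finset.univ) fun k _ => bell1 hF hG h0 hη hc hη0 ht1 ht2 hFG k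
  rw [Finset.sum_sub_distrib] at b
  have cp : ∀ {l : R3 → ℝ}, Continuous l → Integrable (fun x => η x * l x) :=
    fun h2 => cs_int (hη.cont.mul h2) hc.mull
  rw [← integral_finsetSum, ← integral_finsetSum, ← integral_finsetSum] at b
  · have e1 : ∀ x, ∑ k, η x * (Qa τ F G x * pd (pd F k) k x + Qg τ F G x * pd (pd G k) k x) =
        η x * (Qa τ F G x * lap F x + Qg τ F G x * lap G x) := by
      intro x; unfold lap
      rw [← Finset.mul_sum, Finset.sum_add_distrib, Finset.mul_sum, Finset.mul_sum]
    have e2 : ∀ x, ∑ k, Wq τ F G x * pd (pd η k) k x = Wq τ F G x * lap η x := by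
      intro x; unfold lap; rw [Finset.mul_sum]
    simp_rw [e1, e2] at b
    have fin : ∫ x, η x * (|pd F i x| * |pd G j x|) ≤
        ∫ x, ∑ k, η x * (G x ^ τ * pd F k x ^ 2 + G x ^ (-τ) * pd G k x ^ 2) := by
      refine integral_mono (cp ((hF.pd i).cont.abs.mul (hG.pd j).cont.abs)) (integrable_finsetSum _ fun k _ => cp ?_) fun x => ?_
      · exact ((sm_rpow hG h0 _).cont.mul ((hF.pd k).cont.pow 2)).add ((sm_rpow hG h0 _).cont.mul ((hG.pd k).cont.pow 2))
      · simp only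
        rw [← Finset.mul_sum]
        refine mll ?_ (hη0 x)
        rw [Finset.sum_add_distrib]
        have g0 := h0 x
        have a1 := Finset.single_le_sum (f := fun k => G x ^ τ * pd F k x ^ 2) (fun k _ => by positivity) (Finset.mem_univ i)
        have a2 := Finset.single_le_sum (f := fun k => G x ^ (-τ) * pd G k x ^ 2) (fun k _ => by positivity) (Finset.mem_univ j)
        refine le_trans ?_ (add_le_add a1 a2)
        rw [Real.rpow_neg g0.le, ← sq_abs (pd F i x), ← sq_abs (pd G j x)]
        set S := G x ^ τ with hS
        have hS0 : 0 < S := by positivity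
        have hrs : S⁻¹ * S = 1 := inv_mul_cancel₀ hS0.ne'
        set r := S⁻¹
        have hr0 : 0 < r := by positivity
        have q : 0 ≤ S * (|pd F i x| - r * |pd G j x|) ^ 2 := by positivity
        have q2 : S * (|pd F i x| - r * |pd G j x|) ^ 2 = S * |pd F i x| ^ 2 - 2 * (r * S) * (|pd F i x| * |pd G j x|) + (r * S) * r * |pd G j x| ^ 2 := by ring
        rw [q2, hrs] at q
        have : 0 ≤ |pd F i x| * |pd G j x| := by positivity
        linarith
    linarith
  · intro k _; refine cp ?_
    exact ((sm_rpow hG h0 _).cont.mul ((hF.pd k).cont.pow 2)).add ((sm_rpow hG h0 _).cont.mul ((hG.pd k).cont.pow 2))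
  · intro k _
    exact cs_int (sW.cont.mul ((hη.pd k).pd k).cont) (CS.pd (CS.pd hc k) k).mulr
  · intro k _; refine cp ?_
    exact (sA.cont.mul ((hF.pd k).pd k).cont).add (sB.cont.mul ((hG.pd k).pd k).cont)
end
lemma par_cont {H : ℝ → R3 → ℝ} (hH : Continuous H.uncurry) {K : Set R3} (hK : IsCompact K)
    (h0 : ∀ t, ∀ x, x ∉ K → H t x = 0) : Continuous (fun t => ∫ x, H t x) := by
  have h := continuous_parametric_integral_of_continuous (μ := (volume : Measure R3)) hH hK
  have e : ∀ t, ∫ x in K, H t x = ∫ x, H t x := fun t =>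
    setIntegral_eq_integral_of_forall_compl_eq_zero fun x hx => h0 t x hx
  simpa [e] using h
lemma par_swap {H : ℝ → R3 → ℝ} (hH : Continuous H.uncurry) {K : Set R3} (hK : IsCompact K)
    (h0 : ∀ t, ∀ x, x ∉ K → H t x = 0) (a b : ℝ) :
    ∫ t in a..b, ∫ x, H t x = ∫ x, ∫ t in a..b, H t x := by
  apply intervalIntegral_integral_swap
  have e : ((volume : Measure ℝ).restrict (Set.uIoc a b)).prod (volume : Measure R3) =
      ((volume : Measure ℝ).prod volume).restrict (Set.uIoc a b ×ˢ Set.univ) := by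
    rw [← Measure.prod_restrict, Measure.restrict_univ]
  rw [e]
  have h1 : IntegrableOn H.uncurry (Set.uIcc a b ×ˢ K) ((volume : Measure ℝ).prod volume) :=
    hH.continuousOn.integrableOn_compact (isCompact_uIcc.prod hK)
  have h2 : IntegrableOn H.uncurry (Set.uIoc a b ×ˢ K) ((volume : Measure ℝ).prod volume) :=
    h1.mono_set (Set.prod_mono Set.uIoc_subset_uIcc le_rfl)
  refine h2.of_forall_sdiff_eq_zero (measurableSet_uIoc.prod MeasurableSet.univ) ?_
  rintro ⟨t, x⟩ ⟨h3, h4⟩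
  apply h0
  intro hx
  exact h4 ⟨h3.1, hx⟩
lemma lap_hp {t : ℝ} (ht : 0 < t) {f : R3 → ℝ} (hf : Sm f) (h : CS f) (x : R3) :
    lap (hp t f) x = ∑ j, hp t (pd (pd f j) j) x := by
  unfold lap
  refine Finset.sum_congr rfl fun j _ => ?_
  rw [pd_hp ht hf h, pd_hp ht (hf.pd j) (h.pd j)]
structure Pr (τ m : ℝ) (f g : R3 → ℝ) : Prop where
  t1 : 1/2 ≤ τ
  t2 : τ ≤ 5/7
  tm : (1 - τ) * m = 1
  fs : Sm f
  fc : CS f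
  gs : Sm g
  gcs : CS g
  le : ∀ x, |f x| ^ m ≤ g x
  ne : ∃ x, g x ≠ 0
section
variable {τ m : ℝ} {f g : R3 → ℝ}
lemma Pr.m1 (P : Pr τ m f g) : 1 ≤ m := by
  have h1 := P.t1; have h2 := P.t2; have h3 := P.tm
  by_contra h
  push Not at h
  nlinarith
lemma Pr.g0 (P : Pr τ m f g) (x : R3) : 0 ≤ g x := (rnn (abs_nonneg _) _).trans (P.le x)
lemma Pr.pos (P : Pr τ m f g) {t : ℝ} (ht : 0 < t) (x : R3) : 0 < hp t g x :=
  hp_pos P.gs.cont P.gcs P.g0 P.ne ht x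
lemma Pr.sq (P : Pr τ m f g) {t : ℝ} (ht : 0 < t) (x : R3) : hp t f x ^ 2 ≤ hp t g x ^ (2 * (1 - τ)) := by
  have hm := P.m1
  have hm0 : 0 < m := by linarith
  have h1 : |hp t f x| ^ m ≤ hp t g x := (jensen P.fs.cont P.fc hm t x).trans
    (hp_mono (rpow_ct P.fs.cont hm0) (rpow_cs P.fc hm0) P.gs.cont P.gcs P.le t x)
  have h2 := rle' (by positivity) h1 (z := 2 * (1 - τ)) (by have := P.t2; linarith)
  rw [← rmu (abs_nonneg _)] at h2
  have e : m * (2 * (1 - τ)) = ((2:ℕ):ℝ) := by push_cast; linarith [P.tm]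
  rw [e, rnc, sq_abs] at h2
  exact h2
lemma Pr.W0 (P : Pr τ m f g) {t : ℝ} (ht : 0 < t) (x : R3) : 0 ≤ Wq τ (hp t f) (hp t g) x := by
  have := P.pos ht x
  unfold Wq; positivity
lemma Pr.W1 (P : Pr τ m f g) {t : ℝ} (ht : 0 < t) (x : R3) :
    Wq τ (hp t f) (hp t g) x ≤ 21 * |hp t g x| ^ (2 - τ) := by
  have h0 := P.pos ht x
  rw [abs_of_pos h0]
  unfold Wq
  have h1 := mlr (P.sq ht x) (rnn h0.le τ)
  rw [← Real.rpow_add h0] at h1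
  have e : 2 * (1 - τ) + τ = 2 - τ := by ring
  rw [e] at h1
  linarith
lemma Pr.Wint (P : Pr τ m f g) {t : ℝ} (ht : 0 < t) : Integrable (Wq τ (hp t f) (hp t g)) ∧
    ∫ x, Wq τ (hp t f) (hp t g) x ≤ 21 * ∫ x, |g x| ^ (2 - τ) := by
  have hs : 1 ≤ 2 - τ := by have := P.t2; linarith
  obtain ⟨i1, i2⟩ := hp_contr P.gs.cont P.gcs hs ht
  have sW := Wq_sm (τ := τ) (hp_sm ht P.fs P.fc) (hp_sm ht P.gs P.gcs) (P.pos ht)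
  have i3 : Integrable (Wq τ (hp t f) (hp t g)) := by
    refine (i1.const_mul 21).mono' sW.cont.aestronglyMeasurable (evf fun x => ?_)
    rw [nrn (P.W0 ht x)]
    exact P.W1 ht x
  refine ⟨i3, ?_⟩
  calc _ ≤ ∫ x, 21 * |hp t g x| ^ (2 - τ) := integral_mono i3 (i1.const_mul 21) (P.W1 ht)
    _ ≤ _ := by rw [icm]; linarith
lemma bl1 (P : Pr τ m f g) {η : R3 → ℝ} (hη : Sm η) (hc : CS η) (hη0 : ∀ x, 0 ≤ η x) (hη1 : ∀ x, η x ≤ 1)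
    {c : ℝ} (hlap : ∀ x, |lap η x| ≤ c) {ε T : ℝ} (hε : 0 < ε) (hT : ε ≤ T) (i j : Fin 3) :
    ∫ t in ε..T, 2 * t * ∫ x, η x * (|hp t (pd f i) x| * |hp t (pd g j) x|) ≤
      21 * (1 + c * T ^ 2) * ∫ x, |g x| ^ (2 - τ) := by
  set M := ∫ x, |g x| ^ (2 - τ) with hM
  have hM0 : 0 ≤ M := integral_nonneg fun x => by positivity
  have hc0 : 0 ≤ c := (abs_nonneg _).trans (hlap 0)
  have cc : ∀ {k : R3 → ℝ}, Sm k → CS k → Continuous (fun q : ℝ × R3 => hp (max ε q.1) k q.2) := by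
    intro k h1 h2
    exact (hp_cont h1.cont h2).comp (by fun_prop : Continuous fun q : ℝ × R3 => (max ε q.1, q.2))
  have cg : ∀ s : ℝ, Continuous (fun q : ℝ × R3 => hp (max ε q.1) g q.2 ^ s) := by
    intro s
    exact (cc P.gs P.gcs).rpow_const fun q => Or.inl (P.pos (lt_max_of_lt_left hε) _).ne'
  set Φ : ℝ → R3 → ℝ := fun t x => 2 * t * (Qa τ (hp t f) (hp t g) x * (∑ j, hp t (pd (pd f j) j) x) +
    Qg τ (hp t f) (hp t g) x * (∑ j, hp t (pd (pd g j) j) x)) with hΦ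
  have cΦ : Continuous (fun q : ℝ × R3 => Φ (max ε q.1) q.2) := by
    have a1 := cc P.fs P.fc
    have a2 := cc P.gs P.gcs
    have a3 : Continuous fun q : ℝ × R3 => ∑ j, hp (max ε q.1) (pd (pd f j) j) q.2 :=
      continuous_finsetSum _ fun j _ => cc ((P.fs.pd j).pd j) (CS.pd (CS.pd P.fc j) j)
    have a4 : Continuous fun q : ℝ × R3 => ∑ j, hp (max ε q.1) (pd (pd g j) j) q.2 :=
      continuous_finsetSum _ fun j _ => cc ((P.gs.pd j).pd j) (CS.pd (CS.pd P.gcs j) j)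
    have b1 := cg τ
    have b2 := cg (1 - τ)
    have b3 := cg (τ - 1)
    simp only [hΦ, Qa, Qg]
    exact (continuous_const.mul (continuous_const.max continuous_fst)).mul
      (((continuous_const.mul (a1.mul b1)).mul a3).add
      (((continuous_const.mul b2).add (continuous_const.mul ((a1.pow 2).mul b3))).mul a4))
  have cH : Continuous (Function.uncurry fun t x => η x * Φ (max ε t) x) :=
    (hη.cont.comp continuous_snd).mul cΦ
  have zH : ∀ t : ℝ, ∀ x, x ∉ tsupport η → η x * Φ (max ε t) x = 0 := by
    intro t x hx; rw [iz hx, zero_mul]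
  have swap := par_swap cH hc zH ε T
  have cA := par_cont cH hc zH
  have ftc : ∀ x, ∫ t in ε..T, η x * Φ (max ε t) x =
      η x * (Wq τ (hp T f) (hp T g) x - Wq τ (hp ε f) (hp ε g) x) := by
    intro x
    rw [intervalIntegral.integral_const_mul]
    congr 1
    have e1 : ∫ t in ε..T, Φ (max ε t) x = ∫ t in ε..T, Φ t x := by
      apply intervalIntegral.integral_congr
      intro t ht
      rw [Set.uIcc_of_le hT] at ht
      simp only [max_eq_right ht.1]
    rw [e1]
    apply intervalIntegral.integral_eq_sub_of_hasDerivAt (f := fun t => Wq τ (hp t f) (hp t g) x)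
    · intro t ht
      rw [Set.uIcc_of_le hT] at ht
      have ht0 : 0 < t := by linarith [ht.1]
      have d1 := hp_deriv P.fs P.fc x ht0
      have d2 := hp_deriv P.gs P.gcs x ht0
      have hg0 := P.pos ht0 x
      have d3 := ((d2.rpow_const (p := 2 - τ) (Or.inl hg0.ne')).const_mul 20).add
        ((d1.pow 2).mul (d2.rpow_const (p := τ) (Or.inl hg0.ne')))
      refine d3.congr_deriv ?_
      simp only [hΦ, Qa, Qg]
      have : (2 - τ - 1) = 1 - τ := by ring
      rw [this]; simp; ring
    · have : Continuous fun t => Φ (max ε t) x := cΦ.comp (by fun_prop : Continuous fun t : ℝ => (t, x))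
      refine (this.intervalIntegrable ε T).congr ?_
      intro t ht
      rw [Set.uIoc_of_le hT] at ht
      simp only [max_eq_right ht.1.le]
  simp_rw [ftc] at swap
  have iε := P.Wint hε
  have iT := P.Wint (hε.trans_le hT)
  have sW : ∀ t : ℝ, 0 < t → Sm (Wq τ (hp t f) (hp t g)) := fun t ht =>
    Wq_sm (τ := τ) (hp_sm ht P.fs P.fc) (hp_sm ht P.gs P.gcs) (P.pos ht)
  have lowA : -(21 * M) ≤ ∫ t in ε..T, ∫ x, η x * Φ (max ε t) x := by
    rw [swap]
    have a1 : Integrable fun x => η x * Wq τ (hp ε f) (hp ε g) x := cs_int (hη.cont.mul (sW ε hε).cont) hc.mull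
    have a2 : Integrable fun x => η x * (Wq τ (hp T f) (hp T g) x - Wq τ (hp ε f) (hp ε g) x) :=
      cs_int (hη.cont.mul ((sW T (hε.trans_le hT)).cont.sub (sW ε hε).cont)) hc.mull
    have a3 : ∫ x, -(Wq τ (hp ε f) (hp ε g) x) ≤ ∫ x, η x * (Wq τ (hp T f) (hp T g) x - Wq τ (hp ε f) (hp ε g) x) := by
      refine integral_mono iε.1.neg a2 fun x => ?_
      simp only
      have w1 := P.W0 hε x
      have w2 := P.W0 (hε.trans_le hT) x
      have w3 := hη0 x
      have w4 := hη1 x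
      nlinarith
    rw [integral_neg] at a3
    linarith [iε.2]
  set B : ℝ → ℝ := fun t => ∫ x, η x * (|hp t (pd f i) x| * |hp t (pd g j) x|) with hB
  have cB : Continuous B := by
    refine par_cont (H := fun t x => η x * (|hp t (pd f i) x| * |hp t (pd g j) x|)) ?_ hc ?_
    · exact (hη.cont.comp continuous_snd).mul ((hp_cont (P.fs.pd i).cont (P.fc.pd i)).abs.mul
        (hp_cont (P.gs.pd j).cont (P.gcs.pd j)).abs)
    · intro t x hx; rw [iz hx, zero_mul]
  have pt : ∀ t ∈ Set.Icc ε T, (∫ x, η x * Φ (max ε t) x) + 2 * t * B t ≤ 2 * t * (c * (21 * M)) := by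
    intro t ht
    have ht0 : 0 < t := by linarith [ht.1]
    rw [max_eq_right ht.1]
    have b2 := bell2 (hp_sm ht0 P.fs P.fc) (hp_sm ht0 P.gs P.gcs) (P.pos ht0) hη hc hη0 P.t1 P.t2 (P.sq ht0) i j
    rw [pd_hp ht0 P.fs P.fc, pd_hp ht0 P.gs P.gcs] at b2
    have e1 : ∫ x, η x * Φ t x = 2 * t * ∫ x, η x * (Qa τ (hp t f) (hp t g) x * lap (hp t f) x + Qg τ (hp t f) (hp t g) x * lap (hp t g) x) := by
      rw [← icm]
      congr 1; ext x
      simp only [hΦ]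
      rw [lap_hp ht0 P.fs P.fc, lap_hp ht0 P.gs P.gcs]; ring
    have iW := P.Wint ht0
    have e2 : ∫ x, Wq τ (hp t f) (hp t g) x * lap η x ≤ c * (21 * M) := by
      calc _ ≤ ∫ x, c * Wq τ (hp t f) (hp t g) x := by
            refine integral_mono ?_ (iW.1.const_mul c) fun x => ?_
            · have : Continuous (lap η) := continuous_finsetSum _ fun j _ => ((hη.pd j).pd j).cont
              have : CS (lap η) := by
                refine HasCompactSupport.intro hc fun x hx => ?_
                unfold lap
                refine Finset.sum_eq_zero fun j _ => ?_
                exact pd_zero_off j fun h => hx (tsupport_pd_subset _ _ h)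
              exact cs_int ((sW t ht0).cont.mul ‹_›) this.mulr
            · have := P.W0 ht0 x
              have h2 := (le_abs_self _).trans (hlap x)
              simp only
              nlinarith
        _ = c * ∫ x, Wq τ (hp t f) (hp t g) x := icm _ _
        _ ≤ _ := mll iW.2 hc0
    rw [e1, ← mul_add]
    exact mll (b2.trans e2) (by linarith)
  have j2 : Continuous fun t => 2 * t * B t := (continuous_const.mul continuous_id).mul cB
  have mono := intervalIntegral.integral_mono_on (μ := volume) hT ((cA.add j2).intervalIntegrable ε T)
    ((by fun_prop : Continuous fun t : ℝ => 2 * t * (c * (21 * M))).intervalIntegrable ε T) pt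
  simp only [Pi.add_apply] at mono
  rw [intervalIntegral.integral_add (cA.intervalIntegrable ε T) (j2.intervalIntegrable ε T)] at mono
  have e3 : ∫ t in ε..T, 2 * t * (c * (21 * M)) = (T ^ 2 - ε ^ 2) * (c * (21 * M)) := by
    rw [intervalIntegral.integral_mul_const, intervalIntegral.integral_const_mul, integral_id]; ring
  rw [e3] at mono
  have : 0 ≤ ε ^ 2 * (c * (21 * M)) := by positivity
  nlinarith
end
lemma hp_sub {f g : R3 → ℝ} (hf : Continuous f) (h : CS f) (hg : Continuous g) (h' : CS g) (t : ℝ) (x : R3) :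
    hp t (fun y => f y - g y) x = hp t f x - hp t g x := by
  unfold hp
  rw [← integral_sub (hp_integrand_int hf h t x) (hp_integrand_int hg h' t x)]
  congr 1; ext z; ring
lemma hp_cmul (c : ℝ) (f : R3 → ℝ) (t : ℝ) (x : R3) :
    hp t (fun y => c * f y) x = c * hp t f x := by
  unfold hp
  rw [← icm]
  congr 1; ext z; ring
lemma exists_cut {K : Set R3} (hK : IsCompact K) : ∃ χ : R3 → ℝ, Sm χ ∧ CS χ ∧ (∀ x, 0 ≤ χ x) ∧ (∀ x, χ x ≤ 1) ∧
    (∀ x ∈ K, χ x = 1) ∧ χ 0 = 1 := by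
  obtain ⟨R, hR⟩ := hK.isBounded.subset_closedBall (0 : R3)
  let b : ContDiffBump (0 : R3) := ⟨max R 1, max R 1 + 1, by positivity, by linarith⟩
  refine ⟨b, b.contDiff, b.hasCompactSupport, fun x => b.nonneg, fun x => b.le_one, fun x hx => ?_, ?_⟩
  · exact b.one_of_mem_closedBall (closedBall_subset_closedBall (le_max_left _ _) (hR hx))
  · exact b.one_of_mem_closedBall (by simp [b])
lemma add_rpow_le4 {a b s : ℝ} (ha : 0 ≤ a) (hb : 0 ≤ b) (hs0 : 0 ≤ s) (hs : s ≤ 2) :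
    (a + b) ^ s ≤ 4 * (a ^ s + b ^ s) := by
  have h1 : (a + b) ^ s ≤ (2 * max a b) ^ s := by
    refine rle' (by positivity) ?_ hs0
    linarith [le_max_left a b, le_max_right a b]
  have h2 : (2:ℝ) ^ s ≤ 4 := by
    calc (2:ℝ) ^ s ≤ (2:ℝ) ^ (2:ℝ) := rlx (by norm_num) hs
      _ = 4 := by norm_num
  rw [Real.mul_rpow (by norm_num) (by positivity)] at h1
  have h3 : (max a b) ^ s ≤ a ^ s + b ^ s := by
    have := rnn ha s
    have := rnn hb s
    rcases le_total a b with h | h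
    · rw [max_eq_right h]; linarith
    · rw [max_eq_left h]; linarith
  refine h1.trans (mul_le_mul h2 h3 (by positivity) (by norm_num))
section
variable {τ m : ℝ} {f h : R3 → ℝ}
lemma bl2 (t1 : 1/2 ≤ τ) (t2 : τ ≤ 5/7) (tm : (1 - τ) * m = 1) (hf : Sm f) (fc : CS f) (hh : Sm h) (hc : CS h)
    {η : R3 → ℝ} (hη : Sm η) (hcη : CS η) (hη0 : ∀ x, 0 ≤ η x) (hη1 : ∀ x, η x ≤ 1)
    {c : ℝ} (hlap : ∀ x, |lap η x| ≤ c) {ε T : ℝ} (hε : 0 < ε) (hT : ε ≤ T) (i j : Fin 3) :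
    ∫ t in ε..T, 2 * t * ∫ x, η x * (|hp t (pd f i) x| * |hp t (pd h j) x|) ≤
      672 * (1 + c * T ^ 2) * ((∫ x, |f x| ^ (m + 1)) + ∫ x, |h x| ^ (2 - τ)) := by
  have hc0 : 0 ≤ c := (abs_nonneg _).trans (hlap 0)
  have hm1 : 1 ≤ m := by
    by_contra hcon
    push Not at hcon
    nlinarith
  obtain ⟨χ, χs, χc, χ0, χ1, χK, χz⟩ := exists_cut (fc.isCompact.union hc.isCompact)
  have χf : ∀ x, f x ≠ 0 → χ x = 1 := fun x hx => χK x (Or.inl (subset_tsupport _ hx))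
  have χh : ∀ x, h x ≠ 0 → χ x = 1 := fun x hx => χK x (Or.inr (subset_tsupport _ hx))
  set s := 2 - τ with hs
  have hs1 : 1 ≤ s := by linarith
  set N : ℝ → ℝ := fun δ => ∫ x, (8 * ((f x ^ 2 + |δ|) ^ (m / 2) * χ x) ^ s + 32 * ((h x ^ 2 + |δ|) ^ ((1:ℝ) / 2) * χ x) ^ s) with hN
  have Ncont : Continuous N := by
    refine par_cont (H := fun δ x => 8 * ((f x ^ 2 + |δ|) ^ (m / 2) * χ x) ^ s + 32 * ((h x ^ 2 + |δ|) ^ ((1:ℝ) / 2) * χ x) ^ s) ?_ χc ?_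
    · have a1 := hf.cont
      have a2 := hh.cont
      have a3 := χs.cont
      refine (continuous_const.mul ((Continuous.mul ?_ (a3.comp continuous_snd)).rpow_const fun _ => Or.inr (by linarith))).add
        (continuous_const.mul ((Continuous.mul ?_ (a3.comp continuous_snd)).rpow_const fun _ => Or.inr (by linarith)))
      · exact (((a1.comp continuous_snd).pow 2).add continuous_fst.abs).rpow_const fun _ => Or.inr (by linarith)
      · exact (((a2.comp continuous_snd).pow 2).add continuous_fst.abs).rpow_const fun _ => Or.inr (by norm_num)
    · intro t x hx
      rw [iz hx]
      simp [Real.zero_rpow (by linarith : s ≠ 0)]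
  have main : ∀ δ : ℝ, 0 < δ → ∫ t in ε..T, 2 * t * ∫ x, η x * (|hp t (pd f i) x| * |hp t (pd h j) x|) ≤
      21 * (1 + c * T ^ 2) * N δ := by
    intro δ hδ
    set g0 : R3 → ℝ := fun x => (f x ^ 2 + δ) ^ (m / 2) * χ x with hg0
    set h1 : R3 → ℝ := fun x => (h x ^ 2 + δ) ^ ((1:ℝ) / 2) * χ x with hh1
    have g0s : Sm g0 := (sm_rpow ((hf.pow 2).add contDiff_const) (fun x => by positivity) _).mul χs
    have h1s : Sm h1 := (sm_rpow ((hh.pow 2).add contDiff_const) (fun x => by positivity) _).mul χs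
    have g0c : CS g0 := χc.mulr
    have h1c : CS h1 := χc.mulr
    have g0p : ∀ x, 0 ≤ g0 x := fun x => mul_nonneg (by positivity) (χ0 x)
    have h1p : ∀ x, |h x| ≤ h1 x := by
      intro x
      by_cases hx : h x = 0
      · rw [hx, abs_zero]; exact mul_nonneg (by positivity) (χ0 x)
      · simp only [hh1]
        rw [χh x hx, mul_one, ← Real.sqrt_eq_rpow]
        exact Real.abs_le_sqrt (by linarith)
    have fg0 : ∀ x, |f x| ^ m ≤ g0 x := by
      intro x
      by_cases hx : f x = 0
      · rw [hx, abs_zero, Real.zero_rpow (by linarith)]; exact g0p x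
      · simp only [hg0]
        rw [χf x hx, mul_one]
        have e : |f x| ^ m = (f x ^ 2) ^ (m / 2) := by
          rw [← sq_abs, ← rnc, ← rmu (abs_nonneg _)]
          congr 1; push_cast; ring
        rw [e]
        exact rle' (sq_nonneg _) (by linarith) (by linarith)
    have gz : 0 < g0 0 := by simp only [hg0, χz]; positivity
    have P1 : Pr τ m f (fun x => g0 x + h1 x) :=
      ⟨t1, t2, tm, hf, fc, g0s.add h1s, HasCompactSupport.add g0c h1c,
        fun x => by linarith [fg0 x, h1p x, abs_nonneg (h x)], ⟨0, by linarith [h1p 0, abs_nonneg (h 0)]⟩⟩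
    have P2 : Pr τ m f (fun x => (g0 x + h1 x) - h x) :=
      ⟨t1, t2, tm, hf, fc, (g0s.add h1s).sub hh, HasCompactSupport.sub (HasCompactSupport.add g0c h1c) hc,
        fun x => by linarith [fg0 x, h1p x, le_abs_self (h x)], ⟨0, by linarith [h1p 0, le_abs_self (h 0)]⟩⟩
    have B1 := bl1 P1 hη hcη hη0 hη1 hlap hε hT i j
    have B2 := bl1 P2 hη hcη hη0 hη1 hlap hε hT i j
    have contB : ∀ {k l : R3 → ℝ}, Sm k → CS k → Sm l → CS l →
        Continuous (fun t => 2 * t * ∫ x, η x * (|hp t k x| * |hp t l x|)) := by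
      intro k l k1 k2 l1 l2
      refine (continuous_const.mul continuous_id).mul (par_cont (H := fun t x => η x * (|hp t k x| * |hp t l x|)) ?_ hcη ?_)
      · exact (hη.cont.comp continuous_snd).mul ((hp_cont k1.cont k2).abs.mul (hp_cont l1.cont l2).abs)
      · intro t x hx; rw [iz hx, zero_mul]
    have C1 := contB (hf.pd i) (fc.pd i) (P1.gs.pd j) (P1.gcs.pd j)
    have C2 := contB (hf.pd i) (fc.pd i) (P2.gs.pd j) (P2.gcs.pd j)
    have C3 := contB (hf.pd i) (fc.pd i) (hh.pd j) (hc.pd j)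
    have step : ∫ t in ε..T, 2 * t * ∫ x, η x * (|hp t (pd f i) x| * |hp t (pd h j) x|) ≤
       (∫ t in ε..T, 2 * t * ∫ x, η x * (|hp t (pd f i) x| * |hp t (pd (fun x => g0 x + h1 x) j) x|)) +
       ∫ t in ε..T, 2 * t * ∫ x, η x * (|hp t (pd f i) x| * |hp t (pd (fun x => (g0 x + h1 x) - h x) j) x|) := by
      rw [← intervalIntegral.integral_add (C1.intervalIntegrable _ _) (C2.intervalIntegrable _ _)]
      refine intervalIntegral.integral_mono_on (μ := volume) hT (C3.intervalIntegrable _ _)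
        ((C1.add C2).intervalIntegrable _ _) fun t ht => ?_
      have ht0 : 0 < t := by linarith [ht.1]
      rw [← mul_add]
      refine mll ?_ (by linarith)
      have ic : ∀ {l : R3 → ℝ}, Sm l → CS l → Integrable (fun x => η x * (|hp t (pd f i) x| * |hp t l x|)) := by
        intro l l1 l2
        exact cs_int (hη.cont.mul ((hp_sm ht0 (hf.pd i) (fc.pd i)).cont.abs.mul (hp_sm ht0 l1 l2).cont.abs)) hcη.mull
      have I1 := ic (P1.gs.pd j) (P1.gcs.pd j)
      have I2 := ic (P2.gs.pd j) (P2.gcs.pd j)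
      rw [← integral_add I1 I2]
      refine integral_mono (ic (hh.pd j) (hc.pd j)) (I1.add I2) fun x => ?_
      have e : hp t (pd h j) x = hp t (pd (fun x => g0 x + h1 x) j) x - hp t (pd (fun x => (g0 x + h1 x) - h x) j) x := by
        rw [← hp_sub (P1.gs.pd j).cont (P1.gcs.pd j) (P2.gs.pd j).cont (P2.gcs.pd j)]
        congr 1; ext y
        rw [pd_sub P1.gs hh]; ring
      simp only [Pi.add_apply]
      rw [← mul_add, ← mul_add]
      refine mll (mll ?_ (abs_nonneg _)) (hη0 x)
      rw [e]
      exact abs_sub _ _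
    have bG : ∀ {G : R3 → ℝ}, Continuous G → CS G → (∀ x, 0 ≤ G x) → (∀ x, G x ≤ g0 x + 2 * h1 x) →
        2 * (∫ x, |G x| ^ s) ≤ N δ := by
      intro G G1 G2 G3 G4
      rw [← icm]
      simp only [hN, abs_of_pos hδ]
      have c1 : Continuous fun x => 2 * |G x| ^ s := continuous_const.mul (rpow_ct G1 (by linarith))
      have c2 : CS fun x => 2 * |G x| ^ s := CS.mulr (rpow_cs G2 (by linarith))
      have sp : s ≠ 0 := by linarith
      have c3 : Continuous fun x => 8 * (g0 x) ^ s + 32 * (h1 x) ^ s :=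
        (continuous_const.mul (g0s.cont.rpow_const fun _ => Or.inr (by linarith))).add
          (continuous_const.mul (h1s.cont.rpow_const fun _ => Or.inr (by linarith)))
      have c4 : CS fun x => 8 * (g0 x) ^ s + 32 * (h1 x) ^ s := by
        refine HasCompactSupport.intro χc fun x hx => ?_
        have : χ x = 0 := iz hx
        simp [hg0, hh1, this, Real.zero_rpow sp]
      refine integral_mono (cs_int c1 c2) (cs_int c3 c4) fun x => ?_
      simp only
      rw [abs_of_nonneg (G3 x)]
      have h1n : 0 ≤ h1 x := (abs_nonneg _).trans (h1p x)
      have r1 := rle' (G3 x) (G4 x) (z := s) (by linarith)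
      have r2 := add_rpow_le4 (g0p x) (by linarith : 0 ≤ 2 * h1 x) (by linarith : 0 ≤ s) (by linarith)
      have r3 : (2 * h1 x) ^ s ≤ 4 * h1 x ^ s := by
        rw [Real.mul_rpow (by norm_num) h1n]
        refine mlr ?_ (by positivity)
        calc (2:ℝ) ^ s ≤ (2:ℝ) ^ (2:ℝ) := rlx (by norm_num) (by linarith)
          _ = 4 := by norm_num
      linarith
    have D1 := bG P1.gs.cont P1.gcs P1.g0 (fun x => by linarith [h1p x, abs_nonneg (h x)])
    have D2 := bG P2.gs.cont P2.gcs P2.g0 (fun x => by linarith [h1p x, neg_abs_le (h x)])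
    have hK : 0 ≤ 21 * (1 + c * T ^ 2) := by positivity
    nlinarith
  have lim : ∫ t in ε..T, 2 * t * ∫ x, η x * (|hp t (pd f i) x| * |hp t (pd h j) x|) ≤ 21 * (1 + c * T ^ 2) * N 0 := by
    have t0 : Tendsto (fun δ => 21 * (1 + c * T ^ 2) * N δ) (nhdsWithin 0 (Set.Ioi 0)) (nhds (21 * (1 + c * T ^ 2) * N 0)) :=
      ((continuous_const.mul Ncont).tendsto 0).mono_left nhdsWithin_le_nhds
    exact ge_of_tendsto t0 (eventually_nhdsWithin_of_forall fun δ hδ => main δ hδ)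
  have N0 : N 0 ≤ 32 * ((∫ x, |f x| ^ (m + 1)) + ∫ x, |h x| ^ s) := by
    simp only [hN, abs_zero, add_zero]
    have i1 : Integrable fun x => |f x| ^ (m + 1) := cs_int (rpow_ct hf.cont (by linarith)) (rpow_cs fc (by linarith))
    have i2 : Integrable fun x => |h x| ^ s := cs_int (rpow_ct hh.cont (by linarith)) (rpow_cs hc (by linarith))
    rw [← integral_add i1 i2, ← icm]
    refine integral_mono_of_nonneg (evf fun x => ?_) ((i1.add i2).const_mul 32) (evf fun x => ?_)
    · have := χ0 x
      simp only [Pi.zero_apply]; positivity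
    · simp only [Pi.add_apply]
      have e1 : (f x ^ 2) ^ (m / 2) = |f x| ^ m := by
        rw [← sq_abs, ← rnc, ← rmu (abs_nonneg _)]
        congr 1; push_cast; ring
      have e2 : (h x ^ 2) ^ ((1:ℝ) / 2) = |h x| := by
        rw [← Real.sqrt_eq_rpow, Real.sqrt_sq_eq_abs]
      rw [e1, e2]
      have q1 : (|f x| ^ m * χ x) ^ s ≤ |f x| ^ (m + 1) := by
        have : |f x| ^ (m + 1) = (|f x| ^ m) ^ s := by
          rw [← rmu (abs_nonneg _)]; congr 1; rw [hs]; linarith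
        rw [this]
        exact rle' (mul_nonneg (by positivity) (χ0 x)) (mul_le_of_le_one_right (by positivity) (χ1 x)) (by linarith)
      have q2 : (|h x| * χ x) ^ s ≤ |h x| ^ s :=
        rle' (mul_nonneg (by positivity) (χ0 x)) (mul_le_of_le_one_right (by positivity) (χ1 x)) (by linarith)
      have : 0 ≤ |f x| ^ (m + 1) := by positivity
      linarith
  have hK : 0 ≤ 21 * (1 + c * T ^ 2) := by positivity
  nlinarith
lemma bl3 (t1 : 1/2 ≤ τ) (t2 : τ ≤ 5/7) (tm : (1 - τ) * m = 1) (hf : Sm f) (fc : CS f) (hh : Sm h) (hc : CS h)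
    {η : R3 → ℝ} (hη : Sm η) (hcη : CS η) (hη0 : ∀ x, 0 ≤ η x) (hη1 : ∀ x, η x ≤ 1)
    {c : ℝ} (hlap : ∀ x, |lap η x| ≤ c) {ε T : ℝ} (hε : 0 < ε) (hT : ε ≤ T) (i j : Fin 3)
    {a b : ℝ} (ha : 0 < a) (hb : 0 < b) (hfa : ∫ x, |f x| ^ (m + 1) ≤ a ^ (m + 1))
    (hhb : ∫ x, |h x| ^ (2 - τ) ≤ b ^ (2 - τ)) :
    ∫ t in ε..T, 2 * t * ∫ x, η x * (|hp t (pd f i) x| * |hp t (pd h j) x|) ≤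
      1344 * (1 + c * T ^ 2) * (a * b) := by
  have hc0 : 0 ≤ c := (abs_nonneg _).trans (hlap 0)
  have B := bl2 (f := fun x => a⁻¹ * f x) (h := fun x => b⁻¹ * h x) t1 t2 tm (contDiff_const.mul hf) fc.mulr
    (contDiff_const.mul hh) hc.mulr hη hcη hη0 hη1 hlap hε hT i j
  have e1 : pd (fun x => a⁻¹ * f x) i = fun x => a⁻¹ * pd f i x := by ext x; exact pd_cmul hf _ _ _
  have e2 : pd (fun x => b⁻¹ * h x) j = fun x => b⁻¹ * pd h j x := by ext x; exact pd_cmul hh _ _ _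
  rw [e1, e2] at B
  simp_rw [hp_cmul, abs_mul, abs_of_pos (inv_pos.2 ha), abs_of_pos (inv_pos.2 hb)] at B
  have e3 : ∀ t : ℝ, 2 * t * ∫ x, η x * (a⁻¹ * |hp t (pd f i) x| * (b⁻¹ * |hp t (pd h j) x|)) =
      (a * b)⁻¹ * (2 * t * ∫ x, η x * (|hp t (pd f i) x| * |hp t (pd h j) x|)) := by
    intro t
    have : ∀ x, η x * (a⁻¹ * |hp t (pd f i) x| * (b⁻¹ * |hp t (pd h j) x|)) =
        (a * b)⁻¹ * (η x * (|hp t (pd f i) x| * |hp t (pd h j) x|)) := by intro x; rw [mul_inv]; ring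
    simp_rw [this]
    rw [icm]; ring
  simp_rw [e3] at B
  rw [intervalIntegral.integral_const_mul] at B
  have n1 : ∀ {k : R3 → ℝ} {a s : ℝ}, 0 < a → ∫ x, |k x| ^ s ≤ a ^ s → ∫ x, (a⁻¹ * |k x|) ^ s ≤ 1 := by
    intro k a s ha hk
    have : ∀ x, (a⁻¹ * |k x|) ^ s = (a ^ s)⁻¹ * |k x| ^ s := by
      intro x; rw [Real.mul_rpow (by positivity) (abs_nonneg _), Real.inv_rpow ha.le]
    simp_rw [this]
    rw [icm, inv_mul_le_iff₀ (by positivity), mul_one]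
    exact hk
  have B2 : (a * b)⁻¹ * (∫ t in ε..T, 2 * t * ∫ x, η x * (|hp t (pd f i) x| * |hp t (pd h j) x|)) ≤
      1344 * (1 + c * T ^ 2) := by
    refine B.trans ?_
    have h1 := n1 ha hfa
    have h2 := n1 hb hhb
    have hK : 0 ≤ 672 * (1 + c * T ^ 2) := by positivity
    nlinarith
  rw [inv_mul_le_iff₀ (by positivity)] at B2
  linarith
end
lemma cut_seq : ∃ (η : ℕ → R3 → ℝ) (C : ℝ), 0 ≤ C ∧ ∀ n, Sm (η n) ∧ CS (η n) ∧ (∀ x, 0 ≤ η n x) ∧ (∀ x, η n x ≤ 1) ∧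
    (∀ x, |lap (η n) x| ≤ C * ((n:ℝ)+1)⁻¹ ^ 2) ∧ (∀ x : R3, ‖x‖ ≤ n → η n x = 1) := by
  let b : ContDiffBump (0 : R3) := ⟨1, 2, by norm_num, by norm_num⟩
  have bs : Sm b := b.contDiff
  have bc : CS b := b.hasCompactSupport
  have lc : Continuous (lap b) := continuous_finsetSum _ fun j _ => ((bs.pd j).pd j).cont
  have lcs : CS (lap b) := by
    refine HasCompactSupport.intro bc fun x hx => ?_
    unfold lap
    refine Finset.sum_eq_zero fun j _ => ?_
    exact pd_zero_off j fun h => hx (tsupport_pd_subset _ _ h)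
  obtain ⟨C, hC0, hC⟩ := cs_bdd lc lcs
  refine ⟨fun n x => b (0 - (-((n:ℝ)+1)⁻¹) • x), C, hC0, fun n => ?_⟩
  have hn : (-((n:ℝ)+1)⁻¹) ≠ 0 := by
    have : (0:ℝ) < ((n:ℝ)+1)⁻¹ := by positivity
    linarith
  refine ⟨aff_sm bs _ _, aff_cs bc _ hn, fun x => b.nonneg, fun x => b.le_one, fun x => ?_, fun x hx => ?_⟩
  · have e : lap (fun x => b (0 - (-((n:ℝ)+1)⁻¹) • x)) x = ((n:ℝ)+1)⁻¹ ^ 2 * lap b (0 - (-((n:ℝ)+1)⁻¹) • x) := by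
      unfold lap
      rw [Finset.mul_sum]
      refine Finset.sum_congr rfl fun j _ => ?_
      have : pd (fun x => b (0 - (-((n:ℝ)+1)⁻¹) • x)) j = fun x => (((n:ℝ)+1)⁻¹) * pd b j (0 - (-((n:ℝ)+1)⁻¹) • x) := by
        ext x; rw [pd_aff bs]; ring
      rw [this, pd_cmul (aff_sm (bs.pd j) _ _), pd_aff (bs.pd j)]; ring
    rw [e, abs_mul, abs_of_nonneg (by positivity), mul_comm]
    exact mlr (hC _) (by positivity)
  · apply b.one_of_mem_closedBall
    have h1 : (0:ℝ) < (n:ℝ)+1 := by positivity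
    simp only [mem_closedBall, dist_zero_right, zero_sub, norm_neg, norm_smul, norm_inv, b]
    rw [nrn h1.le, inv_mul_le_iff₀ h1]
    linarith
section
variable {τ m : ℝ} {f h : R3 → ℝ}
lemma bl4 (t1 : 1/2 ≤ τ) (t2 : τ ≤ 5/7) (tm : (1 - τ) * m = 1) (hf : Sm f) (fc : CS f) (hh : Sm h) (hc : CS h)
    {ε T : ℝ} (hε : 0 < ε) (hT : ε ≤ T) (i j : Fin 3)
    {a b : ℝ} (ha : 0 < a) (hb : 0 < b) (hfa : ∫ x, |f x| ^ (m + 1) ≤ a ^ (m + 1))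
    (hhb : ∫ x, |h x| ^ (2 - τ) ≤ b ^ (2 - τ)) :
    |∫ t in ε..T, 2 * t * ∫ x, hp t (pd f i) x * hp t (pd h j) x| ≤ 1344 * (a * b) := by
  obtain ⟨η, C, hC0, hη⟩ := cut_seq
  obtain ⟨D, hD0, hD⟩ := cs_bdd (hh.pd j).cont (hc.pd j)
  have hA : ∀ t : ℝ, 0 < t → Integrable (hp t (pd f i)) := fun t ht => hp_integrable ht (cs_int (hf.pd i).cont (fc.pd i))
  have hAB : ∀ t : ℝ, 0 < t → Integrable (fun x => |hp t (pd f i) x| * D) := fun t ht => (hA t ht).abs.mul_const D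
  have hdom : ∀ t x, |hp t (pd f i) x * hp t (pd h j) x| ≤ |hp t (pd f i) x| * D := by
    intro t x
    rw [abs_mul]
    exact mll (hp_bdd (hh.pd j).cont (hc.pd j) hD t x) (abs_nonneg _)
  set M := ∫ x, |pd f i x| with hM
  have hM0 : 0 ≤ M := integral_nonneg fun x => abs_nonneg _
  have hMb : ∀ t : ℝ, 0 < t → ∫ x, |hp t (pd f i) x| * D ≤ M * D := by
    intro t ht
    rw [integral_mul_const]
    refine mlr ?_ hD0
    have := (hp_contr (hf.pd i).cont (fc.pd i) le_rfl ht).2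
    simpa using this
  have cn : ∀ n, Continuous fun t => 2 * t * ∫ x, η n x * (hp t (pd f i) x * hp t (pd h j) x) := by
    intro n
    refine (continuous_const.mul continuous_id).mul (par_cont (H := fun t x => η n x * (hp t (pd f i) x * hp t (pd h j) x)) ?_ (hη n).2.1 ?_)
    · exact ((hη n).1.cont.comp continuous_snd).mul ((hp_cont (hf.pd i).cont (fc.pd i)).mul (hp_cont (hh.pd j).cont (hc.pd j)))
    · intro t x hx; rw [iz hx, zero_mul]
  have cn' : ∀ n, Continuous fun t => 2 * t * ∫ x, η n x * (|hp t (pd f i) x| * |hp t (pd h j) x|) := by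
    intro n
    refine (continuous_const.mul continuous_id).mul (par_cont (H := fun t x => η n x * (|hp t (pd f i) x| * |hp t (pd h j) x|)) ?_ (hη n).2.1 ?_)
    · exact ((hη n).1.cont.comp continuous_snd).mul ((hp_cont (hf.pd i).cont (fc.pd i)).abs.mul (hp_cont (hh.pd j).cont (hc.pd j)).abs)
    · intro t x hx; rw [iz hx, zero_mul]
  have hdn : ∀ n t x, |η n x * (hp t (pd f i) x * hp t (pd h j) x)| ≤ |hp t (pd f i) x| * D := by
    intro n t x
    rw [abs_mul, abs_of_nonneg ((hη n).2.2.1 x)]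
    calc _ ≤ 1 * |hp t (pd f i) x * hp t (pd h j) x| := mlr ((hη n).2.2.2.1 x) (abs_nonneg _)
      _ ≤ _ := by rw [one_mul]; exact hdom t x
  have lim : Tendsto (fun n => ∫ t in ε..T, 2 * t * ∫ x, η n x * (hp t (pd f i) x * hp t (pd h j) x)) atTop
      (nhds (∫ t in ε..T, 2 * t * ∫ x, hp t (pd f i) x * hp t (pd h j) x)) := by
    refine intervalIntegral.tendsto_integral_filter_of_dominated_convergence (fun t => 2 * T * (M * D)) ?_ ?_ ?_ ?_
    · exact evf fun n => (cn n).aestronglyMeasurable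
    · refine evf fun n => evf fun t ht => ?_
      rw [Set.uIoc_of_le hT] at ht
      have ht0 : 0 < t := by linarith [ht.1]
      rw [norm_mul, nrn (by linarith : 0 ≤ 2 * t)]
      refine mul_le_mul (by linarith [ht.2]) ?_ (norm_nonneg _) (by linarith)
      refine le_trans ?_ (hMb t ht0)
      exact norm_integral_le_of_norm_le (hAB t ht0) (evf fun x => hdn n t x)
    · exact intervalIntegrable_const
    · refine evf fun t ht => ?_
      rw [Set.uIoc_of_le hT] at ht
      have ht0 : 0 < t := by linarith [ht.1]
      refine Tendsto.const_mul _ ?_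
      refine tendsto_integral_of_dominated_convergence (fun x => |hp t (pd f i) x| * D) ?_ (hAB t ht0) ?_ ?_
      · intro n
        exact ((hη n).1.cont.mul ((hp_sm ht0 (hf.pd i) (fc.pd i)).cont.mul (hp_sm ht0 (hh.pd j) (hc.pd j)).cont)).aestronglyMeasurable
      · exact fun n => evf fun x => hdn n t x
      · refine evf fun x => ?_
        refine tendsto_const_nhds.congr' ?_
        obtain ⟨N, hN⟩ := exists_nat_ge ‖x‖
        filter_upwards [eventually_ge_atTop N] with n hn
        rw [(hη n).2.2.2.2.2 x (hN.trans (by exact_mod_cast hn)), one_mul]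
  have lim2 : Tendsto (fun n : ℕ => 1344 * (1 + (C * ((n:ℝ)+1)⁻¹ ^ 2) * T ^ 2) * (a * b)) atTop (nhds (1344 * (1 + (C * 0 ^ 2) * T ^ 2) * (a * b))) := by
    have h0 : Tendsto (fun n : ℕ => ((n:ℝ)+1)⁻¹) atTop (nhds 0) := by
      simpa [one_div] using tendsto_one_div_add_atTop_nhds_zero_nat (𝕜 := ℝ)
    exact ((((h0.pow 2).const_mul C).mul_const _).const_add 1 |>.const_mul 1344).mul_const _
  have e : 1344 * (1 + (C * 0 ^ 2) * T ^ 2) * (a * b) = 1344 * (a * b) := by ring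
  rw [e] at lim2
  refine le_of_tendsto_of_tendsto' lim.abs lim2 fun n => ?_
  have B := bl3 t1 t2 tm hf fc hh hc (hη n).1 (hη n).2.1 (hη n).2.2.1 (hη n).2.2.2.1 (hη n).2.2.2.2.1 hε hT i j ha hb hfa hhb
  refine le_trans ?_ B
  refine (intervalIntegral.abs_integral_le_integral_abs hT).trans ?_
  refine intervalIntegral.integral_mono_on (μ := volume) hT ((cn n).abs.intervalIntegrable _ _) ((cn' n).intervalIntegrable _ _) fun t ht => ?_
  have ht0 : 0 < t := by linarith [ht.1]
  rw [abs_mul, abs_of_pos (by linarith : 0 < 2 * t)]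
  refine mll ?_ (by linarith)
  refine (abs_integral_le_integral_abs (μ := volume)).trans (le_of_eq ?_)
  congr 1; ext x
  rw [abs_mul, abs_mul, abs_of_nonneg ((hη n).2.2.1 x)]
end
lemma fb {a B : R3 → ℝ} (ha : Integrable a) (hB : Integrable B) {D : R3 → R3 → ℝ}
    (hD : Continuous (Function.uncurry D)) {C : ℝ} (hC : ∀ x z, |D x z| ≤ C) :
    ∫ x, ∫ z, a z * (B x * D x z) = ∫ z, ∫ x, a z * (B x * D x z) := by
  apply integral_integral_swap
  have h1 : Integrable (fun q : R3 × R3 => B q.1 * a q.2) (volume.prod volume) := hB.mul_prod ha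
  have h2 := h1.mul_bdd (c := C) (g := Function.uncurry D) hD.aestronglyMeasurable (evf fun q => hC q.1 q.2)
  refine h2.congr (evf fun q => ?_)
  simp only [Function.uncurry]; ring
def cr (A B : R3 → ℝ) (y : R3) : ℝ := ∫ x, A (x - y) * B x
lemma cr_eq (A B : R3 → ℝ) : cr A B = cv B (fun z => A (-z)) := by
  ext y
  unfold cr cv
  congr 1; ext x
  show A (x - y) * B x = B x * A (-(y - x))
  rw [neg_sub, mul_comm]
lemma neg_sm {A : R3 → ℝ} (h : Sm A) : Sm (fun z => A (-z)) := h.comp contDiff_neg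
lemma neg_cs {A : R3 → ℝ} (h : CS A) : CS (fun z => A (-z)) := h.comp_homeomorph (Homeomorph.neg R3)
lemma pd_ng {A : R3 → ℝ} (h : Sm A) (j : Fin 3) (z : R3) : pd (fun z => A (-z)) j z = - pd A j (-z) := by
  have := pd_aff h 0 1 j z
  simpa using this
lemma cr_sm {A B : R3 → ℝ} (hA : Sm A) (cA : CS A) (hB : LocallyIntegrable B) : Sm (cr A B) := by
  rw [cr_eq]; exact cv_sm hB (neg_sm hA) (neg_cs cA)
lemma cr_cs {A B : R3 → ℝ} (cA : CS A) (cB : CS B) : CS (cr A B) := by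
  rw [cr_eq, cv_eq]; exact HasCompactSupport.convolution _ cB (neg_cs cA)
lemma pd_cr {A B : R3 → ℝ} (hA : Sm A) (cA : CS A) (hB : LocallyIntegrable B) (j : Fin 3) (y : R3) :
    pd (cr A B) j y = - cr (pd A j) B y := by
  rw [cr_eq, pd_cv hB (neg_sm hA) (neg_cs cA), cr_eq]
  unfold cv
  rw [← integral_neg]
  congr 1; ext x
  rw [pd_ng hA]; ring
lemma cr_pd {A B : R3 → ℝ} (hA : Sm A) (hB : Sm B) (cB : CS B) (j : Fin 3) (y : R3) :
    cr A (pd B j) y = - cr (pd A j) B y := by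
  unfold cr
  have h1 : Sm (fun x => A (x - y)) := hA.comp (contDiff_id.sub contDiff_const)
  have e : ∀ x, pd (fun x => A (x - y)) j x = pd A j (x - y) := by
    intro x
    unfold pd
    rw [fderiv_comp_sub]
  rw [ibp h1 hB cB]
  simp_rw [e]
lemma om_even (z : R3) : om (-z) = om z := by simp [om]
def kap : ℝ := gc ^ 2 * ∫ w : R3, Real.exp (-(1/2) * ‖w‖ ^ 2)
lemma kap_pos : 0 < kap := by
  unfold kap
  rw [gauss_integral (by norm_num)]
  have := gc_pos
  positivity
lemma om_om (y : R3) : ∫ w, om w * om (y + w) = kap * Real.exp (-(1/8) * ‖y‖ ^ 2) := by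
  have e : ∀ w, om w * om (y + w) = (gc ^ 2 * Real.exp (-(1/8) * ‖y‖ ^ 2)) * Real.exp (-(1/2) * ‖w + (1/2:ℝ) • y‖ ^ 2) := by
    intro w
    unfold om
    have : -(1/4) * ‖w‖ ^ 2 + -(1/4) * ‖y + w‖ ^ 2 = -(1/8) * ‖y‖ ^ 2 + -(1/2) * ‖w + (1/2:ℝ) • y‖ ^ 2 := by
      rw [norm_add_sq_real, norm_add_sq_real, norm_smul, inner_smul_right, real_inner_comm]
      simp; ring
    calc _ = gc ^ 2 * (Real.exp (-(1/4) * ‖w‖ ^ 2) * Real.exp (-(1/4) * ‖y + w‖ ^ 2)) := by ring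
      _ = _ := by rw [← Real.exp_add, this, Real.exp_add]; ring
  simp_rw [e]
  rw [icm, integral_add_right_eq_self (fun w => Real.exp (-(1/2) * ‖w‖ ^ 2))]
  unfold kap; ring
lemma semi {A B : R3 → ℝ} (hA : Sm A) (cA : CS A) (hB : Sm B) (cB : CS B) {t : ℝ} (ht : 0 < t) :
    ∫ x, hp t A x * hp t B x = kap * ∫ y, Real.exp (-(1/8) * ‖y‖ ^ 2) * cr A B (t • y) := by
  obtain ⟨C1, hC1, hA1⟩ := cs_bdd hA.cont cA
  obtain ⟨C2, hC2, hB1⟩ := cs_bdd hB.cont cB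
  have ac := hA.cont
  have bc := hB.cont
  have oc := om_sm.cont
  have crs := cr_sm hA cA hB.cont.locallyIntegrable
  have crc := cr_cs cA cB
  have s1 : ∫ x, hp t A x * hp t B x = ∫ w, om w * ∫ x, hp t A (x + t • w) * B x := by
    calc ∫ x, hp t A x * hp t B x = ∫ x, ∫ w, om w * (hp t A x * B (x - t • w)) := by
          congr 1; ext x
          unfold hp
          rw [← icm]
          congr 1; ext w; ring
      _ = ∫ w, ∫ x, om w * (hp t A x * B (x - t • w)) :=
          fb om_int (hp_integrable ht (cs_int ac cA)) (D := fun x w => B (x - t • w)) (by fun_prop) (fun x w => hB1 _)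
      _ = _ := by
          congr 1; ext w
          rw [icm]
          congr 1
          rw [← integral_add_right_eq_self _ (t • w)]
          congr 1; ext x; simp
  have s2 : ∀ w, ∫ x, hp t A (x + t • w) * B x = ∫ y, om (y + w) * cr A B (t • y) := by
    intro w
    calc ∫ x, hp t A (x + t • w) * B x = ∫ x, ∫ z, om z * (B x * A (x + t • w - t • z)) := by
          congr 1; ext x
          unfold hp
          rw [← integral_mul_const]
          congr 1; ext z; ring
      _ = ∫ z, ∫ x, om z * (B x * A (x + t • w - t • z)) :=
          fb om_int (cs_int bc cB) (D := fun x z => A (x + t • w - t • z)) (by fun_prop) (fun x w => hA1 _)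
      _ = ∫ z, om z * cr A B (t • (z - w)) := by
          congr 1; ext z
          rw [icm]
          congr 1
          unfold cr
          congr 1; ext x
          rw [mul_comm, smul_sub]; congr 2; abel
      _ = _ := by
          rw [← integral_add_right_eq_self _ w]
          simp
  rw [s1]
  simp_rw [s2]
  have ci : Integrable fun y : R3 => cr A B (t • y) := by
    refine cs_int (by have := crs.cont; fun_prop) ?_
    exact crc.comp_homeomorph (Homeomorph.smulOfNeZero t ht.ne')
  calc ∫ w, om w * ∫ y, om (y + w) * cr A B (t • y) = ∫ w, ∫ y, om w * (cr A B (t • y) * om (y + w)) := by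
        congr 1; ext w
        rw [← icm]
        congr 1; ext y; ring
    _ = ∫ y, ∫ w, om w * (cr A B (t • y) * om (y + w)) :=
        (fb om_int ci (D := fun y w => om (y + w)) (by fun_prop) (fun y w => by
          rw [abs_of_pos (om_pos _)]; exact om_le _)).symm
    _ = _ := by
        rw [← icm]
        congr 1; ext y
        have : ∀ w, om w * (cr A B (t • y) * om (y + w)) = cr A B (t • y) * (om w * om (y + w)) := fun w => by ring
        simp_rw [this]
        rw [icm, om_om]; ring
lemma gam_li : LocallyIntegrable (fun y : R3 => ‖y‖⁻¹) := by
  intro x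
  refine ⟨ball 0 (‖x‖ + 1), isOpen_ball.mem_nhds (by simp), ?_⟩
  have h : Integrable (fun y : R3 => (Set.Iio (‖x‖+1)).indicator (fun r : ℝ => r⁻¹) ‖y‖) := by
    rw [integrable_fun_norm_addHaar (μ := (volume : Measure R3)) (f := (Set.Iio (‖x‖+1)).indicator (fun r : ℝ => r⁻¹))]
    have h2 : IntegrableOn (fun r : ℝ => r) (Set.Ioo 0 (‖x‖+1)) :=
      (continuous_id.integrableOn_Icc (a := 0) (b := ‖x‖ + 1)).mono_set Set.Ioo_subset_Icc_self
    have h3 : Integrable ((Set.Ioo 0 (‖x‖+1)).indicator (fun r : ℝ => r)) := (integrable_indicator_iff measurableSet_Ioo).2 h2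
    refine h3.integrableOn.congr_fun (fun r hr => ?_) measurableSet_Ioi
    have hr0 : (0:ℝ) < r := hr
    simp only [Set.indicator, Set.mem_Ioo, hr0, true_and, Set.mem_Iio, smul_eq_mul]
    split_ifs
    · simp; field_simp
    · simp
  rw [← integrable_indicator_iff measurableSet_ball]
  refine h.congr (evf fun y => ?_)
  simp [Set.indicator]
lemma newt0 {a : ℝ} (ha : 0 < a) : IntegrableOn (fun t : ℝ => 2 * t ^ (-2:ℝ) * Real.exp (-a * (t⁻¹) ^ 2)) (Set.Ioi 0) ∧
    ∫ t in Set.Ioi 0, 2 * t ^ (-2:ℝ) * Real.exp (-a * (t⁻¹) ^ 2) = Real.sqrt (Real.pi / a) := by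
  have h1 : IntegrableOn (fun t : ℝ => 2 * Real.exp (-a * t ^ 2)) (Set.Ioi 0) := ((integrable_exp_neg_mul_sq ha).const_mul 2).integrableOn
  have e : Set.EqOn (fun t : ℝ => (|(-1:ℝ)| * t ^ ((-1:ℝ) - 1)) • (2 * Real.exp (-a * (t ^ (-1:ℝ)) ^ 2))) (fun t : ℝ => 2 * t ^ (-2:ℝ) * Real.exp (-a * (t⁻¹) ^ 2)) (Set.Ioi 0) := by
    intro t ht
    have ht0 : (0:ℝ) < t := ht
    simp only [smul_eq_mul, Real.rpow_neg_one]
    norm_num; ring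
  constructor
  · rw [← integrableOn_congr_fun e measurableSet_Ioi]
    exact (integrableOn_Ioi_comp_rpow_iff (fun t : ℝ => 2 * Real.exp (-a * t ^ 2)) (by norm_num)).2 h1
  · rw [← setIntegral_congr_fun measurableSet_Ioi e, integral_comp_rpow_Ioi (fun t : ℝ => 2 * Real.exp (-a * t ^ 2)) (by norm_num), icm, integral_gaussian_Ioi]
    ring
lemma newt {b : ℝ} (hb : 0 < b) {k : R3 → ℝ} (hk : Continuous k) (ck : CS k) :
    IntegrableOn (fun t : ℝ => 2 * t * ∫ z, Real.exp (-b * ‖z‖ ^ 2) * k (t • z)) (Set.Ioi 0) ∧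
    ∫ t in Set.Ioi 0, 2 * t * ∫ z, Real.exp (-b * ‖z‖ ^ 2) * k (t • z) = Real.sqrt (Real.pi / b) * ∫ y, ‖y‖⁻¹ * k y := by
  have e0 : Set.EqOn (fun t : ℝ => ∫ y, 2 * t ^ (-2:ℝ) * Real.exp (-(b * ‖y‖ ^ 2) * (t⁻¹) ^ 2) * k y) (fun t : ℝ => 2 * t * ∫ z, Real.exp (-b * ‖z‖ ^ 2) * k (t • z)) (Set.Ioi 0) := by
    intro t ht
    have ht0 : (0:ℝ) < t := ht
    have h := Measure.integral_comp_smul_of_nonneg (μ := (volume : Measure R3))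
      (fun y : R3 => Real.exp (-b * ‖t⁻¹ • y‖ ^ 2) * k y) t (hR := ht0.le)
    have h2 : ∀ z : R3, t⁻¹ • t • z = z := fun z => by rw [smul_smul, inv_mul_cancel₀ ht0.ne', one_smul]
    simp only [h2] at h
    simp only
    rw [h, smul_eq_mul, ← icm, ← icm]
    congr 1; ext y
    have h3 : -b * ‖t⁻¹ • y‖ ^ 2 = -(b * ‖y‖ ^ 2) * (t⁻¹) ^ 2 := by
      rw [norm_smul, nrn (by positivity)]; ring
    have h4 : t ^ (-2:ℝ) = (t ^ 2)⁻¹ := by rw [Real.rpow_neg ht0.le]; norm_num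
    rw [h3, h4]
    simp
    field_simp
  have ym : ∀ᵐ y : R3, y ≠ 0 := by
    rw [ae_iff]; simp
  have pt : ∀ y : R3, y ≠ 0 → IntegrableOn (fun t : ℝ => 2 * t ^ (-2:ℝ) * Real.exp (-(b * ‖y‖ ^ 2) * (t⁻¹) ^ 2)) (Set.Ioi 0) ∧
    ∫ t in Set.Ioi 0, 2 * t ^ (-2:ℝ) * Real.exp (-(b * ‖y‖ ^ 2) * (t⁻¹) ^ 2) = Real.sqrt (Real.pi / b) * ‖y‖⁻¹ := by
    intro y hy
    have hy' := norm_pos_iff.2 hy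
    have := newt0 (a := b * ‖y‖ ^ 2) (by positivity)
    refine ⟨this.1, this.2.trans ?_⟩
    rw [← div_div, Real.sqrt_div' _ (by positivity), Real.sqrt_sq hy'.le, div_eq_mul_inv]
  have gi : Integrable (fun y : R3 => ‖y‖⁻¹ * k y) := by
    exact gam_li.integrable_smul_right_of_hasCompactSupport hk ck
  have gi' : Integrable (fun y : R3 => ‖y‖⁻¹ * |k y|) := by
    refine gi.norm.congr (evf fun y => ?_)
    simp
  have PI : Integrable (Function.uncurry fun (t : ℝ) (y : R3) => 2 * t ^ (-2:ℝ) * Real.exp (-(b * ‖y‖ ^ 2) * (t⁻¹) ^ 2) * k y) ((volume.restrict (Set.Ioi 0)).prod volume) := by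
    have km := hk.measurable
    rw [integrable_prod_iff' (by
      apply Measurable.aestronglyMeasurable
      unfold Function.uncurry
      fun_prop)]
    constructor
    · filter_upwards [ym] with y hy
      exact (pt y hy).1.mul_const (k y)
    · refine (gi'.const_mul (Real.sqrt (Real.pi / b))).congr ?_
      filter_upwards [ym] with y hy
      have : Set.EqOn (fun t => ‖Function.uncurry (fun (t : ℝ) (y : R3) => 2 * t ^ (-2:ℝ) * Real.exp (-(b * ‖y‖ ^ 2) * (t⁻¹) ^ 2) * k y) (t, y)‖) (fun t => 2 * t ^ (-2:ℝ) * Real.exp (-(b * ‖y‖ ^ 2) * (t⁻¹) ^ 2) * |k y|) (Set.Ioi 0) := by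
        intro t ht
        have ht0 : (0:ℝ) < t := ht
        simp only [Function.uncurry]
        rw [norm_mul, nrn (by positivity), Real.norm_eq_abs]
      rw [setIntegral_congr_fun measurableSet_Ioi this, integral_mul_const, (pt y hy).2]
      ring
  constructor
  · rw [← integrableOn_congr_fun e0 measurableSet_Ioi]
    exact PI.integral_prod_left
  · rw [← setIntegral_congr_fun measurableSet_Ioi e0, integral_integral_swap PI, ← icm]
    refine integral_congr_ae ?_
    filter_upwards [ym] with y hy
    rw [integral_mul_const, (pt y hy).2]; ring
def gk : ℝ := gc * Real.sqrt (Real.pi / (1/4))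
lemma reprk {k : R3 → ℝ} (hk : Sm k) (ck : CS k) : k 0 = - (gk * ∫ y, ‖y‖⁻¹ * lap k y) := by
  have lc : Continuous (lap k) := by
    unfold lap
    exact continuous_finsetSum _ fun j _ => ((hk.pd j).pd j).cont
  have lcs : CS (lap k) := by
    refine HasCompactSupport.of_support_subset_isCompact (K := tsupport k) ck ?_
    intro x hx
    by_contra h
    apply hx
    unfold lap
    exact Finset.sum_eq_zero fun j _ => pd_zero_off j fun h2 => h (tsupport_pd_subset _ _ h2)
  obtain ⟨hi, he⟩ := newt (b := 1/4) (by norm_num) lc lcs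
  have hd : ∀ t ∈ Set.Ioi (0:ℝ), HasDerivAt (fun t => hp t k 0) (gc * (2 * t * ∫ z, Real.exp (-(1/4) * ‖z‖ ^ 2) * lap k (t • z))) t := by
    intro t ht
    refine (hp_deriv hk ck 0 ht).congr_deriv ?_
    have : ∑ j, hp t (pd (pd k j) j) 0 = gc * ∫ z, Real.exp (-(1/4) * ‖z‖ ^ 2) * lap k (t • z) := by
      unfold hp
      rw [← icm, ← integral_finsetSum _ (fun j _ => hp_integrand_int ((hk.pd j).pd j).cont ((ck.pd j).pd j) t 0)]
      rw [← integral_neg_eq_self]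
      congr 1; ext z
      rw [← Finset.mul_sum, om_even]
      unfold lap om
      simp; ring
    rw [this]; ring
  have h0 : hp 0 k 0 = k 0 := by
    unfold hp; simp; rw [integral_mul_const, om_integral, one_mul]
  have c0 : ContinuousWithinAt (fun t => hp t k 0) (Set.Ici 0) 0 := by
    have := (hp_cont hk.cont ck)
    have h2 : Continuous (fun t : ℝ => hp t k 0) := this.comp (f := fun t : ℝ => (t, (0:R3))) (by fun_prop)
    exact h2.continuousWithinAt
  have lim : Tendsto (fun t => hp t k 0) atTop (nhds 0) := by
    rw [tendsto_zero_iff_abs_tendsto_zero]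
    have h3 : Tendsto (fun t : ℝ => gc * (t ^ 3)⁻¹ * ∫ y, |k y|) atTop (nhds (gc * 0 * ∫ y, |k y|)) :=
      ((tendsto_inv_atTop_zero.comp (tendsto_pow_atTop (by norm_num))).const_mul _).mul_const _
    rw [mul_zero, zero_mul] at h3
    refine squeeze_zero' (evf fun t => abs_nonneg _) ?_ h3
    filter_upwards [eventually_gt_atTop 0] with t ht
    exact hp_decay hk.cont ck ht 0
  have := integral_Ioi_of_hasDerivAt_of_tendsto c0 hd (hi.const_mul _) lim
  rw [icm, he, h0] at this
  unfold gk
  linarith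
lemma cz {τ m : ℝ} (t1 : 1 / 2 ≤ τ) (t2 : τ ≤ 5 / 7) (tm : (1 - τ) * m = 1)
    {f h : R3 → ℝ} (hf : Sm f) (fc : CS f) (hh : Sm h) (hc : CS h) (i j : Fin 3) {a b : ℝ} (ha : 0 ≤ a) (hb : 0 ≤ b)
    (hfa : ∫ x, |f x| ^ (m + 1) ≤ a ^ (m + 1)) (hhb : ∫ x, |h x| ^ (2 - τ) ≤ b ^ (2 - τ)) :
    |kap * Real.sqrt (Real.pi / (1/8)) * ∫ y, ‖y‖⁻¹ * pd (pd (cr h f) i) j y| ≤ 1344 * (a * b) := by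
  have e : ∀ y, cr (pd h i) (pd f j) y = - pd (pd (cr h f) i) j y := by
    intro y
    have e1 : pd (cr h f) i = fun y => - cr (pd h i) f y := funext fun y => pd_cr hh hc hf.cont.locallyIntegrable i y
    rw [cr_pd (hh.pd i) hf fc, e1, pd_neg, pd_cr (hh.pd i) (hc.pd i) hf.cont.locallyIntegrable]
    ring
  have k1 : Sm (cr h f) := cr_sm hh hc hf.cont.locallyIntegrable
  have k2 : CS (cr h f) := cr_cs hc fc
  obtain ⟨hi, he⟩ := newt (b := 1/8) (by norm_num) (((k1.pd i).pd j).cont) ((k2.pd i).pd j)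
  have hs : ∀ t ∈ Set.Ioi (0:ℝ), 2 * t * ∫ x, hp t (pd f j) x * hp t (pd h i) x = -kap * (2 * t * ∫ y, Real.exp (-(1/8) * ‖y‖ ^ 2) * pd (pd (cr h f) i) j (t • y)) := by
    intro t ht
    have := semi (hh.pd i) (hc.pd i) (hf.pd j) (fc.pd j) (t := t) ht
    simp_rw [e, mul_neg, integral_neg] at this
    simp_rw [mul_comm (hp t (pd f j) _)]
    rw [this]; ring
  have B : ∀ a' b' : ℝ, 0 < a' → 0 < b' → a ≤ a' → b ≤ b' → |kap * Real.sqrt (Real.pi / (1/8)) * ∫ y, ‖y‖⁻¹ * pd (pd (cr h f) i) j y| ≤ 1344 * (a' * b') := by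
    intro a' b' ha' hb' haa hbb
    have m0 : 0 ≤ m + 1 := by nlinarith
    have fa : ∫ x, |f x| ^ (m + 1) ≤ a' ^ (m + 1) := hfa.trans (rle' ha haa m0)
    have fb' : ∫ x, |h x| ^ (2 - τ) ≤ b' ^ (2 - τ) := hhb.trans (rle' hb hbb (by linarith))
    have H : Tendsto (fun n : ℕ => ∫ t in ((n:ℝ)+1)⁻¹..((n:ℝ)+1), 2 * t * ∫ x, hp t (pd f j) x * hp t (pd h i) x) atTop
        (nhds (∫ t in Set.Ioi 0, -kap * (2 * t * ∫ y, Real.exp (-(1/8) * ‖y‖ ^ 2) * pd (pd (cr h f) i) j (t • y)))) := by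
      have n0 : Tendsto (fun n : ℕ => ((n:ℝ)+1)⁻¹) atTop (nhds 0) := by
        simpa [one_div] using tendsto_one_div_add_atTop_nhds_zero_nat (𝕜 := ℝ)
      have nb : Tendsto (fun n : ℕ => (n:ℝ) + 1) atTop atTop := tendsto_natCast_atTop_atTop.atTop_add (tendsto_const_nhds (x := (1:ℝ)))
      have ac := (aecover_Ioi_of_Ioi (μ := (volume : Measure ℝ)) n0).inter (aecover_Iic (μ := volume.restrict (Set.Ioi (0:ℝ))) nb)
      have hl := ac.integral_tendsto_of_countably_generated (hi.const_mul (-kap))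
      refine hl.congr fun n => ?_
      have hn : (0:ℝ) < ((n:ℝ)+1)⁻¹ := by positivity
      have h1 : (1:ℝ) ≤ (n:ℝ) + 1 := by linarith [Nat.cast_nonneg (α := ℝ) n]
      rw [intervalIntegral.integral_of_le ((inv_le_one_of_one_le₀ h1).trans h1), Set.Ioi_inter_Iic, Measure.restrict_restrict measurableSet_Ioc]
      rw [Set.inter_eq_left.2 (show Set.Ioc ((n:ℝ)+1)⁻¹ ((n:ℝ)+1) ⊆ Set.Ioi 0 from fun t ht => hn.trans ht.1)]
      exact setIntegral_congr_fun measurableSet_Ioc fun t ht => (hs t (hn.trans ht.1)).symm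
    refine le_of_tendsto' (b := 1344 * (a' * b')) (x := atTop) ?_ (fun n : ℕ => bl4 t1 t2 tm hf fc hh hc (ε := ((n:ℝ)+1)⁻¹) (T := (n:ℝ)+1) (by positivity) ?_ j i ha' hb' fa fb')
    · convert H.abs using 2
      rw [icm, he]
      rw [neg_mul, abs_neg, mul_assoc]
    · have : (1:ℝ) ≤ (n:ℝ) + 1 := by linarith [Nat.cast_nonneg (α := ℝ) n]
      exact (inv_le_one_of_one_le₀ this).trans this
  have lm : Tendsto (fun n : ℕ => 1344 * ((a + ((n:ℝ)+1)⁻¹) * (b + ((n:ℝ)+1)⁻¹))) atTop (nhds (1344 * ((a + 0) * (b + 0)))) := by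
    have n0 : Tendsto (fun n : ℕ => ((n:ℝ)+1)⁻¹) atTop (nhds 0) := by
      simpa [one_div] using tendsto_one_div_add_atTop_nhds_zero_nat (𝕜 := ℝ)
    exact ((n0.const_add a).mul (n0.const_add b)).const_mul _
  rw [add_zero, add_zero] at lm
  refine ge_of_tendsto' lm fun n => ?_
  have hn : 0 < ((n:ℝ)+1)⁻¹ := by positivity
  exact B _ _ (by linarith) (by linarith) (by linarith) (by linarith)
lemma pd_ev {f g : R3 → ℝ} {x : R3} (h : f =ᶠ[nhds x] g) (j : Fin 3) : pd f j =ᶠ[nhds x] pd g j := by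
  filter_upwards [h.fderiv (𝕜 := ℝ)] with y hy
  unfold pd; rw [hy]
lemma pd_on {f g : R3 → ℝ} {s : Set R3} (hs : IsOpen s) (h : ∀ x ∈ s, f x = g x) (j : Fin 3) : ∀ x ∈ s, pd f j x = pd g j x :=
  fun x hx => (pd_ev (eventually_of_mem (hs.mem_nhds hx) h) j).eq_of_nhds
lemma lap_on {f g : R3 → ℝ} {s : Set R3} (hs : IsOpen s) (h : ∀ x ∈ s, f x = g x) : ∀ x ∈ s, lap f x = lap g x :=
  fun x hx => Finset.sum_congr rfl fun j _ => pd_on hs (pd_on hs h j) j x hx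
lemma co_sm (i : Fin 3) : Sm (fun y : R3 => y i) := ((EuclideanSpace.proj i : R3 →L[ℝ] ℝ)).contDiff
lemma pd_co (i j : Fin 3) (x : R3) : pd (fun y : R3 => y i) j x = if i = j then 1 else 0 := by
  unfold pd
  have : fderiv ℝ (fun y : R3 => y i) x = (EuclideanSpace.proj i : R3 →L[ℝ] ℝ) :=
    ((EuclideanSpace.proj i : R3 →L[ℝ] ℝ)).hasFDerivAt.fderiv
  rw [this]
  simp [Pi.single_apply]
lemma nsq (y : R3) : ‖y‖ ^ 2 = ∑ i, y i ^ 2 := by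
  rw [EuclideanSpace.norm_sq_eq]; simp
lemma nsq_sm : Sm (fun y : R3 => ‖y‖ ^ 2) := contDiff_norm_sq ℝ
lemma pd_nsq (j : Fin 3) (x : R3) : pd (fun y : R3 => ‖y‖ ^ 2) j x = 2 * x j := by
  simp_rw [nsq]
  rw [pd_sum (fun i => (co_sm i).pow 2)]
  simp_rw [pd_sq (co_sm _), pd_co]
  simp
lemma lap_cs {k : R3 → ℝ} (ck : CS k) : CS (lap k) := by
  refine HasCompactSupport.of_support_subset_isCompact (K := tsupport k) ck ?_
  intro x hx
  by_contra h
  apply hx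
  unfold lap
  exact Finset.sum_eq_zero fun j _ => pd_zero_off j fun h2 => h (tsupport_pd_subset _ _ h2)
lemma lap_sm {k : R3 → ℝ} (hk : Sm k) : Sm (lap k) := by
  unfold lap
  exact ContDiff.sum fun j _ => (hk.pd j).pd j
lemma abs_co (y : R3) (i : Fin 3) : |y i| ≤ ‖y‖ := PiLp.norm_apply_le y i
lemma exG : ∃ (G : R3 → ℝ) (C : ℝ), Sm G ∧ 0 ≤ C ∧ (∀ y : R3, 1/2 ≤ ‖y‖ → G y = ‖y‖⁻¹) ∧ (∀ i j y, |pd (pd G i) j y| ≤ C) ∧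
    (∀ y : R3, 1/2 ≤ ‖y‖ → lap G y = 0) := by
  let b : ContDiffBump (0 : R3) := ⟨1/8, 1/4, by norm_num, by norm_num⟩
  have bs : Sm b := b.contDiff
  let h : R3 → ℝ := fun y => ‖y‖ ^ 2 + b y
  have hs : Sm h := nsq_sm.add bs
  have hpos : ∀ y, 0 < h y := by
    intro y
    by_cases hy : y = 0
    · have : b y = 1 := b.one_of_mem_closedBall (by simp [hy, b])
      simp only [h, this]; positivity
    · have := norm_pos_iff.2 hy
      have : 0 ≤ b y := b.nonneg
      simp only [h]; positivity
  have so : IsOpen {y : R3 | 1/4 < ‖y‖} := isOpen_lt continuous_const continuous_norm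
  have ho : ∀ y ∈ {y : R3 | 1/4 < ‖y‖}, h y = ‖y‖ ^ 2 := by
    intro y hy
    have : b y = 0 := b.zero_of_le_dist (by have : 1/4 < ‖y‖ := hy; simpa [b] using this.le)
    simp [h, this]
  have hp1 : ∀ i, ∀ y ∈ {y : R3 | 1/4 < ‖y‖}, pd h i y = 2 * y i := by
    intro i y hy
    rw [pd_on so ho i y hy, pd_nsq]
  have hp2 : ∀ i j, ∀ y ∈ {y : R3 | 1/4 < ‖y‖}, pd (pd h i) j y = if i = j then 2 else 0 := by
    intro i j y hy
    rw [pd_on so (hp1 i) j y hy, pd_cmul (co_sm i), pd_co]; split_ifs <;> norm_num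
  have Gs : Sm (fun y => h y ^ (-(1/2):ℝ)) := sm_rpow hs hpos _
  have Gp : ∀ i j y, pd (pd (fun y => h y ^ (-(1/2):ℝ)) i) j y = -(1/2) * ((-(1/2) - 1) * h y ^ (-(1/2) - 1 - 1:ℝ) * pd h j y * pd h i y + h y ^ (-(1/2) - 1:ℝ) * pd (pd h i) j y) := by
    intro i j y
    have : pd (fun y => h y ^ (-(1/2):ℝ)) i = fun y => -(1/2) * (h y ^ (-(1/2) - 1:ℝ) * pd h i y) := by
      ext y; rw [pd_rpow hs hpos]; ring
    rw [this, pd_cmul ((sm_rpow hs hpos _).mul (hs.pd i)), pd_mul (sm_rpow hs hpos _) (hs.pd i), pd_rpow hs hpos]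
  have Gf : ∀ i j, ∀ y ∈ {y : R3 | 1/4 < ‖y‖}, pd (pd (fun y => h y ^ (-(1/2):ℝ)) i) j y = (3 * y i * y j - (if i = j then ‖y‖ ^ 2 else 0)) * (‖y‖ ^ 5)⁻¹ := by
    intro i j y hy
    have hy0 : 0 < ‖y‖ := lt_trans (by norm_num) hy
    rw [Gp, hp1 i y hy, hp1 j y hy, hp2 i j y hy, ho y hy]
    have e1 : (‖y‖ ^ 2) ^ (-(1/2) - 1 - 1:ℝ) = (‖y‖ ^ 5)⁻¹ := by
      rw [← rnc, ← rmu hy0.le, ← rnc, ← Real.rpow_neg hy0.le]; norm_num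
    have e2 : (‖y‖ ^ 2) ^ (-(1/2) - 1:ℝ) = (‖y‖ ^ 3)⁻¹ := by
      rw [← rnc, ← rmu hy0.le, ← rnc, ← Real.rpow_neg hy0.le]; norm_num
    rw [e1, e2]
    split_ifs
    · field_simp; ring
    · ring
  have cb : ∀ i j, ∃ C, ∀ y ∈ closedBall (0:R3) 1, ‖pd (pd (fun y => h y ^ (-(1/2):ℝ)) i) j y‖ ≤ C := fun i j =>
    (isCompact_closedBall (0:R3) 1).exists_bound_of_continuousOn ((Gs.pd i).pd j).cont.continuousOn
  choose Cf hCf using cb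
  have C0 : ∀ i j, 0 ≤ Cf i j := fun i j => (norm_nonneg _).trans (hCf i j 0 (by simp))
  refine ⟨fun y => h y ^ (-(1/2):ℝ), 4 + ∑ i, ∑ j, Cf i j, Gs, ?_, ?_, ?_, ?_⟩
  · have : 0 ≤ ∑ i, ∑ j, Cf i j := Finset.sum_nonneg fun i _ => Finset.sum_nonneg fun j _ => C0 i j
    linarith
  · intro y hy
    have hy0 : 0 < ‖y‖ := lt_of_lt_of_le (by norm_num) hy
    simp only
    rw [ho y (by simp; linarith), ← rnc, ← rmu hy0.le, ← Real.rpow_neg_one]; norm_num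
  · intro i j y
    have l1 : Cf i j ≤ ∑ i, ∑ j, Cf i j :=
      (Finset.single_le_sum (f := fun j => Cf i j) (fun j _ => C0 i j) (Finset.mem_univ j)).trans
      (Finset.single_le_sum (f := fun i => ∑ j, Cf i j) (fun i _ => Finset.sum_nonneg fun j _ => C0 i j) (Finset.mem_univ i))
    by_cases hy : ‖y‖ ≤ 1
    · have := hCf i j y (by simpa using hy)
      rw [Real.norm_eq_abs] at this
      linarith
    · push Not at hy
      rw [Gf i j y (by simp; linarith)]
      have a1 := abs_co y i
      have a2 := abs_co y j
      have hn : (0:ℝ) < ‖y‖ := by linarith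
      have b1 : |3 * y i * y j - (if i = j then ‖y‖ ^ 2 else 0)| ≤ 4 * ‖y‖ ^ 2 := by
        have c1 : |y i * y j| ≤ ‖y‖ ^ 2 := by
          rw [abs_mul, sq]; exact mul_le_mul a1 a2 (abs_nonneg _) hn.le
        rw [abs_le] at c1 ⊢
        have := sq_nonneg ‖y‖
        split_ifs <;> constructor <;> nlinarith
      rw [abs_mul, abs_of_pos (by positivity : 0 < (‖y‖ ^ 5)⁻¹)]
      have b2 : 4 * ‖y‖ ^ 2 * (‖y‖ ^ 5)⁻¹ ≤ 4 := by
        have : 4 * ‖y‖ ^ 2 * (‖y‖ ^ 5)⁻¹ = 4 * (‖y‖ ^ 3)⁻¹ := by field_simp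
        rw [this]
        have := inv_le_one_of_one_le₀ (one_le_pow₀ hy.le (n := 3))
        linarith
      have := mlr b1 (by positivity : 0 ≤ (‖y‖ ^ 5)⁻¹)
      have := C0 i j
      linarith
  · intro y hy
    unfold lap
    simp_rw [Gf _ _ y (by simp; linarith : y ∈ {y : R3 | 1/4 < ‖y‖})]
    rw [← Finset.sum_mul]
    have := nsq y
    simp only [Fin.sum_univ_three] at this ⊢
    simp
    left
    linarith
lemma curve {Q : R3 → ℝ} (hQ : Sm Q) {S : Set R3} {M L T : ℝ} (hM : 0 ≤ M) (hT : 0 ≤ T) (hb : ∀ x ∈ S, ∀ v, |fderiv ℝ Q x v| ≤ M * ‖v‖)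
    {γ γ' : ℝ → R3} (hγ : ∀ s, HasDerivAt γ (γ' s) s) (hS : ∀ s ∈ Set.Icc 0 T, γ s ∈ S) (hL : ∀ s ∈ Set.Icc 0 T, ‖γ' s‖ ≤ L) :
    |Q (γ T) - Q (γ 0)| ≤ M * L * T := by
  have hd : ∀ s ∈ Set.Icc 0 T, HasDerivWithinAt (fun s => Q (γ s)) (fderiv ℝ Q (γ s) (γ' s)) (Set.Icc 0 T) s := fun s _ =>
    ((hQ.diff (γ s)).hasFDerivAt.comp_hasDerivAt s (hγ s)).hasDerivWithinAt
  have := norm_image_sub_le_of_norm_deriv_le_segment' (C := M * L) hd (fun s hs => by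
    have hs' : s ∈ Set.Icc 0 T := ⟨hs.1, hs.2.le⟩
    exact (hb _ (hS s hs') _).trans (mll (hL s hs') hM)) T ⟨hT, le_rfl⟩
  simpa using this
lemma orth2 (e e' : R3) : ∃ n : R3, ‖n‖ = 1 ∧ inner ℝ e n = 0 ∧ inner ℝ e' n = 0 := by
  let K := Submodule.span ℝ ({e, e'} : Set R3)
  have h1 : Module.finrank ℝ K ≤ 2 := by
    have := finrank_span_le_card (R := ℝ) ({e, e'} : Set R3)
    refine this.trans ?_
    simpa using Finset.card_le_two (a := e) (b := e')
  have h2 := K.finrank_add_finrank_orthogonal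
  have h3 : Module.finrank ℝ R3 = 3 := by simp
  have h4 : Kᗮ ≠ ⊥ := by
    intro h
    rw [h, h3] at h2
    simp at h2
    omega
  obtain ⟨w, hw, hw0⟩ := Submodule.exists_mem_ne_zero_of_ne_bot h4
  have hn : ‖w‖ ≠ 0 := norm_ne_zero_iff.2 hw0
  rw [Submodule.mem_orthogonal] at hw
  refine ⟨‖w‖⁻¹ • w, ?_, ?_, ?_⟩
  · rw [norm_smul, norm_inv, norm_norm, inv_mul_cancel₀ hn]
  · rw [inner_smul_right, hw e (Submodule.subset_span (by simp)), mul_zero]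
  · rw [inner_smul_right, hw e' (Submodule.subset_span (by simp)), mul_zero]
section
variable {Q : R3 → ℝ} {M a b : ℝ} (hQ : Sm Q) (ha : 0 < a) (hab : a ≤ b) (hM : 0 ≤ M)
    (hb : ∀ x ∈ {x : R3 | a ≤ ‖x‖ ∧ ‖x‖ ≤ b}, ∀ v, |fderiv ℝ Q x v| ≤ M * ‖v‖)
include hQ ha hab hM hb
lemma osc1 (e : R3) (he : ‖e‖ = 1) {r : ℝ} (h1 : a ≤ r) (h2 : r ≤ b) : |Q (r • e) - Q (a • e)| ≤ M * (b - a) := by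
  have := curve hQ hM (T := r - a) (L := 1) (by linarith) hb (γ := fun s => (a + s) • e) (γ' := fun s => e) (fun s => by
    have := ((hasDerivAt_id s).const_add a).smul_const e
    simpa using this) (fun s hs => by
      have : 0 ≤ a + s := by linarith [hs.1]
      simp only [Set.mem_ofPred_eq, norm_smul, he, nrn this]
      constructor <;> linarith [hs.1, hs.2]) (fun s hs => he.le)
  simp only [add_sub_cancel, add_zero] at this
  refine this.trans ?_
  nlinarith
lemma osc2 (e n : R3) (he : ‖e‖ = 1) (hn : ‖n‖ = 1) (ho : inner ℝ e n = 0) : |Q (a • n) - Q (a • e)| ≤ M * (2 * a) := by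
  have nn : ∀ c s : ℝ, c ^ 2 + s ^ 2 = 1 → ‖c • e + s • n‖ = 1 := by
    intro c s h
    have : ‖c • e + s • n‖ ^ 2 = 1 := by
      rw [norm_add_sq_real, norm_smul, norm_smul, inner_smul_left, inner_smul_right, ho, he, hn]
      simp [h]
    nlinarith [norm_nonneg (c • e + s • n)]
  have := curve hQ hM (T := Real.pi / 2) (L := a) (by positivity) hb (γ := fun s => a • (Real.cos s • e + Real.sin s • n))
    (γ' := fun s => a • ((- Real.sin s) • e + Real.cos s • n)) (fun s =>
    (((Real.hasDerivAt_cos s).smul_const e).add ((Real.hasDerivAt_sin s).smul_const n)).const_smul a) (fun s hs => by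
      simp only [Set.mem_ofPred_eq, norm_smul, nn _ _ (Real.cos_sq_add_sin_sq s), nrn ha.le]
      constructor <;> linarith) (fun s hs => by
      rw [norm_smul, nn _ _ (by rw [neg_sq]; exact Real.sin_sq_add_cos_sq s), nrn ha.le, mul_one])
  simp only [Real.cos_pi_div_two, Real.sin_pi_div_two, Real.cos_zero, Real.sin_zero, zero_smul, one_smul, zero_add, add_zero] at this
  refine this.trans ?_
  have h4 := Real.pi_le_four
  have : 0 ≤ M * a := by positivity
  nlinarith
lemma osc (x x' : R3) (hx : a ≤ ‖x‖ ∧ ‖x‖ ≤ b) (hx' : a ≤ ‖x'‖ ∧ ‖x'‖ ≤ b) : |Q x - Q x'| ≤ M * (2 * (b - a) + 4 * a) := by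
  have un : ∀ x : R3, a ≤ ‖x‖ → ‖‖x‖⁻¹ • x‖ = 1 ∧ ‖x‖ • ‖x‖⁻¹ • x = x := by
    intro x hx
    have hn : ‖x‖ ≠ 0 := by linarith
    exact ⟨by rw [norm_smul, norm_inv, norm_norm, inv_mul_cancel₀ hn], by rw [smul_smul, mul_inv_cancel₀ hn, one_smul]⟩
  obtain ⟨e1, e2⟩ := un x hx.1
  obtain ⟨e1', e2'⟩ := un x' hx'.1
  obtain ⟨n, hn, o1, o2⟩ := orth2 (‖x‖⁻¹ • x) (‖x'‖⁻¹ • x')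
  have A := osc1 hQ ha hab hM hb _ e1 hx.1 hx.2
  have B := osc1 hQ ha hab hM hb _ e1' hx'.1 hx'.2
  have C := osc2 hQ ha hab hM hb _ n e1 hn o1
  have D := osc2 hQ ha hab hM hb _ n e1' hn o2
  rw [e2] at A
  rw [e2'] at B
  rw [abs_le] at *
  constructor <;> linarith [A.1, A.2, B.1, B.2, C.1, C.2, D.1, D.2]
end
lemma cv_pdl {K g : R3 → ℝ} (hK : Sm K) (hg : Sm g) (cg : CS g) (j : Fin 3) (x : R3) :
    cv K (pd g j) x = cv (pd K j) g x := by
  unfold cv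
  have h1 : Sm (fun y => g (x - y)) := by simpa using aff_sm hg x 1
  have h2 : CS (fun y => g (x - y)) := by simpa using aff_cs cg x one_ne_zero
  have e : ∀ y, pd (fun y => g (x - y)) j y = - pd g j (x - y) := by
    intro y; simpa using pd_aff hg x 1 j y
  have := ibp hK h1 h2 j
  simp_rw [e, mul_neg, integral_neg] at this
  linarith
lemma cv_le {K g : R3 → ℝ} {C : ℝ} (hC : ∀ y, |K y| ≤ C) (hg : Integrable g) (x : R3) : |cv K g x| ≤ C * ∫ y, |g y| := by
  rw [cv_swap, ← icm, ← Real.norm_eq_abs]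
  refine norm_integral_le_of_norm_le (hg.abs.const_mul C) (evf fun y => ?_)
  rw [Real.norm_eq_abs, abs_mul]
  exact mlr (hC _) (abs_nonneg _)
lemma cr_l1 {A B : R3 → ℝ} (hA : Continuous A) (cA : CS A) (hB : Continuous B) (cB : CS B) : ∫ y, |cr A B y| ≤ (∫ x, |A x|) * ∫ x, |B x| := by
  obtain ⟨CA, hCA, hA1⟩ := cs_bdd hA cA
  have PI : Integrable (Function.uncurry fun y x => |A (x - y)| * |B x|) ((volume : Measure R3).prod (volume : Measure R3)) := by
    have h1 : Integrable (fun x => |A (-x)|) := (cs_int hA cA).abs.comp_neg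
    have := (cs_int hB cB).abs.convolution_integrand (ContinuousLinearMap.mul ℝ ℝ) h1
    refine this.congr (evf fun z => ?_)
    simp [Function.uncurry, mul_comm]
  have sw : ∫ y, ∫ x, |A (x - y)| * |B x| = ∫ x, ∫ y, |A (x - y)| * |B x| := integral_integral_swap PI
  have e : ∫ x, ∫ y, |A (x - y)| * |B x| = (∫ x, |A x|) * ∫ x, |B x| := by
    rw [← icm]
    congr 1; ext x
    rw [integral_mul_const, integral_sub_left_eq_self (fun y => |A y|)]
  rw [← e, ← sw]
  refine integral_mono_of_nonneg (evf fun _ => abs_nonneg _) ?_ (evf fun y => ?_)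
  · exact PI.integral_prod_left
  · simp only [cr, ← abs_mul]
    exact abs_integral_le_integral_abs
lemma pdpd_cr {A B : R3 → ℝ} (hA : Sm A) (cA : CS A) (hB : LocallyIntegrable B) (i j : Fin 3) (y : R3) :
    pd (pd (cr A B) i) j y = cr (pd (pd A i) j) B y := by
  have e1 : pd (cr A B) i = fun y => - cr (pd A i) B y := funext fun y => pd_cr hA cA hB i y
  rw [e1, pd_neg, pd_cr (hA.pd i) (cA.pd i) hB]; ring
lemma ibp2 {f g : R3 → ℝ} (hf : Sm f) (hg : Sm g) (h : CS g) (i j : Fin 3) :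
    ∫ x, f x * pd (pd g i) j x = ∫ x, pd (pd f j) i x * g x := by
  rw [ibp hf (hg.pd i) (h.pd i), ibp (hf.pd j) hg h, neg_neg]
lemma gam_int {k : R3 → ℝ} (hk : Continuous k) (ck : CS k) : Integrable (fun y : R3 => ‖y‖⁻¹ * k y) :=
  gam_li.integrable_smul_right_of_hasCompactSupport hk ck
lemma cr_sum {A : Fin 3 → R3 → ℝ} {B : R3 → ℝ} (hA : ∀ i, Continuous (A i)) (hB : Continuous B) (cB : CS B) (y : R3) :
    cr (fun x => ∑ i, A i x) B y = ∑ i, cr (A i) B y := by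
  unfold cr
  rw [← integral_finsetSum]
  · congr 1; ext x; rw [Finset.sum_mul]
  · intro i _
    have := hA i
    exact cs_int (by fun_prop) cB.mulr
lemma press0 : ∃ C : ℝ, 0 ≤ C ∧ ∀ (τ m ρ : ℝ), 1/2 ≤ τ → τ ≤ 5/7 → (1 - τ) * m = 1 → 1 ≤ ρ →
    ∀ (P : R3 → ℝ) (U : Fin 3 → R3 → ℝ) (F : Fin 3 → Fin 3 → R3 → ℝ) (f : R3 → ℝ),
    Sm P → CS P → (∀ i, Sm (U i)) → (∀ i, CS (U i)) → (∀ i j, Sm (F i j)) → (∀ i j, CS (F i j)) → Sm f → CS f →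
    (∀ x, f x ≠ 0 → ρ + 3 ≤ ‖x‖ ∧ ‖x‖ ≤ ρ + 5) → ∫ x, f x = 0 →
    (∀ z : R3, ρ + 2 < ‖z‖ → ‖z‖ < ρ + 6 → ∀ i, pd P i z = lap (U i) z - ∑ j, pd (F i j) j z) →
    (∀ z : R3, ρ + 2 < ‖z‖ → ‖z‖ < ρ + 6 → lap P z = - ∑ i, ∑ j, pd (pd (F i j) i) j z) →
    ∀ (u1 F1 f1 a b : ℝ), 0 ≤ a → 0 ≤ b → (∀ i, ∫ x, |U i x| ≤ u1) → (∀ i j, ∫ x, |F i j x| ≤ F1) → ∫ x, |f x| ≤ f1 →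
    ∫ x, |f x| ^ (m + 1) ≤ a ^ (m + 1) → (∀ i j, ∫ x, |F i j x| ^ (2 - τ) ≤ b ^ (2 - τ)) →
    |∫ x, P x * f x| ≤ C * (a * b + ρ * (u1 + F1) * f1) := by
  obtain ⟨G, CG, Gs, CG0, GΓ, Gb, Gl⟩ := exG
  have κs : Sm (lap G) := lap_sm Gs
  have κc : CS (lap G) := by
    refine HasCompactSupport.of_support_subset_isCompact (isCompact_closedBall (0:R3) (1/2)) fun y hy => ?_
    by_contra h
    simp only [mem_closedBall, dist_zero_right, not_le] at h
    exact hy (Gl y h.le)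
  obtain ⟨K, K0, hK1, hK2⟩ : ∃ K : ℝ, 0 ≤ K ∧ (∀ j y, |pd (lap G) j y| ≤ K) ∧ ∀ j y, |pd (pd (lap G) j) j y| ≤ K := by
    choose k1 k10 hk1 using fun j => cs_bdd (κs.pd j).cont (κc.pd j)
    choose k2 k20 hk2 using fun j => cs_bdd ((κs.pd j).pd j).cont ((κc.pd j).pd j)
    refine ⟨∑ j, (k1 j + k2 j), Finset.sum_nonneg fun j _ => add_nonneg (k10 j) (k20 j), fun j y => ?_, fun j y => ?_⟩
    · refine (hk1 j y).trans (le_trans ?_ (Finset.single_le_sum (f := fun j => k1 j + k2 j) (fun j _ => add_nonneg (k10 j) (k20 j)) (Finset.mem_univ j)))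
      linarith [k20 j]
    · refine (hk2 j y).trans (le_trans ?_ (Finset.single_le_sum (f := fun j => k1 j + k2 j) (fun j _ => add_nonneg (k10 j) (k20 j)) (Finset.mem_univ j)))
      linarith [k10 j]
  have gk0 : 0 ≤ gk := by unfold gk; have := gc_pos; positivity
  have kp : 0 < kap * Real.sqrt (Real.pi / (1/8)) := by have := kap_pos; have := Real.pi_pos; positivity
  refine ⟨gk * (9 * (1344 / (kap * Real.sqrt (Real.pi / (1/8)))) + 9 * CG + 180 * K), by positivity, ?_⟩
  intro τ m ρ t1 t2 tm hρ P U F f Ps Pc Us Uc Fs Fc fs fc fS f0 h1 h2 u1 F1 f1 a b ha hb hU hF hf hfa hFb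
  have fl := fs.cont.locallyIntegrable (μ := (volume : Measure R3))
  have cs := cr_sm Ps Pc fl
  have cc := cr_cs Pc fc
  have cFs := fun i j => cr_sm (Fs i j) (Fc i j) fl
  have cFc := fun i j => cr_cs (Fc i j) fc
  have u10 : 0 ≤ u1 := (integral_nonneg fun x => abs_nonneg _).trans (hU 0)
  have F10 : 0 ≤ F1 := (integral_nonneg fun x => abs_nonneg _).trans (hF 0 0)
  have f10 : 0 ≤ f1 := (integral_nonneg fun x => abs_nonneg _).trans hf
  have reg : ∀ y x : R3, ‖y‖ < 1 → f x ≠ 0 → ρ + 2 < ‖x - y‖ ∧ ‖x - y‖ < ρ + 6 := by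
    intro y x hy hx
    have := fS x hx
    have a1 := norm_sub_norm_le x y
    have a2 := norm_sub_le x y
    constructor <;> linarith [this.1, this.2]
  have e0 : ∫ x, P x * f x = cr P f 0 := by simp [cr]
  have lapc : ∀ y, ‖y‖ < 1 → lap (cr P f) y = - ∑ i, ∑ j, pd (pd (cr (F i j) f) i) j y := by
    intro y hy
    simp_rw [pdpd_cr (Fs _ _) (Fc _ _) fl]
    unfold lap
    simp_rw [pdpd_cr Ps Pc fl]
    rw [← cr_sum (fun j => ((Ps.pd j).pd j).cont) fs.cont fc]
    simp_rw [← cr_sum (fun j => (((Fs _ j).pd _).pd j).cont) fs.cont fc]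
    rw [← cr_sum (fun i => continuous_finsetSum _ fun j _ => (((Fs i j).pd i).pd j).cont) fs.cont fc]
    unfold cr
    rw [← integral_neg]
    congr 1; ext x
    by_cases hx : f x = 0
    · simp [hx]
    · have := h2 (x - y) (reg y x hy hx).1 (reg y x hy hx).2
      unfold lap at this
      simp only
      rw [this]; ring
  have pw : ∀ y, ‖y‖⁻¹ * lap (cr P f) y = - (∑ i, ∑ j, ‖y‖⁻¹ * pd (pd (cr (F i j) f) i) j y) + (∑ i, ∑ j, G y * pd (pd (cr (F i j) f) i) j y) + G y * lap (cr P f) y := by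
    intro y
    simp_rw [← Finset.mul_sum]
    by_cases hy : 1/2 ≤ ‖y‖
    · rw [GΓ y hy]; ring
    · rw [lapc y (by linarith)]; ring
  have i1 : ∀ i j, Integrable fun y => ‖y‖⁻¹ * pd (pd (cr (F i j) f) i) j y := fun i j =>
    gam_int (((cFs i j).pd i).pd j).cont (((cFc i j).pd i).pd j)
  have i2 : ∀ i j, Integrable fun y => G y * pd (pd (cr (F i j) f) i) j y := fun i j =>
    cs_int (Gs.cont.mul (((cFs i j).pd i).pd j).cont) (((cFc i j).pd i).pd j).mulr
  have i3 : Integrable fun y => G y * lap (cr P f) y := cs_int (Gs.cont.mul (lap_sm cs).cont) (lap_cs cc).mulr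
  have i1' : Integrable fun y => ∑ i, ∑ j, ‖y‖⁻¹ * pd (pd (cr (F i j) f) i) j y :=
    integrable_finsetSum _ fun i _ => integrable_finsetSum _ fun j _ => i1 i j
  have i2' : Integrable fun y => ∑ i, ∑ j, G y * pd (pd (cr (F i j) f) i) j y :=
    integrable_finsetSum _ fun i _ => integrable_finsetSum _ fun j _ => i2 i j
  have gl : ∫ y, G y * lap (cr P f) y = ∫ y, lap G y * cr P f y := by
    unfold lap
    simp_rw [Finset.mul_sum, Finset.sum_mul]
    have q1 : ∀ j, Integrable fun y => G y * pd (pd (cr P f) j) j y := fun j => cs_int (Gs.cont.mul ((cs.pd j).pd j).cont) ((cc.pd j).pd j).mulr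
    have q2 : ∀ j, Integrable fun y => pd (pd G j) j y * cr P f y := fun j => cs_int (((Gs.pd j).pd j).cont.mul cs.cont) cc.mulr
    rw [integral_finsetSum _ (fun j _ => q1 j), integral_finsetSum _ (fun j _ => q2 j)]
    exact Finset.sum_congr rfl fun j _ => ibp2 Gs cs cc j j
  have main : cr P f 0 = gk * ((∑ i, ∑ j, ∫ y, ‖y‖⁻¹ * pd (pd (cr (F i j) f) i) j y) - (∑ i, ∑ j, ∫ y, G y * pd (pd (cr (F i j) f) i) j y) - ∫ y, lap G y * cr P f y) := by
    rw [reprk cs cc]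
    simp_rw [pw]
    have i1n : Integrable fun y => -∑ i, ∑ j, ‖y‖⁻¹ * pd (pd (cr (F i j) f) i) j y := i1'.neg
    have i12 : Integrable fun y => -(∑ i, ∑ j, ‖y‖⁻¹ * pd (pd (cr (F i j) f) i) j y) + ∑ i, ∑ j, G y * pd (pd (cr (F i j) f) i) j y := i1n.add i2'
    rw [integral_add i12 i3, integral_add i1n i2', integral_neg, gl]
    rw [integral_finsetSum _ (fun i _ => integrable_finsetSum _ fun j _ => i1 i j), integral_finsetSum _ (fun i _ => integrable_finsetSum _ fun j _ => i2 i j)]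
    simp_rw [integral_finsetSum _ (fun j _ => i1 _ j), integral_finsetSum _ (fun j _ => i2 _ j)]
    ring
  have B1 : ∀ i j, |∫ y, ‖y‖⁻¹ * pd (pd (cr (F i j) f) i) j y| ≤ 1344 / (kap * Real.sqrt (Real.pi / (1/8))) * (a * b) := by
    intro i j
    have := cz t1 t2 tm fs fc (Fs i j) (Fc i j) i j ha hb hfa (hFb i j)
    rw [abs_mul, abs_of_pos kp] at this
    rw [div_mul_eq_mul_div, le_div_iff₀ kp]
    linarith
  have B2 : ∀ i j, |∫ y, G y * pd (pd (cr (F i j) f) i) j y| ≤ CG * (F1 * f1) := by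
    intro i j
    rw [ibp2 Gs (cFs i j) (cFc i j), ← Real.norm_eq_abs]
    have l1 := cr_l1 (Fs i j).cont (Fc i j) fs.cont fc
    have l2 : (∫ x, |F i j x|) * ∫ x, |f x| ≤ F1 * f1 := mul_le_mul (hF i j) hf (integral_nonneg fun x => abs_nonneg _) F10
    refine (norm_integral_le_of_norm_le ((cs_int (cFs i j).cont (cFc i j)).abs.const_mul CG) (evf fun y => ?_)).trans ?_
    · rw [Real.norm_eq_abs, abs_mul]; exact mlr (Gb _ _ _) (abs_nonneg _)
    · rw [icm]; exact mll (l1.trans l2) CG0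
  have Qs : Sm (cv (lap G) P) := cv_sm κs.cont.locallyIntegrable Ps Pc
  have sw : ∫ y, lap G y * cr P f y = ∫ x, f x * cv (lap G) P x := by
    obtain ⟨CP, CP0, hCP⟩ := cs_bdd Ps.cont Pc
    have := fb (cs_int κs.cont κc) (cs_int fs.cont fc) (D := fun x y => P (x - y)) (by have := Ps.cont; fun_prop) (fun x z => hCP _)
    calc _ = ∫ y, ∫ x, lap G y * (f x * P (x - y)) := by
          congr 1; ext y; unfold cr; rw [← icm]; congr 1; ext x; ring
      _ = _ := this.symm
      _ = _ := by
          congr 1; ext x; unfold cv; rw [← icm]; congr 1; ext y; ring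
  have Qd : ∀ x ∈ {x : R3 | ρ + 3 ≤ ‖x‖ ∧ ‖x‖ ≤ ρ + 5}, ∀ i, |pd (cv (lap G) P) i x| ≤ 3 * K * (u1 + F1) := by
    intro x hx i
    have e : pd (cv (lap G) P) i x = (∑ j, cv (pd (pd (lap G) j) j) (U i) x) - ∑ j, cv (pd (lap G) j) (F i j) x := by
      rw [pd_cv κs.cont.locallyIntegrable Ps Pc]
      simp_rw [← cv_pdl (κs.pd _) (Us i) (Uc i), ← cv_pdl κs ((Us i).pd _) ((Uc i).pd _), ← cv_pdl κs (Fs i _) (Fc i _)]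
      unfold cv
      have j1 : ∀ j, Integrable fun y => lap G y * pd (pd (U i) j) j (x - y) := fun j =>
        cs_int (by have := κs.cont; have := (((Us i).pd j).pd j).cont; fun_prop) κc.mull
      have j2 : ∀ j, Integrable fun y => lap G y * pd (F i j) j (x - y) := fun j =>
        cs_int (by have := κs.cont; have := ((Fs i j).pd j).cont; fun_prop) κc.mull
      rw [← integral_finsetSum _ (fun j _ => j1 j), ← integral_finsetSum _ (fun j _ => j2 j), ← integral_sub (integrable_finsetSum _ fun j _ => j1 j) (integrable_finsetSum _ fun j _ => j2 j)]
      congr 1; ext y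
      rw [← Finset.mul_sum, ← Finset.mul_sum, ← mul_sub]
      by_cases hy : 1/2 ≤ ‖y‖
      · rw [Gl y hy]; ring
      · have a1 := norm_sub_norm_le x y
        have a2 := norm_sub_le x y
        rw [h1 (x - y) (by linarith [hx.1]) (by linarith [hx.2]) i]
        rfl
    rw [e]
    have s1 : |∑ j, cv (pd (pd (lap G) j) j) (U i) x| ≤ 3 * (K * u1) := by
      refine (Finset.abs_sum_le_sum_abs _ _).trans ?_
      refine (Finset.sum_le_card_nsmul _ _ (K * u1) fun j _ => ?_).trans (by simp)
      exact (cv_le (hK2 j) (cs_int (Us i).cont (Uc i)) x).trans (mll (hU i) K0)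
    have s2 : |∑ j, cv (pd (lap G) j) (F i j) x| ≤ 3 * (K * F1) := by
      refine (Finset.abs_sum_le_sum_abs _ _).trans ?_
      refine (Finset.sum_le_card_nsmul _ _ (K * F1) fun j _ => ?_).trans (by simp)
      exact (cv_le (hK1 j) (cs_int (Fs i j).cont (Fc i j)) x).trans (mll (hF i j) K0)
    refine (abs_sub _ _).trans ?_
    linarith
  have Qd' : ∀ x ∈ {x : R3 | ρ + 3 ≤ ‖x‖ ∧ ‖x‖ ≤ ρ + 5}, ∀ v, |fderiv ℝ (cv (lap G) P) x v| ≤ (9 * K * (u1 + F1)) * ‖v‖ := by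
    intro x hx v
    rw [fderiv_eq_sum]
    refine (Finset.abs_sum_le_sum_abs _ _).trans ?_
    refine (Finset.sum_le_card_nsmul _ _ (‖v‖ * (3 * K * (u1 + F1))) fun j _ => ?_).trans (by simp; linarith)
    rw [abs_mul]
    exact mul_le_mul (abs_co v j) (Qd x hx j) (abs_nonneg _) (norm_nonneg _)
  have B3 : |∫ y, lap G y * cr P f y| ≤ 180 * K * ρ * (u1 + F1) * f1 := by
    let x0 : R3 := (ρ + 3) • EuclideanSpace.single 0 1
    have hx0 : ‖x0‖ = ρ + 3 := by
      simp [x0, norm_smul]; linarith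
    have e : ∫ x, f x * cv (lap G) P x = ∫ x, f x * (cv (lap G) P x - cv (lap G) P x0) := by
      simp_rw [mul_sub]
      have q1 : Integrable fun x => f x * cv (lap G) P x := cs_int (fs.cont.mul Qs.cont) fc.mull
      rw [integral_sub q1 ((cs_int fs.cont fc).mul_const _), integral_mul_const, f0]; ring
    rw [sw, e, ← Real.norm_eq_abs]
    refine (norm_integral_le_of_norm_le ((cs_int fs.cont fc).abs.mul_const (180 * K * ρ * (u1 + F1))) (evf fun x => ?_)).trans ?_
    · rw [Real.norm_eq_abs, abs_mul]
      by_cases hx : f x = 0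
      · simp [hx]
      · refine mll ?_ (abs_nonneg _)
        have := osc Qs (a := ρ + 3) (b := ρ + 5) (by linarith) (by linarith) (by positivity) Qd' x x0 (fS x hx) ⟨hx0.ge, by linarith⟩
        refine this.trans ?_
        have : 0 ≤ K * (u1 + F1) := by positivity
        nlinarith
    · rw [integral_mul_const, mul_comm]
      exact mll hf (by positivity)
  rw [e0, main, abs_mul, abs_of_nonneg gk0, mul_assoc]
  refine mll ?_ gk0
  have D1 : |∑ i, ∑ j, ∫ y, ‖y‖⁻¹ * pd (pd (cr (F i j) f) i) j y| ≤ 9 * (1344 / (kap * Real.sqrt (Real.pi / (1/8))) * (a * b)) := by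
    refine (Finset.abs_sum_le_sum_abs _ _).trans ((Finset.sum_le_card_nsmul _ _ _ fun i _ => (Finset.abs_sum_le_sum_abs _ _).trans (Finset.sum_le_card_nsmul _ _ _ fun j _ => B1 i j)).trans ?_)
    simp; linarith
  have D2 : |∑ i, ∑ j, ∫ y, G y * pd (pd (cr (F i j) f) i) j y| ≤ 9 * (CG * (F1 * f1)) := by
    refine (Finset.abs_sum_le_sum_abs _ _).trans ((Finset.sum_le_card_nsmul _ _ _ fun i _ => (Finset.abs_sum_le_sum_abs _ _).trans (Finset.sum_le_card_nsmul _ _ _ fun j _ => B2 i j)).trans ?_)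
    simp; linarith
  refine (abs_sub _ _).trans ((add_le_add (abs_sub _ _) le_rfl).trans ((add_le_add (add_le_add D1 D2) B3).trans ?_))
  have w1 : 0 ≤ 1344 / (kap * Real.sqrt (Real.pi / (1/8))) := by positivity
  have w2 : F1 * f1 ≤ ρ * (u1 + F1) * f1 := by
    refine mlr ?_ f10
    nlinarith
  have w3 := mll w2 CG0
  have w4 : 0 ≤ a * b := by positivity
  have w5 : 0 ≤ ρ * (u1 + F1) * f1 := by positivity
  have w6 : 0 ≤ K * (a * b) := by positivity
  have w7 : 0 ≤ CG * (a * b) := by positivity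
  have w8 := mul_nonneg w1 w5
  nlinarith
lemma cutoff : ∃ C : ℝ, 0 ≤ C ∧ ∀ r : ℝ, 0 ≤ r → ∃ ψ : R3 → ℝ, Sm ψ ∧ CS ψ ∧ (∀ x, 0 ≤ ψ x) ∧ (∀ x, ψ x ≤ 1) ∧
    (∀ x : R3, ‖x‖ ≤ r → ψ x = 1) ∧ (∀ x : R3, r + 2 ≤ ‖x‖ → ψ x = 0) ∧ (∀ j x, |pd ψ j x| ≤ C) ∧ (∀ x, |lap ψ x| ≤ C) := by
  let b : ContDiffBump (0 : R3) := ⟨1/2, 1, by norm_num, by norm_num⟩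
  let η : R3 → ℝ := b.normed volume
  have es : Sm η := b.contDiff_normed
  have ec : CS η := b.hasCompactSupport_normed
  have e0 : ∀ x, 0 ≤ η x := b.nonneg_normed
  have ei : ∫ x, η x = 1 := b.integral_normed
  have eS : ∀ x : R3, η x ≠ 0 → ‖x‖ < 1 := by
    intro x hx
    have : x ∈ Function.support η := hx
    rw [show Function.support η = ball 0 1 from b.support_normed_eq] at this
    simpa using this
  refine ⟨(∑ j, ∫ y, |pd η j y|) + ∑ j, ∫ y, |pd (pd η j) j y|, ?_, ?_⟩
  · exact add_nonneg (Finset.sum_nonneg fun j _ => integral_nonneg fun y => abs_nonneg _) (Finset.sum_nonneg fun j _ => integral_nonneg fun y => abs_nonneg _)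
  intro r hr
  let B : R3 → ℝ := (ball (0:R3) (r+1)).indicator (fun _ => 1)
  have Bi : Integrable B := (integrable_indicator_iff measurableSet_ball).2 (integrableOn_const (by exact measure_ball_lt_top.ne))
  have Bl : LocallyIntegrable B := Bi.locallyIntegrable
  have B0 : ∀ y, 0 ≤ B y := fun y => Set.indicator_nonneg (fun _ _ => zero_le_one) y
  have B1 : ∀ y, B y ≤ 1 := fun y => Set.indicator_le_self' (fun _ _ => zero_le_one) y
  have Ba : ∀ y, |B y| ≤ 1 := fun y => by rw [abs_of_nonneg (B0 y)]; exact B1 y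
  have p1 : ∀ j, pd (cv B η) j = cv B (pd η j) := fun j => pd_cv Bl es ec j
  have p2 : ∀ j, pd (pd (cv B η) j) j = cv B (pd (pd η j) j) := fun j => by rw [p1, pd_cv Bl (es.pd j) (ec.pd j)]
  have one : ∀ x : R3, ‖x‖ ≤ r → cv B η x = 1 := by
    intro x hx
    rw [cv_swap, ← ei]
    congr 1; ext y
    by_cases hy : η y = 0
    · simp [hy]
    · have h1 := eS y hy
      have h2 := norm_sub_le x y
      have : B (x - y) = 1 := Set.indicator_of_mem (by simp; linarith) _
      rw [this, one_mul]
  have zero : ∀ x : R3, r + 2 ≤ ‖x‖ → cv B η x = 0 := by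
    intro x hx
    rw [cv_swap]
    have : ∀ y, B (x - y) * η y = 0 := by
      intro y
      by_cases hy : η y = 0
      · simp [hy]
      · have h1 := eS y hy
        have h2 := norm_sub_norm_le x y
        have : B (x - y) = 0 := Set.indicator_of_notMem (by simp; linarith) _
        rw [this, zero_mul]
    simp [this]
  refine ⟨cv B η, cv_sm Bl es ec, ?_, fun x => ?_, fun x => ?_, one, zero, fun j x => ?_, fun x => ?_⟩
  · refine HasCompactSupport.of_support_subset_isCompact (isCompact_closedBall (0:R3) (r+2)) fun y hy => ?_
    by_contra h
    simp only [mem_closedBall, dist_zero_right, not_le] at h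
    exact hy (zero y h.le)
  · exact integral_nonneg fun y => mul_nonneg (B0 y) (e0 _)
  · refine (le_abs_self _).trans ((cv_le Ba (cs_int es.cont ec) x).trans ?_)
    simp_rw [abs_of_nonneg (e0 _)]
    rw [ei, one_mul]
  · rw [p1]
    refine (cv_le Ba (cs_int (es.pd j).cont (ec.pd j)) x).trans ?_
    rw [one_mul]
    have h1 := Finset.single_le_sum (f := fun j => ∫ y, |pd η j y|) (fun j _ => integral_nonneg fun y => abs_nonneg _) (Finset.mem_univ j)
    have h2 : 0 ≤ ∑ j, ∫ y, |pd (pd η j) j y| := Finset.sum_nonneg fun j _ => integral_nonneg fun y => abs_nonneg _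
    linarith
  · unfold lap
    simp_rw [p2]
    refine (Finset.abs_sum_le_sum_abs _ _).trans ?_
    have h1 : ∑ j, |cv B (pd (pd η j) j) x| ≤ ∑ j, ∫ y, |pd (pd η j) j y| := Finset.sum_le_sum fun j _ => by
      simpa using cv_le Ba (cs_int ((es.pd j).pd j).cont ((ec.pd j).pd j)) x
    have h2 : 0 ≤ ∑ j, ∫ y, |pd η j y| := Finset.sum_nonneg fun j _ => integral_nonneg fun y => abs_nonneg _
    linarith
def BM (A : Set R3) : Prop := MeasurableSet A ∧ ∃ r : ℝ, A ⊆ closedBall 0 r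
lemma BM.int {A : Set R3} (h : BM A) {g : R3 → ℝ} (hg : Continuous g) : IntegrableOn g A := by
  obtain ⟨r, hr⟩ := h.2
  exact (hg.continuousOn.integrableOn_compact (isCompact_closedBall 0 r)).mono_set hr
lemma BM.fin {A : Set R3} (h : BM A) : volume A ≠ ⊤ := by
  obtain ⟨r, hr⟩ := h.2
  exact ((measure_mono hr).trans_lt measure_closedBall_lt_top).ne
lemma hg {A : Set R3} (hA : BM A) {f g : R3 → ℝ} (hf : Continuous f) (hg : Continuous g) (f0 : ∀ x, 0 ≤ f x) (g0 : ∀ x, 0 ≤ g x)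
    {a b : ℝ} (ha : 0 < a) (hb : 0 < b) (hab : a + b = 1) :
    ∫ x in A, f x ^ a * g x ^ b ≤ (∫ x in A, f x) ^ a * (∫ x in A, g x) ^ b := by
  have : IsFiniteMeasure (volume.restrict A) := ⟨by simpa using hA.fin.lt_top⟩
  have ml : ∀ (h : R3 → ℝ), Continuous h → ∀ q, MemLp h q (volume.restrict A) := by
    intro h hh q
    obtain ⟨r, hr⟩ := hA.2
    obtain ⟨C, hC⟩ := (isCompact_closedBall (0:R3) r).exists_bound_of_continuousOn hh.continuousOn
    refine MemLp.of_bound hh.aestronglyMeasurable C ?_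
    filter_upwards [ae_restrict_mem hA.1] with x hx using hC x (hr hx)
  have hpq : (1/a).HolderConjugate (1/b) := by
    rw [Real.holderConjugate_iff]
    refine ⟨?_, by simp [hab]⟩
    rw [lt_div_iff₀ ha]; linarith
  have := integral_mul_le_Lp_mul_Lq_of_nonneg (μ := volume.restrict A) hpq (f := fun x => f x ^ a) (g := fun x => g x ^ b)
    (evf fun x => rnn (f0 x) _) (evf fun x => rnn (g0 x) _)
    (ml _ (hf.rpow_const fun x => Or.inr ha.le) _) (ml _ (hg.rpow_const fun x => Or.inr hb.le) _)
  have e1 : ∀ x, (f x ^ a) ^ (1/a) = f x := fun x => by rw [← rmu (f0 x), mul_one_div_cancel ha.ne', Real.rpow_one]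
  have e2 : ∀ x, (g x ^ b) ^ (1/b) = g x := fun x => by rw [← rmu (g0 x), mul_one_div_cancel hb.ne', Real.rpow_one]
  simp only [e1, e2, one_div_one_div] at this
  exact this
lemma int_nn {A : Set R3} (g : R3 → ℝ) (s : ℝ) : 0 ≤ ∫ x in A, |g x| ^ s := integral_nonneg fun x => rnn (abs_nonneg _) _
lemma lpS_nn (g : R3 → ℝ) (s : ℝ) (A : Set R3) : 0 ≤ lpS g s A := rnn (int_nn _ _) _
lemma lpS_pow (g : R3 → ℝ) {s : ℝ} (hs : 0 < s) (A : Set R3) : lpS g s A ^ s = ∫ x in A, |g x| ^ s := by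
  unfold lpS
  rw [← rmu (int_nn _ _), one_div_mul_cancel hs.ne', Real.rpow_one]
lemma lpS_pow' (g : R3 → ℝ) {s : ℝ} (hs : 0 < s) (A : Set R3) (a : ℝ) : (∫ x in A, |g x| ^ s) ^ a = lpS g s A ^ (s * a) := by
  rw [← lpS_pow g hs, ← rmu (lpS_nn _ _ _)]
lemma lpS_le_of {g : R3 → ℝ} {s M : ℝ} {A : Set R3} (hs : 0 < s) (hM : 0 ≤ M) (h : ∫ x in A, |g x| ^ s ≤ M ^ s) : lpS g s A ≤ M := by
  rw [← lpS_pow g hs] at h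
  exact (Real.rpow_le_rpow_iff (lpS_nn _ _ _) hM hs).1 h
lemma lpS_mono {g h : R3 → ℝ} {s : ℝ} {A B : Set R3} (hs : 0 < s) (hB : BM B) (hA : MeasurableSet A) (hAB : A ⊆ B) (hg : Continuous g) (hh : Continuous h)
    (hgh : ∀ x ∈ A, |g x| ≤ |h x|) : lpS g s A ≤ lpS h s B := by
  refine lpS_le_of hs (lpS_nn _ _ _) ?_
  rw [lpS_pow h hs]
  have hA' : BM A := ⟨hA, hB.2.choose, hAB.trans hB.2.choose_spec⟩
  calc _ ≤ ∫ x in A, |h x| ^ s := setIntegral_mono_on (hA'.int (rpow_ct hg hs)) (hA'.int (rpow_ct hh hs)) hA fun x hx => rle' (abs_nonneg _) (hgh x hx) hs.le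
    _ ≤ _ := setIntegral_mono_set (hB.int (rpow_ct hh hs)) (evf fun x => rnn (abs_nonneg _) _) (hAB.eventuallyLE)
lemma lpS_sq (g : R3 → ℝ) {s : ℝ} (hs : 0 < s) (A : Set R3) : lpS (fun x => g x ^ 2) s A = lpS g (2 * s) A ^ 2 := by
  unfold lpS
  have : ∀ x, |g x ^ 2| ^ s = |g x| ^ (2 * s) := fun x => by
    rw [abs_pow, rmu (abs_nonneg _)]; norm_num
  simp_rw [this]
  rw [← rnc, ← rmu (int_nn _ _)]
  congr 1
  push_cast; field_simp
lemma hol {A : Set R3} (hA : BM A) {g h : R3 → ℝ} (cg : Continuous g) (ch : Continuous h) {s t : ℝ} (hs : 0 < s) (ht : 0 < t) (hst : 1 / s + 1 / t = 1) :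
    ∫ x in A, |g x| * |h x| ≤ lpS g s A * lpS h t A := by
  have := hg hA (rpow_ct cg hs) (rpow_ct ch ht) (fun x => rnn (abs_nonneg _) _) (fun x => rnn (abs_nonneg _) _) (one_div_pos.2 hs) (one_div_pos.2 ht) hst
  have e : ∀ (y : ℝ) (s : ℝ), 0 < s → (|y| ^ s) ^ (1/s) = |y| := fun y s hs => by
    rw [← rmu (abs_nonneg _), mul_one_div_cancel hs.ne', Real.rpow_one]
  simp only [e _ _ hs, e _ _ ht] at this
  exact this
lemma interp {A : Set R3} (hA : BM A) {g : R3 → ℝ} (cg : Continuous g) {q s t x y : ℝ} (hq : 0 < q) (hs : 0 < s) (ht : 0 < t) (hx : 0 < x) (hy : 0 < y)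
    (hxy : x + y = 1) (he : q * x + t * y = s) : lpS g s A ≤ lpS g q A ^ (q * x / s) * lpS g t A ^ (t * y / s) := by
  have := hg hA (rpow_ct cg hq) (rpow_ct cg ht) (fun x => rnn (abs_nonneg _) _) (fun x => rnn (abs_nonneg _) _) hx hy hxy
  refine lpS_le_of hs (mul_nonneg (rnn (lpS_nn _ _ _) _) (rnn (lpS_nn _ _ _) _)) ?_
  rw [Real.mul_rpow (rnn (lpS_nn _ _ _) _) (rnn (lpS_nn _ _ _) _), ← rmu (lpS_nn _ _ _), ← rmu (lpS_nn _ _ _),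
    div_mul_cancel₀ _ hs.ne', div_mul_cancel₀ _ hs.ne', ← lpS_pow' g hq, ← lpS_pow' g ht]
  refine le_trans (le_of_eq ?_) this
  congr 1; ext z
  rw [← rmu (abs_nonneg _), ← rmu (abs_nonneg _), ← Real.rpow_add_of_nonneg (abs_nonneg _) (by positivity) (by positivity), he]
lemma lpS_w {A : Set R3} (hA : BM A) {g : R3 → ℝ} (cg : Continuous g) {s t w : ℝ} (hs : 1 ≤ s) (hst : s ≤ t) (hw : 1 ≤ w) (hv : volume.real A ≤ w) :
    lpS g s A ≤ w * lpS g t A := by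
  have s0 : 0 < s := by linarith
  have t0 : 0 < t := by linarith
  have w0 : 0 < w := by linarith
  rcases hst.eq_or_lt with rfl | hlt
  · nlinarith [lpS_nn g s A]
  refine lpS_le_of s0 (mul_nonneg w0.le (lpS_nn _ _ _)) ?_
  have h1 : s / t < 1 := (div_lt_one t0).2 hlt
  have := hg hA (rpow_ct cg t0) (continuous_const (y := (1:ℝ))) (fun x => rnn (abs_nonneg _) _) (fun x => zero_le_one) (a := s/t) (b := 1 - s/t) (by positivity) (by linarith) (by ring)
  have e : ∀ x, (|g x| ^ t) ^ (s/t) * (1:ℝ) ^ (1 - s/t) = |g x| ^ s := fun x => by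
    rw [← rmu (abs_nonneg _), mul_div_cancel₀ _ t0.ne', Real.one_rpow, mul_one]
  simp_rw [e, lpS_pow' g t0, mul_div_cancel₀ _ t0.ne'] at this
  refine this.trans ?_
  rw [Real.mul_rpow w0.le (lpS_nn _ _ _), mul_comm]
  refine mlr ?_ (rnn (lpS_nn _ _ _) _)
  simp only [integral_const, smul_eq_mul, mul_one, measureReal_restrict_apply_univ]
  calc _ ≤ w ^ (1 - s/t) := rle' measureReal_nonneg hv (by linarith)
    _ ≤ w ^ s := rlx hw (by linarith [div_pos s0 t0])
def gr (g : R3 → ℝ) (x : R3) : ℝ := ∑ j, pd g j x ^ 2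
lemma gr_nn (g : R3 → ℝ) (x : R3) : 0 ≤ gr g x := Finset.sum_nonneg fun j _ => sq_nonneg _
lemma gr_sm {g : R3 → ℝ} (h : Sm g) : Sm (gr g) := by
  unfold gr
  exact ContDiff.sum fun j _ => (h.pd j).pow 2
lemma gr_cs {g : R3 → ℝ} (h : CS g) : CS (gr g) := by
  refine HasCompactSupport.of_support_subset_isCompact (K := tsupport g) h ?_
  intro x hx
  by_contra h
  exact hx (by simp [gr, pd_zero_off _ h])
lemma fd_le (g : R3 → ℝ) (x : R3) : ‖fderiv ℝ g x‖ ^ 2 ≤ 3 * gr g x := by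
  have : ‖fderiv ℝ g x‖ ≤ ∑ j, |pd g j x| := by
    refine ContinuousLinearMap.opNorm_le_bound _ (Finset.sum_nonneg fun j _ => abs_nonneg _) fun v => ?_
    rw [fderiv_eq_sum, Finset.sum_mul]
    refine (norm_sum_le _ _).trans (Finset.sum_le_sum fun j _ => ?_)
    rw [norm_mul, mul_comm]
    exact mll (abs_co v j) (norm_nonneg _)
  refine (pow_le_pow_left₀ (norm_nonneg _) this 2).trans ?_
  unfold gr
  simp only [Fin.sum_univ_three]
  rw [← sq_abs (pd g 0 x), ← sq_abs (pd g 1 x), ← sq_abs (pd g 2 x)]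
  nlinarith [sq_nonneg (|pd g 0 x| - |pd g 1 x|), sq_nonneg (|pd g 0 x| - |pd g 2 x|), sq_nonneg (|pd g 1 x| - |pd g 2 x|)]
lemma sob : ∃ C : ℝ, 0 ≤ C ∧ ∀ g : R3 → ℝ, Sm g → CS g → ∫ x, |g x| ^ (6:ℝ) ≤ (C * ∫ x, gr g x) ^ (3:ℝ) := by
  let K : NNReal := eLpNormLESNormFDerivOfEqInnerConst (volume : Measure R3) ((2:NNReal):ℝ)
  refine ⟨K ^ 2 * 3, by positivity, fun g sg cg => ?_⟩
  have h := eLpNorm_le_eLpNorm_fderiv_of_eq_inner (μ := (volume : Measure R3)) (u := g) (sg.of_le (by simp)) cg (p := 2) (p' := 6)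
    (by norm_num) (by simp) (by simp; norm_num)
  have hK : ((eLpNormLESNormFDerivOfEqInnerConst (volume : Measure R3) ((2:NNReal):ℝ) : NNReal) : ENNReal) = ENNReal.ofReal (K:ℝ) := (ENNReal.ofReal_coe_nnreal).symm
  have cf : Continuous (fderiv ℝ g) := sg.continuous_fderiv (by simp)
  have m1 : MemLp g ((6:NNReal):ENNReal) volume := sg.cont.memLp_of_hasCompactSupport cg
  have m2 : MemLp (fderiv ℝ g) ((2:NNReal):ENNReal) volume := cf.memLp_of_hasCompactSupport (cg.fderiv (𝕜 := ℝ))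
  rw [m1.eLpNorm_eq_integral_rpow_norm (by simp) (by simp), m2.eLpNorm_eq_integral_rpow_norm (by simp) (by simp),
    hK, ← ENNReal.ofReal_mul (by positivity)] at h
  simp only [ENNReal.coe_toReal] at h
  have i1 : 0 ≤ ∫ x, |g x| ^ (6:ℝ) := integral_nonneg fun x => by positivity
  have i2 : 0 ≤ ∫ x, ‖fderiv ℝ g x‖ ^ (2:ℝ) := integral_nonneg fun x => by positivity
  rw [ENNReal.ofReal_le_ofReal_iff (by positivity)] at h
  simp only [Real.norm_eq_abs, NNReal.coe_ofNat] at h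
  have i3 : ∫ x, ‖fderiv ℝ g x‖ ^ (2:ℝ) ≤ 3 * ∫ x, gr g x := by
    rw [← icm]
    refine integral_mono_of_nonneg (evf fun x => by positivity) ((cs_int (gr_sm sg).cont (gr_cs cg)).const_mul 3) (evf fun x => ?_)
    simpa using fd_le g x
  have h' := rle' (by positivity) h (show (0:ℝ) ≤ 6 by norm_num)
  rw [← rmu i1, inv_mul_cancel₀ (by norm_num), Real.rpow_one, Real.mul_rpow (by positivity) (by positivity), ← rmu i2] at h'
  refine h'.trans ?_
  have e : (K:ℝ) ^ (6:ℝ) = ((K:ℝ) ^ 2) ^ (3:ℝ) := by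
    rw [← rnc, ← rmu (by positivity)]; norm_num
  rw [show (2:ℝ)⁻¹ * 6 = 3 by norm_num, e, ← Real.mul_rpow (by positivity) i2]
  refine rle' (by positivity) ?_ (by norm_num)
  calc _ ≤ (K:ℝ) ^ 2 * (3 * ∫ x, gr g x) := by gcongr
    _ = _ := by ring
structure Sys (κ : ℝ) (U V : Fin 3 → R3 → ℝ) (P T : R3 → ℝ) : Prop where
  su : ∀ i, Sm (U i)
  sv : ∀ i, Sm (V i)
  sp : Sm P
  st : Sm T
  e1 : ∀ i x, lap (U i) x = κ * ((∑ j, U j x * pd (U i) j x) + pd P i x + ∑ j, pd (fun y => V j y * V i y) j x)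
  e2 : ∀ i x, lap (V i) x = κ * ((∑ j, U j x * pd (V i) j x) + pd T i x + ∑ j, V j x * pd (U i) j x)
  e3 : ∀ x, lap T x = κ * ((∑ j, U j x * pd T j x) + ∑ j, pd (V j) j x)
  e4 : ∀ x, ∑ j, pd (U j) j x = 0
section
variable {κ : ℝ} {U V : Fin 3 → R3 → ℝ} {P T : R3 → ℝ}
def En (U V : Fin 3 → R3 → ℝ) (T : R3 → ℝ) (x : R3) : ℝ := (∑ i, U i x ^ 2) + (∑ i, V i x ^ 2) + T x ^ 2
def Nn (U V : Fin 3 → R3 → ℝ) (T : R3 → ℝ) (x : R3) : ℝ := (∑ i, gr (U i) x) + (∑ i, gr (V i) x) + gr T x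
def Dt (U V : Fin 3 → R3 → ℝ) (x : R3) : ℝ := ∑ i, U i x * V i x
def Wf (U V : Fin 3 → R3 → ℝ) (P T : R3 → ℝ) (j : Fin 3) (x : R3) : ℝ := (1/2 * En U V T x + P x) * U j x + (Dt U V x + T x) * V j x
lemma en_sm (h : Sys κ U V P T) : Sm (En U V T) :=
  ((ContDiff.sum fun i _ => (h.su i).pow 2).add (ContDiff.sum fun i _ => (h.sv i).pow 2)).add (h.st.pow 2)
lemma nn_sm (h : Sys κ U V P T) : Sm (Nn U V T) :=
  ((ContDiff.sum fun i _ => gr_sm (h.su i)).add (ContDiff.sum fun i _ => gr_sm (h.sv i))).add (gr_sm h.st)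
lemma dt_sm (h : Sys κ U V P T) : Sm (Dt U V) := ContDiff.sum fun i _ => (h.su i).mul (h.sv i)
lemma wf_sm (h : Sys κ U V P T) (j) : Sm (Wf U V P T j) :=
  (((contDiff_const.mul (en_sm h)).add h.sp).mul (h.su j)).add (((dt_sm h).add h.st).mul (h.sv j))
lemma pd_en (h : Sys κ U V P T) (j x) : pd (En U V T) j x = (∑ i, 2 * U i x * pd (U i) j x) + (∑ i, 2 * V i x * pd (V i) j x) + 2 * T x * pd T j x := by
  unfold En
  have s1 : ∀ i, Sm (fun y => U i y ^ 2) := fun i => (h.su i).pow 2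
  have s2 : ∀ i, Sm (fun y => V i y ^ 2) := fun i => (h.sv i).pow 2
  have s3 : Sm (fun y => ∑ i, U i y ^ 2) := ContDiff.sum fun i _ => s1 i
  have s4 : Sm (fun y => ∑ i, V i y ^ 2) := ContDiff.sum fun i _ => s2 i
  rw [pd_add (s3.add s4) (h.st.pow 2), pd_add s3 s4, pd_sum s1, pd_sum s2, pd_sq h.st]
  simp_rw [pd_sq (h.su _), pd_sq (h.sv _)]
lemma pd_wf (h : Sys κ U V P T) (j x) : pd (Wf U V P T j) j x =
    (1/2 * pd (En U V T) j x + pd P j x) * U j x + (1/2 * En U V T x + P x) * pd (U j) j x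
     + ((∑ i, (pd (U i) j x * V i x + U i x * pd (V i) j x)) + pd T j x) * V j x + (Dt U V x + T x) * pd (V j) j x := by
  unfold Wf
  have s1 : Sm (fun y => 1/2 * En U V T y) := contDiff_const.mul (en_sm h)
  have s2 : Sm (fun y => 1/2 * En U V T y + P y) := s1.add h.sp
  have s3 : Sm (fun y => Dt U V y + T y) := (dt_sm h).add h.st
  have e : pd (Dt U V) j x = ∑ i, (pd (U i) j x * V i x + U i x * pd (V i) j x) := by
    unfold Dt
    rw [pd_sum (fun i => (h.su i).mul (h.sv i))]
    simp_rw [pd_mul (h.su _) (h.sv _)]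
  rw [pd_add (s2.mul (h.su j)) (s3.mul (h.sv j)), pd_mul s2 (h.su j), pd_mul s3 (h.sv j), pd_add s1 h.sp, pd_cmul (en_sm h), pd_add (dt_sm h) h.st, e]
  ring
lemma div_wf (h : Sys κ U V P T) (x) : (∑ i, U i x * lap (U i) x) + (∑ i, V i x * lap (V i) x) + T x * lap T x = κ * ∑ j, pd (Wf U V P T j) j x := by
  have e4 := h.e4 x
  simp_rw [pd_wf h, pd_en h, h.e1, h.e2, h.e3, pd_mul (h.sv _) (h.sv _)]
  unfold Dt
  simp only [Fin.sum_univ_three] at e4 ⊢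
  linear_combination (-κ * (1/2 * En U V T x + P x)) * e4
lemma lap_id {φ g : R3 → ℝ} (sφ : Sm φ) (sg : Sm g) (x) : (∑ j, pd (fun y => φ y * (g y * pd g j y) - 1/2 * (g y ^ 2 * pd φ j y)) j x)
    = φ x * (g x * lap g x) + φ x * gr g x - 1/2 * (g x ^ 2 * lap φ x) := by
  have : ∀ j, pd (fun y => φ y * (g y * pd g j y) - 1/2 * (g y ^ 2 * pd φ j y)) j x = φ x * (g x * pd (pd g j) j x) + φ x * pd g j x ^ 2 - 1/2 * (g x ^ 2 * pd (pd φ j) j x) := by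
    intro j
    have s1 : Sm (fun y => g y * pd g j y) := sg.mul (sg.pd j)
    have s0 : Sm (fun y => g y ^ 2) := sg.pow 2
    have s2 : Sm (fun y => g y ^ 2 * pd φ j y) := s0.mul (sφ.pd j)
    rw [pd_sub (sφ.mul s1) (contDiff_const.mul s2), pd_mul sφ s1, pd_mul sg (sg.pd j), pd_cmul s2, pd_mul s0 (sφ.pd j), pd_sq sg]
    ring
  simp_rw [this]
  unfold lap gr
  simp only [Fin.sum_univ_three]
  ring
lemma int_lap {φ g : R3 → ℝ} (sφ : Sm φ) (cφ : CS φ) (sg : Sm g) : ∫ x, (φ x * (g x * lap g x) + φ x * gr g x - 1/2 * (g x ^ 2 * lap φ x)) = 0 := by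
  have e := lap_id sφ sg
  simp_rw [← e]
  have s : ∀ j, Sm (fun y => φ y * (g y * pd g j y) - 1/2 * (g y ^ 2 * pd φ j y)) := fun j =>
    (sφ.mul (sg.mul (sg.pd j))).sub (contDiff_const.mul ((sg.pow 2).mul (sφ.pd j)))
  have c : ∀ j, CS (fun y => φ y * (g y * pd g j y) - 1/2 * (g y ^ 2 * pd φ j y)) := fun j =>
    HasCompactSupport.sub cφ.mull (CS.mulr (CS.mulr (cφ.pd j)))
  rw [integral_finsetSum _ fun j _ => cs_int ((s j).pd j).cont ((c j).pd j)]
  exact Finset.sum_eq_zero fun j _ => int_pd (s j) (c j) j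
lemma energy {φ : R3 → ℝ} (h : Sys κ U V P T) (sφ : Sm φ) (cφ : CS φ) :
    ∫ x, φ x * Nn U V T x = ∫ x, (1/2 * (En U V T x * lap φ x) + κ * ∑ j, Wf U V P T j x * pd φ j x) := by
  have i1 : ∀ g, Sm g → Integrable (fun x => φ x * (g x * lap g x) + φ x * gr g x - 1/2 * (g x ^ 2 * lap φ x)) := fun g sg =>
    ((cs_int (sφ.mul (sg.mul (lap_sm sg))).continuous cφ.mull).add (cs_int (sφ.mul (gr_sm sg)).continuous cφ.mull)).sub
      (cs_int (contDiff_const.mul ((sg.pow 2).mul (lap_sm sφ))).continuous (CS.mulr (CS.mulr (lap_cs cφ))))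
  have sw : ∀ j, Sm (fun x => φ x * Wf U V P T j x) := fun j => sφ.mul (wf_sm h j)
  have cw : ∀ j, CS (fun x => φ x * Wf U V P T j x) := fun j => cφ.mull
  have i2 : ∀ j, Integrable (pd (fun x => φ x * Wf U V P T j x) j) := fun j => cs_int ((sw j).pd j).cont ((cw j).pd j)
  have key : ∀ x, φ x * Nn U V T x - (1/2 * (En U V T x * lap φ x) + κ * ∑ j, Wf U V P T j x * pd φ j x) =
      ((∑ i, (φ x * (U i x * lap (U i) x) + φ x * gr (U i) x - 1/2 * (U i x ^ 2 * lap φ x))) +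
      (∑ i, (φ x * (V i x * lap (V i) x) + φ x * gr (V i) x - 1/2 * (V i x ^ 2 * lap φ x))) +
      (φ x * (T x * lap T x) + φ x * gr T x - 1/2 * (T x ^ 2 * lap φ x))) - κ * ∑ j, pd (fun x => φ x * Wf U V P T j x) j x := by
    intro x
    have := div_wf h x
    simp_rw [pd_mul sφ (wf_sm h _)]
    unfold Nn En
    simp only [Fin.sum_univ_three] at this ⊢
    linear_combination (-φ x) * this
  have z : ∫ x, (φ x * Nn U V T x - (1/2 * (En U V T x * lap φ x) + κ * ∑ j, Wf U V P T j x * pd φ j x)) = 0 := by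
    simp_rw [key]
    have j1 : Integrable fun x => ∑ i, (φ x * (U i x * lap (U i) x) + φ x * gr (U i) x - 1/2 * (U i x ^ 2 * lap φ x)) := integrable_finsetSum _ fun i _ => i1 _ (h.su i)
    have j2 : Integrable fun x => ∑ i, (φ x * (V i x * lap (V i) x) + φ x * gr (V i) x - 1/2 * (V i x ^ 2 * lap φ x)) := integrable_finsetSum _ fun i _ => i1 _ (h.sv i)
    have j3 : Integrable fun x => κ * ∑ j, pd (fun x => φ x * Wf U V P T j x) j x := (integrable_finsetSum _ fun j _ => i2 j).const_mul κ
    have j4 : Integrable fun x => (∑ i, (φ x * (U i x * lap (U i) x) + φ x * gr (U i) x - 1/2 * (U i x ^ 2 * lap φ x))) +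
      (∑ i, (φ x * (V i x * lap (V i) x) + φ x * gr (V i) x - 1/2 * (V i x ^ 2 * lap φ x))) := j1.add j2
    have j5 : Integrable fun x => (∑ i, (φ x * (U i x * lap (U i) x) + φ x * gr (U i) x - 1/2 * (U i x ^ 2 * lap φ x))) +
      (∑ i, (φ x * (V i x * lap (V i) x) + φ x * gr (V i) x - 1/2 * (V i x ^ 2 * lap φ x))) + (φ x * (T x * lap T x) + φ x * gr T x - 1/2 * (T x ^ 2 * lap φ x)) := j4.add (i1 _ h.st)
    rw [integral_sub j5 j3, integral_add j4 (i1 _ h.st), integral_add j1 j2, icm,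
      integral_finsetSum _ fun i _ => i1 _ (h.su i), integral_finsetSum _ fun i _ => i1 _ (h.sv i), integral_finsetSum _ fun j _ => i2 j, int_lap sφ cφ h.st]
    simp_rw [int_lap sφ cφ (h.su _), int_lap sφ cφ (h.sv _), int_pd (sw _) (cw _)]
    simp
  rw [integral_sub (cs_int (sφ.mul (nn_sm h)).continuous cφ.mull)] at z
  · linarith
  · have q1 : Integrable fun x => 1/2 * (En U V T x * lap φ x) := cs_int (contDiff_const.mul ((en_sm h).mul (lap_sm sφ))).continuous (CS.mulr (CS.mulr (lap_cs cφ)))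
    have q2 : Integrable fun x => κ * ∑ j, Wf U V P T j x * pd φ j x :=
      (integrable_finsetSum _ fun j _ => cs_int ((wf_sm h j).mul (sφ.pd j)).continuous (CS.mulr (cφ.pd j))).const_mul κ
    exact q1.add q2
end
section
variable {κ : ℝ} {U V : Fin 3 → R3 → ℝ} {P T : R3 → ℝ}
def Gf (κ : ℝ) (U V : Fin 3 → R3 → ℝ) (i j : Fin 3) (x : R3) : ℝ := κ * (U i x * U j x + V i x * V j x)
lemma gf_sm (h : Sys κ U V P T) (i j) : Sm (Gf κ U V i j) := contDiff_const.mul (((h.su i).mul (h.su j)).add ((h.sv i).mul (h.sv j)))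
lemma peq (h : Sys κ U V P T) (i x) : κ * pd P i x = lap (U i) x - ∑ j, pd (Gf κ U V i j) j x := by
  have e : ∀ j, pd (Gf κ U V i j) j x = κ * ((pd (U i) j x * U j x + U i x * pd (U j) j x) + pd (fun y => V j y * V i y) j x) := by
    intro j
    have s1 : Sm (fun y => U i y * U j y) := (h.su i).mul (h.su j)
    have s2 : Sm (fun y => V i y * V j y) := (h.sv i).mul (h.sv j)
    unfold Gf
    rw [pd_cmul (s1.add s2), pd_add s1 s2, pd_mul (h.su i) (h.su j)]
    simp_rw [mul_comm (V i _)]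
  have e4 := h.e4 x
  simp_rw [e, h.e1]
  simp only [Fin.sum_univ_three] at e4 ⊢
  linear_combination κ * U i x * e4
lemma plap (h : Sys κ U V P T) (x) : κ * lap P x = - ∑ i, ∑ j, pd (pd (Gf κ U V i j) i) j x := by
  have e : ∀ i, κ * pd (pd P i) i x = pd (lap (U i)) i x - ∑ j, pd (pd (Gf κ U V i j) i) j x := by
    intro i
    have hf : (fun y => κ * pd P i y) = fun y => lap (U i) y - ∑ j, pd (Gf κ U V i j) j y := funext fun y => peq h i y
    have s1 : ∀ j, Sm (pd (Gf κ U V i j) j) := fun j => (gf_sm h i j).pd j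
    rw [← pd_cmul (h.sp.pd i), hf, pd_sub (lap_sm (h.su i)) (ContDiff.sum fun j _ => s1 j), pd_sum s1]
    simp_rw [pd_comm (gf_sm h i _) _ i x]
  have z : ∑ i, pd (lap (U i)) i x = 0 := by
    have e1 : ∀ i, pd (lap (U i)) i x = ∑ j, pd (pd (pd (U i) i) j) j x := by
      intro i
      unfold lap
      rw [pd_sum fun j => ((h.su i).pd j).pd j]
      refine Finset.sum_congr rfl fun j _ => ?_
      rw [pd_comm ((h.su i).pd j)]
      congr 1
      ext y
      exact pd_comm (h.su i) _ _ y
    simp_rw [e1]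
    rw [Finset.sum_comm]
    refine Finset.sum_eq_zero fun j _ => ?_
    rw [← pd_sum fun i => ((h.su i).pd i).pd j]
    have : (fun y => ∑ i, pd (pd (U i) i) j y) = fun _ => 0 := by
      ext y
      rw [← pd_sum fun i => (h.su i).pd i]
      have : (fun y => ∑ i, pd (U i) i y) = fun _ => 0 := funext h.e4
      rw [this]; simp [pd]
    rw [this]; simp [pd]
  calc κ * lap P x = ∑ i, κ * pd (pd P i) i x := by unfold lap; rw [Finset.mul_sum]
    _ = _ := by simp_rw [e]; rw [Finset.sum_sub_distrib, z]; ring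
def shell (s t : ℝ) : Set R3 := ball 0 t \ closedBall 0 s
lemma mem_shell {s t : ℝ} {x : R3} : x ∈ shell s t ↔ s < ‖x‖ ∧ ‖x‖ < t := by
  simp [shell, and_comm]
lemma shell_bm (s t : ℝ) : BM (shell s t) := ⟨measurableSet_ball.diff measurableSet_closedBall, t, fun x hx => by
  rw [mem_shell] at hx; simpa using hx.2.le⟩
lemma supp_le {A : Set R3} (hA : MeasurableSet A) {h k : R3 → ℝ} (hh : Integrable h) (hk : IntegrableOn k A) (z : ∀ x, x ∉ A → h x = 0) (hle : ∀ x ∈ A, h x ≤ k x) :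
    ∫ x, h x ≤ ∫ x in A, k x := by
  rw [← setIntegral_eq_integral_of_forall_compl_eq_zero z]
  exact setIntegral_mono_on hh.integrableOn hk hA hle
lemma lpS_int {A : Set R3} {g : R3 → ℝ} (g0 : ∀ x, 0 ≤ g x) : ∫ x in A, g x = lpS g 1 A := by
  unfold lpS; simp [abs_of_nonneg (g0 _)]
lemma lpS_two {A : Set R3} (g : R3 → ℝ) : ∫ x in A, g x ^ 2 = lpS g 2 A ^ 2 := by
  have := lpS_pow g (show (0:ℝ) < 2 by norm_num) A
  simp only [Real.rpow_two, sq_abs] at this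
  exact this.symm
lemma pres (C0 : ℝ) (h0 : 0 ≤ C0) : ∃ C : ℝ, 0 ≤ C ∧ ∀ (κ : ℝ) (U V : Fin 3 → R3 → ℝ) (P T nu nv φ : R3 → ℝ) (p ρ w : ℝ), Sys κ U V P T → 0 < κ → 3 ≤ p → p ≤ 9/2 → 1 ≤ ρ →
    Continuous nu → Continuous nv → (∀ i x, |U i x| ≤ nu x) → (∀ i x, |V i x| ≤ nv x) → 1 ≤ w → ρ ≤ w → volume.real (shell ρ (ρ+8)) ≤ w →
    Sm φ → CS φ → (∀ j x, |pd φ j x| ≤ C0) → (∀ j x, pd φ j x ≠ 0 → ρ+3 ≤ ‖x‖ ∧ ‖x‖ ≤ ρ+5) →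
    |∫ x, κ * P x * ∑ j, U j x * pd φ j x| ≤ C * w^5 * (lpS nu p (shell ρ (ρ+8)) ^ 2
      + κ * (lpS nu p (shell ρ (ρ+8)) * (lpS nu p (shell ρ (ρ+8)) ^ 2 + lpS nv (2*(p/(p-1))) (shell ρ (ρ+8)) ^ 2))) := by
  obtain ⟨C, hC, H⟩ := press0
  obtain ⟨Cc, hCc, Hc⟩ := cutoff
  refine ⟨C * (20 * (3 * C0 + 1)), by positivity, ?_⟩
  intro κ U V P T nu nv φ p ρ w h hκ hp1 hp2 hρ cnu cnv hnu hnv hw hρw hvol sφ cφ dφ supφ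
  set A := shell ρ (ρ+8) with hA
  have bA : BM A := shell_bm _ _
  have p1 : 0 < p - 1 := by linarith
  set p' := p/(p-1) with hp'
  have p'1 : 1 < p' := by rw [hp', lt_div_iff₀ p1]; linarith
  have p'2 : p' ≤ 3/2 := by rw [hp', div_le_iff₀ p1]; linarith
  set a := lpS nu p A with ha
  set b := lpS nv (2*p') A with hb
  have a0 : 0 ≤ a := lpS_nn _ _ _
  have b0 : 0 ≤ b := lpS_nn _ _ _
  have w0 : 0 < w := by linarith
  have nu0 : ∀ x, 0 ≤ nu x := fun x => (abs_nonneg _).trans (hnu 0 x)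
  have nv0 : ∀ x, 0 ≤ nv x := fun x => (abs_nonneg _).trans (hnv 0 x)
  obtain ⟨ψ0, s0, c0, ψ00, ψ01, ψ0i, ψ0o, -, -⟩ := Hc ρ (by linarith)
  obtain ⟨ψ1, s1, c1, ψ10, ψ11, ψ1i, ψ1o, -, -⟩ := Hc (ρ+6) (by linarith)
  let χ : R3 → ℝ := fun x => ψ1 x - ψ0 x
  have sχ : Sm χ := s1.sub s0
  have cχ : CS χ := HasCompactSupport.sub c1 c0
  have χ1 : ∀ x : R3, ρ+2 < ‖x‖ → ‖x‖ < ρ+6 → χ x = 1 := fun x h1 h2 => by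
    simp only [χ]; rw [ψ1i x h2.le, ψ0o x h1.le]; ring
  have χ0 : ∀ x, x ∉ A → χ x = 0 := fun x hx => by
    simp only [χ]
    rw [mem_shell, not_and_or, not_lt, not_lt] at hx
    rcases hx with hx | hx
    · rw [ψ1i x (by linarith), ψ0i x hx]; ring
    · rw [ψ1o x (by linarith), ψ0o x (by linarith)]; ring
  have χa : ∀ x, |χ x| ≤ 1 := fun x => by
    simp only [χ]; rw [abs_le]
    constructor <;> linarith [ψ00 x, ψ01 x, ψ10 x, ψ11 x]
  let f : R3 → ℝ := fun x => ∑ j, U j x * pd φ j x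
  have sf : Sm f := ContDiff.sum fun j _ => (h.su j).mul (sφ.pd j)
  have fsup : ∀ x, f x ≠ 0 → ρ+3 ≤ ‖x‖ ∧ ‖x‖ ≤ ρ+5 := by
    intro x hx
    by_contra hcon
    apply hx
    refine Finset.sum_eq_zero fun j _ => ?_
    by_cases hz : pd φ j x = 0
    · simp [hz]
    · exact absurd (supφ j x hz) hcon
  have fA : ∀ x, x ∉ A → f x = 0 := fun x hx => by
    by_contra hc
    obtain ⟨h1, h2⟩ := fsup x hc
    exact hx (mem_shell.2 ⟨by linarith, by linarith⟩)
  have cf : CS f := HasCompactSupport.of_support_subset_isCompact (isCompact_closedBall (0:R3) (ρ+5)) fun x hx => by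
    simpa using (fsup x hx).2
  have fle : ∀ x, |f x| ≤ 3 * C0 * nu x := fun x => by
    refine (Finset.abs_sum_le_sum_abs _ _).trans ?_
    have : ∀ j ∈ Finset.univ, |U j x * pd φ j x| ≤ nu x * C0 := fun j _ => by
      rw [abs_mul]; exact mul_le_mul (hnu j x) (dφ j x) (abs_nonneg _) (nu0 x)
    refine (Finset.sum_le_card_nsmul _ _ _ this).trans (le_of_eq ?_)
    simp; ring
  have f0 : ∫ x, f x = 0 := by
    have : ∀ j, Integrable fun x => U j x * pd φ j x := fun j => cs_int ((h.su j).mul (sφ.pd j)).continuous (CS.mulr (cφ.pd j))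
    simp only [f]
    rw [integral_finsetSum _ fun j _ => this j]
    simp_rw [ibp (h.su _) sφ cφ]
    rw [Finset.sum_neg_distrib, ← integral_finsetSum _ fun j _ => cs_int (((h.su j).pd j).mul sφ).continuous (CS.mulr cφ)]
    simp_rw [← Finset.sum_mul, h.e4]
    simp
  have X1 : lpS (fun x => nu x ^ 2) p' A ≤ w ^ 2 * a ^ 2 := by
    rw [lpS_sq _ (by linarith), ← mul_pow]
    exact pow_le_pow_left₀ (lpS_nn _ _ _) (lpS_w bA cnu (by linarith) (by linarith) hw hvol) 2
  have Y1 : lpS (fun x => nv x ^ 2) p' A = b ^ 2 := by rw [lpS_sq _ (by linarith)]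
  have u1 : ∫ x in A, nu x ≤ w * a := by
    rw [lpS_int nu0]; exact lpS_w bA cnu le_rfl (by linarith) hw hvol
  have X2 : ∫ x in A, nu x ^ 2 ≤ w * (w ^ 2 * a ^ 2) := by
    rw [lpS_int fun x => sq_nonneg (nu x)]
    exact (lpS_w bA (cnu.pow 2) le_rfl (by linarith) hw hvol).trans (mll X1 w0.le)
  have Y2 : ∫ x in A, nv x ^ 2 ≤ w * b ^ 2 := by
    rw [lpS_int fun x => sq_nonneg (nv x), ← Y1]
    exact lpS_w bA (cnv.pow 2) le_rfl (by linarith) hw hvol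
  have Gle : ∀ i j x, |Gf κ U V i j x| ≤ κ * (nu x ^ 2 + nv x ^ 2) := fun i j x => by
    unfold Gf
    rw [abs_mul, abs_of_pos hκ]
    refine mll ((abs_add_le _ _).trans ?_) hκ.le
    rw [abs_mul, abs_mul, sq, sq]
    exact add_le_add (mul_le_mul (hnu _ _) (hnu _ _) (abs_nonneg _) (nu0 _)) (mul_le_mul (hnv _ _) (hnv _ _) (abs_nonneg _) (nv0 _))
  have χle : ∀ (g : R3 → ℝ) x, |χ x * g x| ≤ |g x| := fun g x => by
    rw [abs_mul]; exact mul_le_of_le_one_left (abs_nonneg _) (χa x)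
  have O : IsOpen {z : R3 | ρ+2 < ‖z‖ ∧ ‖z‖ < ρ+6} := (isOpen_lt continuous_const continuous_norm).inter (isOpen_lt continuous_norm continuous_const)
  have Oc : ∀ (g : R3 → ℝ), ∀ x ∈ {z : R3 | ρ+2 < ‖z‖ ∧ ‖z‖ < ρ+6}, χ x * g x = g x := fun g x hx => by rw [χ1 x hx.1 hx.2, one_mul]
  have key := H (2 - p') (p - 1) ρ (by linarith) (by
      rw [hp']
      have : 9/7 ≤ p/(p-1) := by rw [le_div_iff₀ p1]; linarith
      linarith) (by rw [hp']; field_simp; ring) hρ (fun x => χ x * (κ * P x)) (fun i x => χ x * U i x) (fun i j x => χ x * Gf κ U V i j x) f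
    (sχ.mul (contDiff_const.mul h.sp)) cχ.mull (fun i => sχ.mul (h.su i)) (fun i => cχ.mull) (fun i j => sχ.mul (gf_sm h i j)) (fun i j => cχ.mull) sf cf fsup f0
    (by
      intro z h1 h2 i
      rw [pd_on O (Oc _) i z ⟨h1, h2⟩, lap_on O (Oc _) z ⟨h1, h2⟩, pd_cmul h.sp, peq h]
      congr 1
      exact Finset.sum_congr rfl fun j _ => (pd_on O (Oc _) j z ⟨h1, h2⟩).symm)
    (by
      intro z h1 h2
      have : lap (fun y => κ * P y) z = κ * lap P z := by
        unfold lap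
        rw [Finset.mul_sum]
        refine Finset.sum_congr rfl fun j _ => ?_
        rw [← pd_cmul (h.sp.pd j)]
        congr 1; ext y; exact pd_cmul h.sp _ _ _
      rw [lap_on O (Oc _) z ⟨h1, h2⟩, this, plap h]
      congr 1
      exact Finset.sum_congr rfl fun i _ => Finset.sum_congr rfl fun j _ => (pd_on O (pd_on O (Oc _) i) j z ⟨h1, h2⟩).symm)
    (w * a) (κ * (w * (w ^ 2 * a ^ 2) + w * b ^ 2)) (3 * C0 * (w * a)) (3 * C0 * a) (κ * 2 * (w ^ 2 * a ^ 2 + b ^ 2)) (by positivity) (by positivity)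
    (by
      intro i
      refine le_trans (supp_le bA.1 (cs_int (sχ.mul (h.su i)).continuous cχ.mull).abs (bA.int cnu) (fun x hx => ?_) fun x _ => (χle _ x).trans (hnu i x)) u1
      simp [χ0 x hx])
    (by
      intro i j
      refine le_trans (supp_le bA.1 (cs_int (sχ.mul (gf_sm h i j)).continuous cχ.mull).abs (k := fun x => κ * (nu x ^ 2 + nv x ^ 2)) (bA.int (by fun_prop)) (fun x hx => ?_) fun x _ => (χle _ x).trans (Gle i j x)) ?_
      · simp [χ0 x hx]
      · have q1 : IntegrableOn (fun x => nu x ^ 2) A := bA.int (cnu.pow 2)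
        have q2 : IntegrableOn (fun x => nv x ^ 2) A := bA.int (cnv.pow 2)
        rw [icm, integral_add q1 q2]
        gcongr)
    (by
      refine le_trans (supp_le bA.1 (cs_int sf.cont cf).abs (k := fun x => 3 * C0 * nu x) (bA.int (by fun_prop)) (fun x hx => by simp [fA x hx]) fun x _ => fle x) ?_
      rw [icm]
      gcongr)
    (by
      rw [sub_add_cancel]
      have pp : 0 < p := by linarith
      refine le_trans (supp_le bA.1 (cs_int (rpow_ct sf.cont pp) (rpow_cs cf pp)) (k := fun x => (3 * C0) ^ p * |nu x| ^ p) (bA.int (continuous_const.mul (rpow_ct cnu pp))) (fun x hx => by simp [fA x hx, pp.ne']) fun x _ => ?_) ?_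
      · rw [← Real.mul_rpow (by positivity) (abs_nonneg _), abs_of_nonneg (nu0 x)]
        exact rle' (abs_nonneg _) (fle x) pp.le
      · rw [icm, Real.mul_rpow (by positivity) a0, ha, lpS_pow _ pp])
    (by
      intro i j
      rw [show 2 - (2 - p') = p' by ring]
      have pp : 0 < p' := by linarith
      have sG : Sm (fun x => χ x * Gf κ U V i j x) := sχ.mul (gf_sm h i j)
      have cG : CS (fun x => χ x * Gf κ U V i j x) := cχ.mull
      have c2 : Continuous fun x => nu x ^ 2 := cnu.pow 2
      have c3 : Continuous fun x => nv x ^ 2 := cnv.pow 2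
      refine le_trans (supp_le bA.1 (cs_int (rpow_ct sG.cont pp) (rpow_cs cG pp)) (k := fun x => (κ * 2) ^ p' * (|nu x ^ 2| ^ p' + |nv x ^ 2| ^ p'))
        (bA.int (continuous_const.mul ((rpow_ct c2 pp).add (rpow_ct c3 pp)))) (fun x hx => by simp [χ0 x hx, pp.ne']) fun x _ => ?_) ?_
      · have m1 : |χ x * Gf κ U V i j x| ≤ (κ * 2) * max (nu x ^ 2) (nv x ^ 2) := by
          refine ((χle _ x).trans (Gle i j x)).trans ?_
          have := le_max_left (nu x ^ 2) (nv x ^ 2)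
          have := le_max_right (nu x ^ 2) (nv x ^ 2)
          rw [mul_assoc]
          gcongr
          linarith
        have m2 : (max (nu x ^ 2) (nv x ^ 2)) ^ p' ≤ |nu x ^ 2| ^ p' + |nv x ^ 2| ^ p' := by
          rw [abs_of_nonneg (sq_nonneg _), abs_of_nonneg (sq_nonneg _)]
          rcases max_cases (nu x ^ 2) (nv x ^ 2) with h | h <;> rw [h.1]
          · linarith [rnn (sq_nonneg (nv x)) p']
          · linarith [rnn (sq_nonneg (nu x)) p']
        calc _ ≤ ((κ * 2) * max (nu x ^ 2) (nv x ^ 2)) ^ p' := rle' (abs_nonneg _) m1 pp.le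
          _ = (κ * 2) ^ p' * (max (nu x ^ 2) (nv x ^ 2)) ^ p' := Real.mul_rpow (by positivity) (by positivity)
          _ ≤ _ := mll m2 (by positivity)
      · rw [icm, integral_add (bA.int (rpow_ct c2 pp)) (bA.int (rpow_ct c3 pp)), Real.mul_rpow (x := κ * 2) (y := w ^ 2 * a ^ 2 + b ^ 2) (by positivity) (by positivity), ← lpS_pow _ pp, ← lpS_pow _ pp, Y1]
        refine mll ?_ (rnn (by positivity) _)
        calc _ ≤ (w ^ 2 * a ^ 2) ^ p' + (b ^ 2) ^ p' := by
              gcongr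
              exact lpS_nn _ _ _
          _ ≤ _ := Real.add_rpow_le_rpow_add (by positivity) (by positivity) p'1.le)
  have e : ∀ x, χ x * (κ * P x) * f x = κ * P x * ∑ j, U j x * pd φ j x := fun x => by
    by_cases hx : f x = 0
    · have : ∑ j, U j x * pd φ j x = 0 := hx
      rw [hx, this]; ring
    · obtain ⟨h1, h2⟩ := fsup x hx
      rw [χ1 x (by linarith) (by linarith), one_mul]
  simp_rw [e] at key
  refine key.trans ?_
  rw [mul_assoc C, mul_assoc C]
  refine mll ?_ hC
  have w1 : w ≤ w ^ 5 := le_self_pow₀ hw (by norm_num)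
  have w2 : w ^ 2 ≤ w ^ 5 := pow_le_pow_right₀ hw (by norm_num)
  have w3 : w ^ 3 ≤ w ^ 5 := pow_le_pow_right₀ hw (by norm_num)
  have w5 : 1 ≤ w ^ 5 := one_le_pow₀ hw
  have k1 : 3 * C0 * a * (κ * 2 * (w ^ 2 * a ^ 2 + b ^ 2)) ≤ 3 * C0 * a * (κ * 2 * (w ^ 5 * a ^ 2 + w ^ 5 * b ^ 2)) := by
    gcongr
    nlinarith [sq_nonneg b]
  have k2 : ρ * (w * a + κ * (w * (w ^ 2 * a ^ 2) + w * b ^ 2)) * (3 * C0 * (w * a)) ≤ 3 * C0 * (w ^ 5 * a ^ 2 + κ * (w ^ 5 * a ^ 2 + w ^ 5 * b ^ 2) * a) := by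
    calc _ ≤ w * (w * a + κ * (w * (w ^ 2 * a ^ 2) + w * b ^ 2)) * (3 * C0 * (w * a)) := by gcongr
      _ = 3 * C0 * (w ^ 3 * a ^ 2 + κ * (w ^ 5 * a ^ 2 + w ^ 3 * b ^ 2) * a) := by ring
      _ ≤ _ := by gcongr
  refine (add_le_add k1 k2).trans ?_
  have n1 : 0 ≤ w ^ 5 * a ^ 2 := by positivity
  have n2 : 0 ≤ κ * (w ^ 5 * (a * (a ^ 2 + b ^ 2))) := by positivity
  nlinarith [mul_nonneg h0 n1, mul_nonneg h0 n2]
end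
lemma gr_mul_le {φ g : R3 → ℝ} (sφ : Sm φ) (sg : Sm g) (x) : gr (fun y => φ y * g y) x ≤ 2 * (φ x ^ 2 * gr g x) + 2 * (g x ^ 2 * gr φ x) := by
  unfold gr
  simp_rw [pd_mul sφ sg, Finset.mul_sum]
  rw [← Finset.sum_add_distrib]
  refine Finset.sum_le_sum fun j _ => ?_
  nlinarith [sq_nonneg (pd φ j x * g x - φ x * pd g j x)]
def Qq (κ w a b τ b2 t2 : ℝ) : ℝ := w^5 * (a^2 + b2^2 + t2^2 + κ * (a * (a^2 + b^2 + τ^2) + b2 * t2))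
lemma num1 {κ w a b τ b2 t2 C : ℝ} (hκ : 0 < κ) (hw : 1 ≤ w) (a0 : 0 ≤ a) (b0 : 0 ≤ b) (τ0 : 0 ≤ τ) (b20 : 0 ≤ b2) (t20 : 0 ≤ t2) (hC : 0 ≤ C) :
    14 * C * ((w ^ 2 * a ^ 2 + b2 ^ 2 + t2 ^ 2) + κ * ((a * (w ^ 2 * a ^ 2) + a * b ^ 2 + a * τ ^ 2) + b2 * t2)) ≤ 14 * C * Qq κ w a b τ b2 t2 := by
  have w5 : 1 ≤ w ^ 5 := one_le_pow₀ hw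
  have w2 : w ^ 2 ≤ w ^ 5 := pow_le_pow_right₀ hw (by norm_num)
  refine mll ?_ (by positivity)
  have o : ∀ x : ℝ, 0 ≤ x → x ≤ w ^ 5 * x := fun x hx => le_mul_of_one_le_left hx w5
  have l1 : w ^ 2 * a ^ 2 ≤ w ^ 5 * a ^ 2 := by gcongr
  have l2 := o (b2 ^ 2) (by positivity)
  have l3 := o (t2 ^ 2) (by positivity)
  have l4 : a * (w ^ 2 * a ^ 2) ≤ a * (w ^ 5 * a ^ 2) := by gcongr
  have l5 := o (a * b ^ 2) (by positivity)
  have l6 := o (a * τ ^ 2) (by positivity)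
  have l7 := o (b2 * t2) (by positivity)
  have := mll (add_le_add (add_le_add (add_le_add l4 l5) l6) l7) hκ.le
  refine (add_le_add (add_le_add (add_le_add l1 l2) l3) this).trans (le_of_eq ?_)
  unfold Qq; ring
lemma num2 {κ w a b τ b2 t2 C : ℝ} (hκ : 0 < κ) (hw : 1 ≤ w) (a0 : 0 ≤ a) (b0 : 0 ≤ b) (τ0 : 0 ≤ τ) (b20 : 0 ≤ b2) (t20 : 0 ≤ t2) (hC : 0 ≤ C) :
    C * w ^ 5 * (a ^ 2 + κ * (a * (a ^ 2 + b ^ 2))) ≤ C * Qq κ w a b τ b2 t2 := by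
  unfold Qq
  rw [mul_assoc]
  refine mll (mll ?_ (by positivity)) hC
  have : κ * (a * (a ^ 2 + b ^ 2)) ≤ κ * (a * (a^2 + b^2 + τ^2) + b2 * t2) := by
    refine mll ?_ hκ.le
    have : 0 ≤ a * τ ^ 2 := by positivity
    have : 0 ≤ b2 * t2 := by positivity
    linarith
  linarith [sq_nonneg b2, sq_nonneg t2]
lemma num4 {κ w a b τ b2 t2 : ℝ} (hκ : 0 < κ) (hw : 1 ≤ w) (a0 : 0 ≤ a) (b0 : 0 ≤ b) (τ0 : 0 ≤ τ) (b20 : 0 ≤ b2) (t20 : 0 ≤ t2) :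
    b2 ^ 2 ≤ Qq κ w a b τ b2 t2 ∧ t2 ^ 2 ≤ Qq κ w a b τ b2 t2 := by
  have : a^2 + b2^2 + t2^2 + κ * (a * (a^2 + b^2 + τ^2) + b2 * t2) ≤ Qq κ w a b τ b2 t2 :=
    le_mul_of_one_le_left (by positivity) (one_le_pow₀ hw)
  have n : 0 ≤ κ * (a * (a^2 + b^2 + τ^2) + b2 * t2) := by positivity
  constructor <;> linarith [sq_nonneg a, sq_nonneg b2, sq_nonneg t2]
lemma num3 {κ C n m t E l f D g : ℝ} (hκ : 0 < κ) (hC : 0 ≤ C) (n0 : 0 ≤ n) (m0 : 0 ≤ m)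
    (q1 : 1/2 * (E * l) ≤ 1/2 * (3 * (n ^ 2 + m ^ 2 + t ^ 2) * C))
    (q2 : 1/2 * E * f ≤ 1/2 * (3 * (n ^ 2 + m ^ 2 + t ^ 2) * (3 * C * n)))
    (q3 : (D + t) * g ≤ (3 * (n * m) + |t|) * (3 * C * m)) :
    1/2 * (E * l) + κ * (1/2 * E * f + (D + t) * g) ≤ 14 * C * ((n ^ 2 + m ^ 2 + t ^ 2) + κ * ((n * n ^ 2 + n * m ^ 2 + n * t ^ 2) + m * |t|)) := by
  have q4 := mll (add_le_add q2 q3) hκ.le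
  have n1 : 0 ≤ C * (n ^ 2 + m ^ 2 + t ^ 2) := by positivity
  have n2 : 0 ≤ κ * (C * (n * n ^ 2)) := by positivity
  have n3 : 0 ≤ κ * (C * (n * m ^ 2)) := by positivity
  have n4 : 0 ≤ κ * (C * (n * t ^ 2)) := by positivity
  have n5 : 0 ≤ κ * (C * (m * |t|)) := by positivity
  linarith
set_option maxHeartbeats 2000000 in
lemma unit_est : ∃ C : ℝ, 0 ≤ C ∧ ∀ (κ : ℝ) (U V : Fin 3 → R3 → ℝ) (P T nu nv : R3 → ℝ) (p ρ w : ℝ), Sys κ U V P T → 0 < κ → 3 ≤ p → p ≤ 9/2 → 1 ≤ ρ →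
    Continuous nu → Continuous nv → (∀ i x, |U i x| ≤ nu x) → (∀ i x, |V i x| ≤ nv x) → 1 ≤ w → ρ ≤ w → volume.real (shell ρ (ρ+8)) ≤ w →
    ∀ a b τ b2 t2, a = lpS nu p (shell ρ (ρ+8)) → b = lpS nv (2*(p/(p-1))) (shell ρ (ρ+8)) → τ = lpS T (2*(p/(p-1))) (shell ρ (ρ+8)) →
      b2 = lpS nv 2 (shell ρ (ρ+8)) → t2 = lpS T 2 (shell ρ (ρ+8)) →
    (∫ x in ball 0 ρ, Nn U V T x ≤ C * Qq κ w a b τ b2 t2) ∧ (∀ i, ∫ x in ball 0 ρ, |V i x| ^ (6:ℝ) ≤ (C * Qq κ w a b τ b2 t2) ^ (3:ℝ)) ∧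
      ∫ x in ball 0 ρ, |T x| ^ (6:ℝ) ≤ (C * Qq κ w a b τ b2 t2) ^ (3:ℝ) := by
  obtain ⟨Cc, hCc, Hc⟩ := cutoff
  obtain ⟨Cp, hCp, Hp⟩ := pres Cc hCc
  obtain ⟨Cs, hCs, Hs⟩ := sob
  refine ⟨(14 * Cc + Cp) + Cs * (2 * (14 * Cc + Cp) + 6 * Cc ^ 2), by positivity, ?_⟩
  intro κ U V P T nu nv p ρ w h hκ hp1 hp2 hρ cnu cnv hnu hnv hw hρw hvol a b τ b2 t2 ha hb hτ hb2 ht2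
  set A := shell ρ (ρ+8) with hA
  have bA : BM A := shell_bm _ _
  have p1 : 0 < p - 1 := by linarith
  have p0 : 0 < p := by linarith
  set p' := p/(p-1) with hp'
  have p'1 : 1 < p' := by rw [hp', lt_div_iff₀ p1]; linarith
  have p'2 : p' ≤ 3/2 := by rw [hp', div_le_iff₀ p1]; linarith
  have p'0 : 0 < p' := by linarith
  have hpp : 1 / p + 1 / p' = 1 := by rw [hp']; field_simp; ring
  have a0 : 0 ≤ a := ha ▸ lpS_nn _ _ _
  have b0 : 0 ≤ b := hb ▸ lpS_nn _ _ _
  have τ0 : 0 ≤ τ := hτ ▸ lpS_nn _ _ _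
  have b20 : 0 ≤ b2 := hb2 ▸ lpS_nn _ _ _
  have t20 : 0 ≤ t2 := ht2 ▸ lpS_nn _ _ _
  have w0 : 0 < w := by linarith
  have nu0 : ∀ x, 0 ≤ nu x := fun x => (abs_nonneg _).trans (hnu 0 x)
  have nv0 : ∀ x, 0 ≤ nv x := fun x => (abs_nonneg _).trans (hnv 0 x)
  have cT := h.st.cont
  obtain ⟨φ, sφ, cφ, φ0, φ1, φi, φo, φd, φl⟩ := Hc (ρ+3) (by linarith)
  have Oi : IsOpen {z : R3 | ‖z‖ < ρ+3} := isOpen_lt continuous_norm continuous_const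
  have Oo : IsOpen {z : R3 | ρ+5 < ‖z‖} := isOpen_lt continuous_const continuous_norm
  have hi : ∀ x ∈ {z : R3 | ‖z‖ < ρ+3}, φ x = (fun _ => (1:ℝ)) x := fun x hx => φi x (le_of_lt hx)
  have ho : ∀ x ∈ {z : R3 | ρ+5 < ‖z‖}, φ x = (fun _ => (0:ℝ)) x := fun x hx => φo x ((by ring : ρ+3+2 = ρ+5).le.trans (le_of_lt hx))
  have pc : ∀ (c : ℝ) j, pd (fun _ => c) j = fun _ => 0 := fun c j => by ext; simp [pd]
  have supφ : ∀ j x, pd φ j x ≠ 0 → ρ+3 ≤ ‖x‖ ∧ ‖x‖ ≤ ρ+5 := by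
    intro j x hx
    constructor
    · by_contra hc
      exact hx (by rw [pd_on Oi hi j x (not_le.1 hc), pc])
    · by_contra hc
      exact hx (by rw [pd_on Oo ho j x (not_le.1 hc), pc])
  have dA : ∀ j x, x ∉ A → pd φ j x = 0 := fun j x hx => by
    by_contra hc
    obtain ⟨h1, h2⟩ := supφ j x hc
    exact hx (mem_shell.2 ⟨by linarith, by linarith⟩)
  have lA : ∀ x, x ∉ A → lap φ x = 0 := fun x hx => by
    rw [mem_shell, not_and_or, not_lt, not_lt] at hx
    rcases hx with hx | hx
    · rw [lap_on Oi hi x (by show ‖x‖ < ρ+3; linarith)]; simp [lap, pc]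
    · rw [lap_on Oo ho x (by show ρ+5 < ‖x‖; linarith)]; simp [lap, pc]
  let f : R3 → ℝ := fun x => ∑ j, U j x * pd φ j x
  let g : R3 → ℝ := fun x => ∑ j, V j x * pd φ j x
  have sle : ∀ (W : Fin 3 → R3 → ℝ) (n : R3 → ℝ) x, (∀ i x, |W i x| ≤ n x) → |∑ j, W j x * pd φ j x| ≤ 3 * Cc * n x := fun W n x hn => by
    refine (Finset.abs_sum_le_sum_abs _ _).trans ?_
    have : ∀ j ∈ Finset.univ, |W j x * pd φ j x| ≤ n x * Cc := fun j _ => by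
      rw [abs_mul]; exact mul_le_mul (hn j x) (φd j x) (abs_nonneg _) ((abs_nonneg _).trans (hn 0 x))
    refine (Finset.sum_le_card_nsmul _ _ _ this).trans (le_of_eq ?_)
    simp; ring
  have fle : ∀ x, |f x| ≤ 3 * Cc * nu x := fun x => sle U nu x hnu
  have gle : ∀ x, |g x| ≤ 3 * Cc * nv x := fun x => sle V nv x hnv
  have sf : Sm f := ContDiff.sum fun j _ => (h.su j).mul (sφ.pd j)
  have sg : Sm g := ContDiff.sum fun j _ => (h.sv j).mul (sφ.pd j)
  have fA : ∀ x, x ∉ A → f x = 0 := fun x hx => Finset.sum_eq_zero fun j _ => by rw [dA j x hx, mul_zero]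
  have gA : ∀ x, x ∉ A → g x = 0 := fun x hx => Finset.sum_eq_zero fun j _ => by rw [dA j x hx, mul_zero]
  have Ac : ∀ (k : R3 → ℝ), (∀ x, x ∉ A → k x = 0) → CS k := fun k hk =>
    HasCompactSupport.of_support_subset_isCompact (isCompact_closedBall (0:R3) (ρ+8)) fun x hx => by
      by_contra hc
      refine hx (hk x fun hxA => hc ?_)
      simpa using (mem_shell.1 hxA).2.le
  have E0 : ∀ x, 0 ≤ En U V T x := fun x => by unfold En; positivity
  have Ele : ∀ x, En U V T x ≤ 3 * (nu x ^ 2 + nv x ^ 2 + T x ^ 2) := fun x => by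
    unfold En
    have q1 : ∀ i, U i x ^ 2 ≤ nu x ^ 2 := fun i => sq_le_sq' (by linarith [neg_abs_le (U i x), hnu i x]) ((le_abs_self _).trans (hnu i x))
    have q2 : ∀ i, V i x ^ 2 ≤ nv x ^ 2 := fun i => sq_le_sq' (by linarith [neg_abs_le (V i x), hnv i x]) ((le_abs_self _).trans (hnv i x))
    simp only [Fin.sum_univ_three]
    nlinarith [q1 0, q1 1, q1 2, q2 0, q2 1, q2 2, sq_nonneg (T x)]
  have Dle : ∀ x, |Dt U V x| ≤ 3 * (nu x * nv x) := fun x => by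
    unfold Dt
    refine (Finset.abs_sum_le_sum_abs _ _).trans ?_
    have : ∀ j ∈ Finset.univ, |U j x * V j x| ≤ nu x * nv x := fun j _ => by
      rw [abs_mul]; exact mul_le_mul (hnu j x) (hnv j x) (abs_nonneg _) (nu0 x)
    refine (Finset.sum_le_card_nsmul _ _ _ this).trans (le_of_eq ?_)
    simp
  let R1 : R3 → ℝ := fun x => 1/2 * (En U V T x * lap φ x) + κ * (1/2 * En U V T x * f x + (Dt U V x + T x) * g x)
  have sR : Sm R1 := (contDiff_const.mul ((en_sm h).mul (lap_sm sφ))).add (contDiff_const.mul (((contDiff_const.mul (en_sm h)).mul sf).add (((dt_sm h).add h.st).mul sg)))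
  have RA : ∀ x, x ∉ A → R1 x = 0 := fun x hx => by simp [R1, fA x hx, gA x hx, lA x hx]
  have Rle : ∀ x, R1 x ≤ 14 * Cc * ((nu x ^ 2 + nv x ^ 2 + T x ^ 2) + κ * ((|nu x| * |nu x ^ 2| + |nu x| * |nv x ^ 2| + |nu x| * |T x ^ 2|) + |nv x| * |T x|)) := fun x => by
    have q1 : 1/2 * (En U V T x * lap φ x) ≤ 1/2 * (3 * (nu x ^ 2 + nv x ^ 2 + T x ^ 2) * Cc) := by
      have : En U V T x * lap φ x ≤ 3 * (nu x ^ 2 + nv x ^ 2 + T x ^ 2) * Cc :=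
        (mll ((le_abs_self _).trans (φl x)) (E0 x)).trans (mlr (Ele x) hCc)
      linarith
    have q2 : 1/2 * En U V T x * f x ≤ 1/2 * (3 * (nu x ^ 2 + nv x ^ 2 + T x ^ 2) * (3 * Cc * nu x)) := by
      have : En U V T x * f x ≤ 3 * (nu x ^ 2 + nv x ^ 2 + T x ^ 2) * (3 * Cc * nu x) :=
        (mll ((le_abs_self _).trans (fle x)) (E0 x)).trans (mlr (Ele x) (by have := nu0 x; positivity))
      linarith
    have q3 : (Dt U V x + T x) * g x ≤ (3 * (nu x * nv x) + |T x|) * (3 * Cc * nv x) := by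
      refine (le_abs_self _).trans ?_
      rw [abs_mul]
      have := nu0 x; have := nv0 x
      exact mul_le_mul ((abs_add_le _ _).trans (add_le_add (Dle x) le_rfl)) (gle x) (abs_nonneg _) (by positivity)
    rw [abs_of_nonneg (nu0 x), abs_of_nonneg (nv0 x), abs_of_nonneg (sq_nonneg _), abs_of_nonneg (sq_nonneg _), abs_of_nonneg (sq_nonneg _)]
    exact num3 hκ hCc (nu0 x) (nv0 x) q1 q2 q3
  have W1 : lpS nu (2 * p') A ≤ w * a := by rw [ha]; exact lpS_w bA cnu (by linarith) (by linarith) hw hvol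
  have W2 : lpS nu 2 A ≤ w * a := by rw [ha]; exact lpS_w bA cnu (by linarith) (by linarith) hw hvol
  have c1 : Continuous fun x => nu x ^ 2 := cnu.pow 2
  have c2 : Continuous fun x => nv x ^ 2 := cnv.pow 2
  have c3 : Continuous fun x => T x ^ 2 := cT.pow 2
  have I1 : ∫ x in A, nu x ^ 2 ≤ w ^ 2 * a ^ 2 := by
    rw [lpS_two, ← mul_pow]; exact pow_le_pow_left₀ (lpS_nn _ _ _) W2 2
  have I2 : ∫ x in A, nv x ^ 2 = b2 ^ 2 := by rw [lpS_two, hb2]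
  have I3 : ∫ x in A, T x ^ 2 = t2 ^ 2 := by rw [lpS_two, ht2]
  have I4 : ∫ x in A, |nu x| * |nu x ^ 2| ≤ a * (w ^ 2 * a ^ 2) := by
    refine (hol bA cnu c1 p0 p'0 hpp).trans ?_
    rw [lpS_sq _ p'0, ← mul_pow, ha]
    exact mll (pow_le_pow_left₀ (lpS_nn _ _ _) (ha ▸ W1) 2) (lpS_nn _ _ _)
  have I5 : ∫ x in A, |nu x| * |nv x ^ 2| ≤ a * b ^ 2 := by
    refine (hol bA cnu c2 p0 p'0 hpp).trans ?_
    rw [lpS_sq _ p'0, ha, hb]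
  have I6 : ∫ x in A, |nu x| * |T x ^ 2| ≤ a * τ ^ 2 := by
    refine (hol bA cnu c3 p0 p'0 hpp).trans ?_
    rw [lpS_sq _ p'0, ha, hτ]
  have I7 : ∫ x in A, |nv x| * |T x| ≤ b2 * t2 := by
    rw [hb2, ht2]
    exact hol bA cnv cT (by norm_num) (by norm_num) (by norm_num)
  have R1le : ∫ x, R1 x ≤ 14 * Cc * ((w ^ 2 * a ^ 2 + b2 ^ 2 + t2 ^ 2) + κ * ((a * (w ^ 2 * a ^ 2) + a * b ^ 2 + a * τ ^ 2) + b2 * t2)) := by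
    refine (supp_le bA.1 (cs_int sR.cont (Ac _ RA)) (bA.int (by fun_prop)) RA fun x _ => Rle x).trans ?_
    have j1 : IntegrableOn (fun x => nu x ^ 2) A := bA.int c1
    have j2 : IntegrableOn (fun x => nv x ^ 2) A := bA.int c2
    have j3 : IntegrableOn (fun x => T x ^ 2) A := bA.int c3
    have j12 : IntegrableOn (fun x => nu x ^ 2 + nv x ^ 2) A := j1.add j2
    have j4 : IntegrableOn (fun x => |nu x| * |nu x ^ 2|) A := bA.int (by fun_prop)
    have j5 : IntegrableOn (fun x => |nu x| * |nv x ^ 2|) A := bA.int (by fun_prop)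
    have j6 : IntegrableOn (fun x => |nu x| * |T x ^ 2|) A := bA.int (by fun_prop)
    have j7 : IntegrableOn (fun x => |nv x| * |T x|) A := bA.int (by fun_prop)
    have j45 : IntegrableOn (fun x => |nu x| * |nu x ^ 2| + |nu x| * |nv x ^ 2|) A := j4.add j5
    have j456 : IntegrableOn (fun x => |nu x| * |nu x ^ 2| + |nu x| * |nv x ^ 2| + |nu x| * |T x ^ 2|) A := j45.add j6
    rw [icm, integral_add (bA.int (by fun_prop)) (bA.int (by fun_prop)), icm, integral_add j456 j7, integral_add j45 j6, integral_add j4 j5,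
      integral_add j12 j3, integral_add j1 j2, I2, I3]
    gcongr
  have key := energy h sφ cφ
  set Q := Qq κ w a b τ b2 t2 with hQ
  have w5 : 1 ≤ w ^ 5 := one_le_pow₀ hw
  have w2 : w ^ 2 ≤ w ^ 5 := pow_le_pow_right₀ hw (by norm_num)
  have D1 : ∫ x, φ x * Nn U V T x ≤ (14 * Cc + Cp) * Q := by
    have e : ∀ x, 1/2 * (En U V T x * lap φ x) + κ * ∑ j, Wf U V P T j x * pd φ j x = R1 x + κ * P x * ∑ j, U j x * pd φ j x := fun x => by
      simp only [R1, f, g, Wf, Fin.sum_univ_three]; ring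
    simp_rw [e] at key
    have jp : Integrable fun x => κ * P x * ∑ j, U j x * pd φ j x :=
      cs_int ((contDiff_const.mul h.sp).mul sf).continuous (Ac _ fun x hx => by
        have : ∑ j, U j x * pd φ j x = 0 := fA x hx
        rw [this, mul_zero])
    rw [key, integral_add (cs_int sR.cont (Ac _ RA)) jp]
    have hpres := Hp κ U V P T nu nv φ p ρ w h hκ hp1 hp2 hρ cnu cnv hnu hnv hw hρw hvol sφ cφ φd supφ
    rw [← hA, ← ha, ← hp', ← hb] at hpres
    have k1 := num1 (w := w) hκ hw a0 b0 τ0 b20 t20 hCc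
    have k2 := num2 (w := w) hκ hw a0 b0 τ0 b20 t20 hCp
    rw [← hQ] at k1 k2
    have := le_abs_self (∫ x, κ * P x * ∑ j, U j x * pd φ j x)
    linarith
  have N0 : ∀ x, 0 ≤ Nn U V T x := fun x =>
    add_nonneg (add_nonneg (Finset.sum_nonneg fun i _ => gr_nn _ _) (Finset.sum_nonneg fun i _ => gr_nn _ _)) (gr_nn _ _)
  have φB : ∀ x ∈ ball (0:R3) ρ, φ x = 1 := fun x hx => φi x ((le_of_lt (by simpa using hx)).trans (by linarith : ρ ≤ ρ+3))
  have Q0 : 0 ≤ Q := by rw [hQ, Qq]; positivity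
  have iφN : Integrable fun x => φ x * Nn U V T x := cs_int (sφ.mul (nn_sm h)).continuous cφ.mull
  have bB : BM (ball (0:R3) ρ) := ⟨measurableSet_ball, ρ, ball_subset_closedBall⟩
  have S1 : ∀ (k m : R3 → ℝ) (n2 : ℝ), Sm k → Continuous m → (∀ x, |k x| ≤ |m x|) → (∀ x, gr k x ≤ Nn U V T x) → ∫ x in A, m x ^ 2 = n2 ^ 2 → n2 ^ 2 ≤ Q →
      ∫ x in ball 0 ρ, |k x| ^ (6:ℝ) ≤ (((14 * Cc + Cp) + Cs * (2 * (14 * Cc + Cp) + 6 * Cc ^ 2)) * Q) ^ (3:ℝ) := by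
    intro k m n2 sk cm hkm hkN hm hn2
    have sφk : Sm fun x => φ x * k x := sφ.mul sk
    have cφk : CS fun x => φ x * k x := cφ.mull
    have r1 : ∫ x in ball 0 ρ, |k x| ^ (6:ℝ) ≤ ∫ x, |φ x * k x| ^ (6:ℝ) := by
      calc ∫ x in ball 0 ρ, |k x| ^ (6:ℝ) = ∫ x in ball 0 ρ, |φ x * k x| ^ (6:ℝ) := setIntegral_congr_fun measurableSet_ball fun x hx => by simp only [φB x hx, one_mul]
        _ ≤ _ := setIntegral_le_integral (cs_int (rpow_ct sφk.cont (by norm_num)) (rpow_cs cφk (by norm_num))) (evf fun x => rnn (abs_nonneg _) _)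
    refine (r1.trans (Hs _ sφk cφk)).trans (rle' (mul_nonneg hCs (integral_nonneg fun x => gr_nn _ _)) ?_ (by norm_num))
    have z : ∀ x, x ∉ A → 2 * (k x ^ 2 * gr φ x) = 0 := fun x hx => by simp [gr, dA _ x hx]
    have i2 : Integrable fun x => 2 * (k x ^ 2 * gr φ x) := cs_int (contDiff_const.mul ((sk.pow 2).mul (gr_sm sφ))).continuous (Ac _ z)
    have r2 : ∫ x, gr (fun y => φ y * k y) x ≤ 2 * (∫ x, φ x * Nn U V T x) + ∫ x, 2 * (k x ^ 2 * gr φ x) := by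
      rw [← icm, ← integral_add (iφN.const_mul 2) i2]
      refine integral_mono (cs_int (gr_sm sφk).cont (gr_cs cφk)) ((iφN.const_mul 2).add i2) fun x => ?_
      refine (gr_mul_le sφ sk x).trans ?_
      have : φ x ^ 2 * gr k x ≤ φ x * Nn U V T x :=
        mul_le_mul (by nlinarith [φ0 x, φ1 x]) (hkN x) (gr_nn _ _) (φ0 x)
      show _ ≤ 2 * (φ x * Nn U V T x) + 2 * (k x ^ 2 * gr φ x)
      linarith
    have r3 : ∫ x, 2 * (k x ^ 2 * gr φ x) ≤ 6 * Cc ^ 2 * n2 ^ 2 := by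
      refine (supp_le bA.1 i2 (k := fun x => 6 * Cc ^ 2 * m x ^ 2) (bA.int (by fun_prop)) z fun x _ => ?_).trans ?_
      · have g1 : gr φ x ≤ 3 * Cc ^ 2 := by
          unfold gr
          have : ∀ j ∈ Finset.univ, pd φ j x ^ 2 ≤ Cc ^ 2 := fun j _ => by
            rw [← sq_abs]; exact pow_le_pow_left₀ (abs_nonneg _) (φd j x) 2
          refine (Finset.sum_le_card_nsmul _ _ _ this).trans (le_of_eq ?_)
          simp
        have := mul_le_mul (sq_le_sq.2 (hkm x)) g1 (gr_nn _ _) (sq_nonneg _)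
        linarith
      · rw [icm, hm]
    have r4 : ∫ x, gr (fun y => φ y * k y) x ≤ (2 * (14 * Cc + Cp) + 6 * Cc ^ 2) * Q := by
      have : 6 * Cc ^ 2 * n2 ^ 2 ≤ 6 * Cc ^ 2 * Q := by gcongr
      linarith
    have r5 := mll r4 hCs
    have : 0 ≤ (14 * Cc + Cp) * Q := by positivity
    linarith
  have Qb : b2 ^ 2 ≤ Q ∧ t2 ^ 2 ≤ Q := num4 hκ hw a0 b0 τ0 b20 t20
  refine ⟨?_, fun i => S1 _ nv b2 (h.sv i) cnv (fun x => (hnv i x).trans (le_abs_self _)) (fun x => ?_) I2 Qb.1, S1 _ T t2 h.st cT (fun x => le_rfl) (fun x => ?_) I3 Qb.2⟩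
  · calc ∫ x in ball 0 ρ, Nn U V T x = ∫ x in ball 0 ρ, φ x * Nn U V T x := setIntegral_congr_fun measurableSet_ball fun x hx => by simp only [φB x hx, one_mul]
      _ ≤ ∫ x, φ x * Nn U V T x := setIntegral_le_integral iφN (evf fun x => mul_nonneg (φ0 x) (N0 x))
      _ ≤ _ := D1
      _ ≤ _ := by
        refine mlr ?_ Q0
        have : 0 ≤ Cs * (2 * (14 * Cc + Cp) + 6 * Cc ^ 2) := by positivity
        linarith
  · unfold Nn
    have q1 := Finset.single_le_sum (f := fun i => gr (V i) x) (fun i _ => gr_nn _ _) (Finset.mem_univ i)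
    have q2 : 0 ≤ ∑ i, gr (U i) x := Finset.sum_nonneg fun i _ => gr_nn _ _
    have q3 := gr_nn T x
    linarith
  · unfold Nn
    have q1 : 0 ≤ ∑ i, gr (V i) x := Finset.sum_nonneg fun i _ => gr_nn _ _
    have q2 : 0 ≤ ∑ i, gr (U i) x := Finset.sum_nonneg fun i _ => gr_nn _ _
    linarith
lemma pd_dil {f : R3 → ℝ} (hf : Sm f) (δ : ℝ) (j : Fin 3) (z : R3) : pd (fun y => f (δ • y)) j z = δ * pd f j (δ • z) := by
  have := pd_aff hf 0 (-δ) j z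
  simpa using this
lemma dil_sm {f : R3 → ℝ} (hf : Sm f) (δ : ℝ) : Sm (fun y => f (δ • y)) := by
  have := aff_sm hf 0 (-δ)
  simpa using this
lemma lap_dil {f : R3 → ℝ} (hf : Sm f) (δ : ℝ) (z : R3) : lap (fun y => f (δ • y)) z = δ ^ 2 * lap f (δ • z) := by
  unfold lap
  rw [Finset.mul_sum]
  refine Finset.sum_congr rfl fun j _ => ?_
  have e : pd (fun y => f (δ • y)) j = fun y => δ * pd f j (δ • y) := funext fun y => pd_dil hf δ j y
  rw [e, pd_cmul (dil_sm (hf.pd j) δ), pd_dil (hf.pd j)]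
  ring
lemma gr_dil {f : R3 → ℝ} (hf : Sm f) (δ : ℝ) (z : R3) : gr (fun y => f (δ • y)) z = δ ^ 2 * gr f (δ • z) := by
  unfold gr
  rw [Finset.mul_sum]
  refine Finset.sum_congr rfl fun j _ => ?_
  rw [pd_dil hf]; ring
open Pointwise in
lemma int_dil (f : R3 → ℝ) {δ : ℝ} (hδ : 0 < δ) (A B : Set R3) (hAB : ∀ x, δ • x ∈ B ↔ x ∈ A) : ∫ x in A, f (δ • x) = (δ ^ 3)⁻¹ * ∫ x in B, f x := by
  have := Measure.setIntegral_comp_smul_of_pos (volume : Measure R3) f A hδ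
  rw [this]
  have e : δ • A = B := by
    ext x
    rw [Set.mem_smul_set_iff_inv_smul_mem₀ hδ.ne', ← hAB, smul_inv_smul₀ hδ.ne']
  rw [e]; simp
lemma lpS_dil (f : R3 → ℝ) {δ : ℝ} (hδ : 0 < δ) (A B : Set R3) (hAB : ∀ x, δ • x ∈ B ↔ x ∈ A) (m : ℝ) : lpS (fun x => f (δ • x)) m A = δ ^ (-3/m) * lpS f m B := by
  unfold lpS
  rw [int_dil (fun x => |f x| ^ m) hδ A B hAB, Real.mul_rpow (by positivity) (int_nn _ _), ← rnc, ← Real.rpow_neg hδ.le, ← rmu hδ.le]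
  congr 2
  push_cast; ring
lemma co_sm' {u : R3 → R3} (hu : ContDiff ℝ (⊤ : ℕ∞) u) (i : Fin 3) : Sm (fun y => u y i) := (co_sm i).comp hu
lemma sys_dil {u v : R3 → R3} {pr θ : R3 → ℝ} (hu : ContDiff ℝ (⊤ : ℕ∞) u) (hv : ContDiff ℝ (⊤ : ℕ∞) v)
    (hpr : ContDiff ℝ (⊤ : ℕ∞) pr) (hθ : ContDiff ℝ (⊤ : ℕ∞) θ) (h : TCM u v pr θ) (δ : ℝ) :
    Sys δ (fun i x => u (δ • x) i) (fun i x => v (δ • x) i) (fun x => pr (δ • x)) (fun x => θ (δ • x)) := by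
  obtain ⟨h1, h2, h3, h4⟩ := h
  have su := co_sm' hu
  have sv := co_sm' hv
  refine ⟨fun i => dil_sm (su i) δ, fun i => dil_sm (sv i) δ, dil_sm hpr δ, dil_sm hθ δ, fun i x => ?_, fun i x => ?_, fun x => ?_, fun x => ?_⟩
  · rw [lap_dil (su i)]
    have e : ∀ j, pd (fun y => v (δ • y) j * v (δ • y) i) j x = δ * pd (fun y => v y j * v y i) j (δ • x) := fun j => pd_dil (f := fun y => v y j * v y i) ((sv j).mul (sv i)) δ j x
    simp_rw [e, pd_dil (su _), pd_dil hpr]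
    have := h1 i (δ • x)
    simp only [Fin.sum_univ_three] at this ⊢
    linear_combination -δ ^ 2 * this
  · rw [lap_dil (sv i)]
    simp_rw [pd_dil (su _), pd_dil (sv _), pd_dil hθ]
    have := h2 i (δ • x)
    simp only [Fin.sum_univ_three] at this ⊢
    linear_combination -δ ^ 2 * this
  · rw [lap_dil hθ]
    simp_rw [pd_dil (sv _), pd_dil hθ]
    have := h3 (δ • x)
    simp only [Fin.sum_univ_three] at this ⊢
    linear_combination -δ ^ 2 * this
  · simp_rw [pd_dil (su _)]
    rw [← Finset.mul_sum, h4, mul_zero]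
lemma vol_shell : ∃ c : ℝ, 0 ≤ c ∧ ∀ s t : ℝ, 0 ≤ t → volume.real (shell s t) ≤ c * t ^ 3 := by
  refine ⟨volume.real (ball (0:R3) 1), measureReal_nonneg, fun s t ht => ?_⟩
  calc volume.real (shell s t) ≤ volume.real (ball (0:R3) t) := measureReal_mono Set.sdiff_subset measure_ball_lt_top.ne
    _ = _ := by
      rw [measureReal_def, Measure.addHaar_ball _ _ ht, ENNReal.toReal_mul, ENNReal.toReal_ofReal (by positivity), mul_comm]
      simp [measureReal_def]
lemma n6 (y : R3) {M : ℝ} : |‖y‖| ^ (6:ℝ) ≤ 9 * ∑ i, |y i| ^ (6:ℝ) := by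
  have e : ∀ z : ℝ, |z| ^ (6:ℝ) = (z ^ 2) ^ 3 := fun z => by
    rw [← sq_abs z, ← pow_mul, ← rnc]; norm_num
  simp_rw [e, nsq, Fin.sum_univ_three]
  have g : ∀ a b c : ℝ, 0 ≤ a → 0 ≤ b → 0 ≤ c → (a + b + c) ^ 3 ≤ 9 * (a ^ 3 + b ^ 3 + c ^ 3) := by
    intro a b c ha hb hc
    have h1 : ∀ x y : ℝ, 0 ≤ x → 0 ≤ y → x ^ 2 * y + x * y ^ 2 ≤ x ^ 3 + y ^ 3 := fun x y hx hy => by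
      nlinarith [mul_nonneg (add_nonneg hx hy) (sq_nonneg (x - y))]
    have h2 : 3 * (a * b * c) ≤ a ^ 3 + b ^ 3 + c ^ 3 := by
      nlinarith [mul_nonneg (add_nonneg (add_nonneg ha hb) hc) (add_nonneg (add_nonneg (sq_nonneg (a - b)) (sq_nonneg (b - c))) (sq_nonneg (a - c)))]
    nlinarith [h1 a b ha hb, h1 b c hb hc, h1 a c ha hc]
  exact g _ _ _ (sq_nonneg _) (sq_nonneg _) (sq_nonneg _)
def Ph (u v : R3 → R3) (θ : R3 → ℝ) (s : ℝ) : ℝ :=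
  (∫ x in ball 0 s, Nn (fun i x => u x i) (fun i x => v x i) θ x) + lpS (fun x => ‖v x‖) 6 (ball 0 s) ^ 2 + lpS θ 6 (ball 0 s) ^ 2
def Rhs (p R a b τ b2 t2 : ℝ) : ℝ := R ^ (1 - 6/p) * a ^ 2 + R ^ (-2:ℝ) * (b2 ^ 2 + t2 ^ 2) + R ^ (2 - 9/p) * a ^ 3 + R ^ (-1:ℝ) * (a * (b ^ 2 + τ ^ 2) + b2 * t2)
lemma num5 {p δ K R a b τ b2 t2 : ℝ} (hp1 : 3 ≤ p) (hp2 : p ≤ 9/2) (hδ : 0 < δ) (hK : 1 ≤ K) (hR : R = δ * K) (a0 : 0 ≤ a) (b0 : 0 ≤ b) (τ0 : 0 ≤ τ) (b20 : 0 ≤ b2) (t20 : 0 ≤ t2) (w : ℝ) (hw : 0 ≤ w) :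
    δ * Qq δ w (δ ^ (-3/p) * a) (δ ^ (-3/(2*(p/(p-1)))) * b) (δ ^ (-3/(2*(p/(p-1)))) * τ) (δ ^ (-3/2 : ℝ) * b2) (δ ^ (-3/2 : ℝ) * t2) ≤ w ^ 5 * (K ^ 2 * Rhs p R a b τ b2 t2) := by
  have p0 : 0 < p := by linarith
  have p1 : 0 < p - 1 := by linarith
  have K0 : 0 < K := by linarith
  have conv : ∀ e : ℝ, -2 ≤ e → δ ^ e ≤ K ^ 2 * R ^ e := fun e he => by
    rw [hR, Real.mul_rpow hδ.le K0.le]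
    have : (1:ℝ) ≤ K ^ 2 * K ^ e := by
      rw [← rnc, ← Real.rpow_add K0]
      exact Real.one_le_rpow hK (by push_cast; linarith)
    nlinarith [Real.rpow_pos_of_pos hδ e]
  have d1 : δ ^ (1:ℝ) = δ := Real.rpow_one δ
  have d2 : ∀ x : ℝ, (δ ^ x) ^ 2 = δ ^ (2 * x) := fun x => by rw [← rnc, ← rmu hδ.le]; push_cast; ring_nf
  have e1 : δ * (δ ^ (-3/p)) ^ 2 = δ ^ (1 - 6/p) := by
    rw [d2]; nth_rw 1 [← d1]; rw [← Real.rpow_add hδ]; congr 1; ring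
  have e2 : δ * (δ ^ (-3/2:ℝ)) ^ 2 = δ ^ (-2:ℝ) := by
    rw [d2]; nth_rw 1 [← d1]; rw [← Real.rpow_add hδ]; congr 1; ring
  have e3 : δ * δ * δ ^ (-3/p) * (δ ^ (-3/p)) ^ 2 = δ ^ (2 - 9/p) := by
    rw [d2]; nth_rw 1 2 [← d1]; rw [← Real.rpow_add hδ, ← Real.rpow_add hδ, ← Real.rpow_add hδ]; congr 1; ring
  have e4 : δ * δ * δ ^ (-3/p) * (δ ^ (-3/(2*(p/(p-1))))) ^ 2 = δ ^ (-1:ℝ) := by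
    rw [d2]; nth_rw 1 2 [← d1]; rw [← Real.rpow_add hδ, ← Real.rpow_add hδ, ← Real.rpow_add hδ]; congr 1; field_simp; ring
  have e5 : δ * δ * (δ ^ (-3/2:ℝ)) ^ 2 = δ ^ (-1:ℝ) := by
    rw [d2]; nth_rw 1 2 [← d1]; rw [← Real.rpow_add hδ, ← Real.rpow_add hδ]; congr 1; ring
  have E : δ * Qq δ w (δ ^ (-3/p) * a) (δ ^ (-3/(2*(p/(p-1)))) * b) (δ ^ (-3/(2*(p/(p-1)))) * τ) (δ ^ (-3/2 : ℝ) * b2) (δ ^ (-3/2 : ℝ) * t2)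
     = w ^ 5 * (δ ^ (1 - 6/p) * a ^ 2 + δ ^ (-2:ℝ) * (b2 ^ 2 + t2 ^ 2) + δ ^ (2 - 9/p) * a ^ 3 + δ ^ (-1:ℝ) * (a * (b ^ 2 + τ ^ 2) + b2 * t2)) := by
    rw [← e1, ← e2, ← e3]
    have : δ ^ (-1:ℝ) * (a * (b ^ 2 + τ ^ 2) + b2 * t2) = (δ * δ * δ ^ (-3/p) * (δ ^ (-3/(2*(p/(p-1))))) ^ 2) * (a * (b ^ 2 + τ ^ 2)) + (δ * δ * (δ ^ (-3/2:ℝ)) ^ 2) * (b2 * t2) := by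
      rw [e4, e5]; ring
    rw [this]
    unfold Qq; ring
  rw [E]
  refine mll ?_ (by positivity)
  have q1 : 6 / p ≤ 2 := by rw [div_le_iff₀ p0]; linarith
  have q2 : 9 / p ≤ 3 := by rw [div_le_iff₀ p0]; linarith
  have l1 := mlr (conv (1 - 6/p) (by linarith)) (sq_nonneg a)
  have l2 := mlr (conv (-2) le_rfl) (show 0 ≤ b2 ^ 2 + t2 ^ 2 by positivity)
  have l3 := mlr (conv (2 - 9/p) (by linarith)) (show 0 ≤ a ^ 3 by positivity)
  have l4 := mlr (conv (-1) (by norm_num)) (show 0 ≤ a * (b ^ 2 + τ ^ 2) + b2 * t2 by positivity)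
  refine (add_le_add (add_le_add (add_le_add l1 l2) l3) l4).trans (le_of_eq ?_)
  unfold Rhs; ring
lemma scaled : ∃ C : ℝ, 0 ≤ C ∧ ∀ (u v : R3 → R3) (pr θ : R3 → ℝ), ContDiff ℝ (⊤ : ℕ∞) u → ContDiff ℝ (⊤ : ℕ∞) v → ContDiff ℝ (⊤ : ℕ∞) pr → ContDiff ℝ (⊤ : ℕ∞) θ →
    TCM u v pr θ → ∀ p R s t : ℝ, 3 ≤ p → p ≤ 9/2 → 0 < R → R ≤ s → s < t → t ≤ 2 * R →
    Ph u v θ s ≤ C * (R / (t - s)) ^ 17 * Rhs p R (lpS (fun x => ‖u x‖) p (shell s t)) (lpS (fun x => ‖v x‖) (2*(p/(p-1))) (shell s t)) (lpS θ (2*(p/(p-1))) (shell s t))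
      (lpS (fun x => ‖v x‖) 2 (shell s t)) (lpS θ 2 (shell s t)) := by
  obtain ⟨C, hC, H⟩ := unit_est
  obtain ⟨c, hc, Hc⟩ := vol_shell
  refine ⟨5 * C * (8 * c + 2) ^ 5 * 8 ^ 17, by positivity, ?_⟩
  intro u v pr θ hu hv hpr hθ hsol p R s t hp1 hp2 hR hRs hst ht
  set δ := (t - s) / 8 with hδd
  have hδ : 0 < δ := by rw [hδd]; linarith
  set K := R / δ with hKd
  have hRK : R = δ * K := by rw [hKd]; field_simp
  have hK8 : 8 ≤ K := by rw [hKd, le_div_iff₀ hδ, hδd]; linarith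
  have hK : 1 ≤ K := by linarith
  set ρ := s / δ with hρd
  have hρK : K ≤ ρ := by rw [hKd, hρd]; gcongr
  have hρ2 : ρ + 8 ≤ 2 * K := by
    have : ρ + 8 = t / δ := by rw [hρd, eq_div_iff hδ.ne', add_mul, div_mul_cancel₀ _ hδ.ne', hδd]; ring
    rw [this, hKd, ← mul_div_assoc]; gcongr
  have hsρ : δ * ρ = s := by rw [hρd]; field_simp
  have htρ : δ * (ρ + 8) = t := by rw [mul_add, hsρ, hδd]; ring
  have mS : ∀ x : R3, δ • x ∈ shell s t ↔ x ∈ shell ρ (ρ + 8) := fun x => by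
    rw [mem_shell, mem_shell, norm_smul, nrn hδ.le, ← hsρ, ← htρ, mul_lt_mul_iff_right₀ hδ, mul_lt_mul_iff_right₀ hδ]
  have mB : ∀ x : R3, δ • x ∈ ball (0:R3) s ↔ x ∈ ball (0:R3) ρ := fun x => by
    rw [mem_ball_zero_iff, mem_ball_zero_iff, norm_smul, nrn hδ.le, ← hsρ, mul_lt_mul_iff_right₀ hδ]
  set w := (8 * c + 2) * K ^ 3 with hwd
  have K3 : K ≤ K ^ 3 := le_self_pow₀ hK (by norm_num)
  have hcK : 0 ≤ c * K ^ 3 := by positivity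
  have hw2 : 2 * K ≤ w := by rw [hwd]; linarith
  have hvol : volume.real (shell ρ (ρ + 8)) ≤ w := by
    refine (Hc _ _ (by linarith)).trans ?_
    have : (ρ + 8) ^ 3 ≤ (2 * K) ^ 3 := pow_le_pow_left₀ (by linarith) hρ2 3
    have := mll this hc
    rw [hwd]
    nlinarith
  have cu : Continuous fun x => ‖u (δ • x)‖ := (hu.continuous.comp (continuous_const_smul δ)).norm
  have cv' : Continuous fun x => ‖v (δ • x)‖ := (hv.continuous.comp (continuous_const_smul δ)).norm
  obtain ⟨r1, r2, r3⟩ := H δ _ _ _ _ (fun x => ‖u (δ • x)‖) (fun x => ‖v (δ • x)‖) p ρ w (sys_dil hu hv hpr hθ hsol δ) hδ hp1 hp2 (by linarith) cu cv'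
    (fun i x => abs_co _ i) (fun i x => abs_co _ i) (by linarith) (by linarith) hvol _ _ _ _ _ rfl rfl rfl rfl rfl
  set a := lpS (fun x => ‖u x‖) p (shell s t) with ha
  set b := lpS (fun x => ‖v x‖) (2*(p/(p-1))) (shell s t) with hb
  set τ := lpS θ (2*(p/(p-1))) (shell s t) with hτ
  set b2 := lpS (fun x => ‖v x‖) 2 (shell s t) with hb2
  set t2 := lpS θ 2 (shell s t) with ht2
  have a0 : 0 ≤ a := lpS_nn _ _ _
  have b0 : 0 ≤ b := lpS_nn _ _ _
  have τ0 : 0 ≤ τ := lpS_nn _ _ _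
  have b20 : 0 ≤ b2 := lpS_nn _ _ _
  have t20 : 0 ≤ t2 := lpS_nn _ _ _
  rw [lpS_dil (fun x => ‖u x‖) hδ _ _ mS, lpS_dil (fun x => ‖v x‖) hδ _ _ mS, lpS_dil (fun x => ‖v x‖) hδ _ _ mS, lpS_dil θ hδ _ _ mS, lpS_dil θ hδ _ _ mS,
    ← ha, ← hb, ← hτ, ← hb2, ← ht2] at r1 r2 r3
  have w0 : 0 ≤ w := by rw [hwd]; positivity
  have nm := num5 hp1 hp2 hδ hK hRK a0 b0 τ0 b20 t20 w w0
  set Q := Qq δ w (δ ^ (-3/p) * a) (δ ^ (-3/(2*(p/(p-1)))) * b) (δ ^ (-3/(2*(p/(p-1)))) * τ) (δ ^ (-3/2 : ℝ) * b2) (δ ^ (-3/2 : ℝ) * t2) with hQ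
  have Q0 : 0 ≤ Q := by rw [hQ, Qq]; positivity
  have N1 : ∫ x in ball 0 s, Nn (fun i x => u x i) (fun i x => v x i) θ x ≤ C * (δ * Q) := by
    have e : ∀ x, Nn (fun i x => u (δ • x) i) (fun i x => v (δ • x) i) (fun x => θ (δ • x)) x = δ ^ 2 * Nn (fun i x => u x i) (fun i x => v x i) θ (δ • x) := fun x => by
      unfold Nn
      simp_rw [gr_dil (co_sm' hu _), gr_dil (co_sm' hv _), gr_dil hθ]
      rw [← Finset.mul_sum, ← Finset.mul_sum]; ring
    simp_rw [e] at r1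
    rw [icm, int_dil _ hδ _ _ mB] at r1
    have : δ ^ 2 * ((δ ^ 3)⁻¹ * ∫ x in ball 0 s, Nn (fun i x => u x i) (fun i x => v x i) θ x) = δ⁻¹ * ∫ x in ball 0 s, Nn (fun i x => u x i) (fun i x => v x i) θ x := by
      field_simp
    rw [this, inv_mul_le_iff₀ hδ] at r1
    linarith
  have c6 : ∀ f : R3 → ℝ, ∫ x in ball 0 ρ, |f (δ • x)| ^ (6:ℝ) ≤ (C * Q) ^ (3:ℝ) → ∫ x in ball 0 s, |f x| ^ (6:ℝ) ≤ (C * (δ * Q)) ^ 3 := fun f hf => by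
    rw [int_dil (fun x => |f x| ^ (6:ℝ)) hδ _ _ mB, inv_mul_le_iff₀ (by positivity)] at hf
    refine hf.trans (le_of_eq ?_)
    rw [show (3:ℝ) = ((3:ℕ):ℝ) by norm_num, rnc]; ring
  have T1 : lpS θ 6 (ball 0 s) ^ 2 ≤ C * (δ * Q) := by
    have := c6 θ r3
    rw [← lpS_pow θ (by norm_num : (0:ℝ) < 6)] at this
    have e : lpS θ 6 (ball 0 s) ^ (6:ℝ) = (lpS θ 6 (ball 0 s) ^ 2) ^ 3 := by rw [← pow_mul, ← rnc]; norm_num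
    rw [e] at this
    exact (pow_le_pow_iff_left₀ (by positivity) (by positivity) (by norm_num)).1 this
  have V1 : lpS (fun x => ‖v x‖) 6 (ball 0 s) ^ 2 ≤ 3 * (C * (δ * Q)) := by
    have bB : BM (ball (0:R3) s) := ⟨measurableSet_ball, s, ball_subset_closedBall⟩
    have cvi : ∀ i, Continuous fun x => |v x i| ^ (6:ℝ) := fun i => rpow_ct (co_sm' hv i).cont (by norm_num)
    have : ∫ x in ball 0 s, |‖v x‖| ^ (6:ℝ) ≤ (3 * (C * (δ * Q))) ^ 3 := by
      calc _ ≤ ∫ x in ball 0 s, 9 * ∑ i, |v x i| ^ (6:ℝ) :=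
            setIntegral_mono_on (bB.int (rpow_ct hv.continuous.norm (by norm_num))) (bB.int (continuous_const.mul (continuous_finsetSum _ fun i _ => cvi i))) measurableSet_ball fun x _ => n6 (M := 0) (v x)
        _ = 9 * ∑ i, ∫ x in ball 0 s, |v x i| ^ (6:ℝ) := by
            rw [icm, integral_finsetSum _ fun i _ => bB.int (cvi i)]
        _ ≤ 9 * ∑ i : Fin 3, (C * (δ * Q)) ^ 3 := by
            gcongr with i
            exact c6 (fun x => v x i) (r2 i)
        _ = _ := by simp; ring
    rw [← lpS_pow _ (by norm_num : (0:ℝ) < 6)] at this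
    have e : lpS (fun x => ‖v x‖) 6 (ball 0 s) ^ (6:ℝ) = (lpS (fun x => ‖v x‖) 6 (ball 0 s) ^ 2) ^ 3 := by rw [← pow_mul, ← rnc]; norm_num
    rw [e] at this
    exact (pow_le_pow_iff_left₀ (by positivity) (by positivity) (by norm_num)).1 this
  have fin : Ph u v θ s ≤ 5 * C * (w ^ 5 * (K ^ 2 * Rhs p R a b τ b2 t2)) := by
    have := mll nm (show 0 ≤ 5 * C by positivity)
    unfold Ph
    linarith
  refine fin.trans (le_of_eq ?_)
  have hK' : K = 8 * (R / (t - s)) := by rw [hKd, hδd]; field_simp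
  rw [hwd, hK']
  ring
lemma e_bd {q m e : ℝ} (hq1 : 1 ≤ q) (hq2 : q < 2) (hm1 : 2 ≤ m) (hm2 : m ≤ 3) (he : e = 2*q*(6-m)/((6-q)*m)) : 2/5 ≤ e ∧ e < 2 := by
  have h : 0 < (6-q)*m := mul_pos (by linarith) (by linarith)
  rw [he]
  constructor
  · rw [le_div_iff₀ h]
    nlinarith [mul_nonneg (sub_nonneg.2 hq1) (sub_nonneg.2 hm2)]
  · rw [div_lt_iff₀ h]
    nlinarith
lemma ip {A : Set R3} (hA : BM A) {g : R3 → ℝ} (cg : Continuous g) {q m e R β M F : ℝ} (hq1 : 1 ≤ q) (hq2 : q < 2) (hm1 : 2 ≤ m) (hm2 : m ≤ 3) (he : e = 2*q*(6-m)/((6-q)*m))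
    (hR : 1 ≤ R) (hM : 1 ≤ M) (hY : lpS g q A ≤ R ^ β * M) (hF : lpS g 6 A ^ 2 ≤ F) :
    lpS g m A ^ 2 ≤ R ^ (β * e) * M ^ 2 * F ^ (1 - e/2) := by
  have q0 : 0 < 6 - q := by linarith
  have m0 : 0 < m := by linarith
  have R0 : 0 < R := by linarith
  have M0 : 0 < M := by linarith
  obtain ⟨e1, e2⟩ := e_bd hq1 hq2 hm1 hm2 he
  have := interp hA cg (q := q) (s := m) (t := 6) (x := (6-m)/(6-q)) (y := (m-q)/(6-q)) (by linarith) m0 (by norm_num) (div_pos (by linarith) q0) (div_pos (by linarith) q0) (by field_simp; ring) (by field_simp; ring)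
  have h2 := pow_le_pow_left₀ (lpS_nn _ _ _) this 2
  refine h2.trans ?_
  rw [mul_pow, ← rnc, ← rmu (lpS_nn _ _ _), ← rnc, ← rmu (lpS_nn _ _ _)]
  have x1 : q * ((6 - m) / (6 - q)) / m * ((2:ℕ):ℝ) = e := by rw [he]; push_cast; field_simp
  have x2 : 6 * ((m - q) / (6 - q)) / m * ((2:ℕ):ℝ) = 2 * (1 - e/2) := by rw [he]; push_cast; field_simp; ring
  rw [x1, x2, rmu (lpS_nn _ _ _)]
  have l1 : lpS g q A ^ e ≤ R ^ (β * e) * M ^ 2 := by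
    refine (rle' (lpS_nn _ _ _) hY (by linarith)).trans ?_
    rw [Real.mul_rpow (by positivity) M0.le, ← rmu R0.le]
    refine mll ?_ (by positivity)
    rw [← rnc]
    exact rlx hM (by push_cast; linarith)
  have l2 : (lpS g 6 A ^ (2:ℝ)) ^ (1 - e/2) ≤ F ^ (1 - e/2) := by
    refine rle' (rnn (lpS_nn _ _ _) _) ?_ (by linarith)
    rw [show (2:ℝ) = ((2:ℕ):ℝ) by norm_num, rnc]; exact hF
  exact mul_le_mul l1 l2 (rnn (rnn (lpS_nn _ _ _) _) _) (by positivity)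
lemma rle {R e : ℝ} (hR : 1 ≤ R) (he : e ≤ 0) : R ^ e ≤ 1 := Real.rpow_le_one_of_one_le_of_nonpos hR he
lemma rhs_bd {p R a b τ b2 t2 α X M G k1 k2 k3 k4 : ℝ} (hR : 1 ≤ R) (hp1 : 3 ≤ p) (hα1 : 0 ≤ α) (hα2 : α ≤ 3/p - 2/3)
    (a0 : 0 ≤ a) (b20 : 0 ≤ b2) (t20 : 0 ≤ t2) (X0 : 0 ≤ X) (G0 : 0 ≤ G) (hM : 1 ≤ M) (ha : a ≤ R ^ α * X)
    (h1 : b ^ 2 ≤ R ^ k1 * M ^ 2 * G) (h2 : τ ^ 2 ≤ R ^ k2 * M ^ 2 * G) (h3 : b2 ^ 2 ≤ R ^ k3 * M ^ 2 * G) (h4 : t2 ^ 2 ≤ R ^ k4 * M ^ 2 * G)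
    (k1h : α + k1 ≤ 1) (k2h : α + k2 ≤ 1) (k3h : k3 ≤ 2) (k4h : k4 ≤ 2) (k34 : k3 / 2 + k4 / 2 ≤ 1) :
    Rhs p R a b τ b2 t2 ≤ X ^ 2 + X ^ 3 + 3 * M ^ 2 * G + 2 * X * M ^ 2 * G := by
  have R0 : 0 < R := by linarith
  have ad := fun x y => Real.rpow_add R0 x y
  have rp := fun x => Real.rpow_pos_of_pos R0 x
  have MG : 0 ≤ M ^ 2 * G := by positivity
  have c1 : R ^ (1 - 6/p) * a ^ 2 ≤ X ^ 2 := by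
    calc _ ≤ R ^ (1 - 6/p) * (R ^ α * X) ^ 2 := by have := rp (1 - 6/p); gcongr
      _ = R ^ (1 - 6/p + (α + α)) * X ^ 2 := by rw [ad, ad]; ring
      _ ≤ 1 * X ^ 2 := by
          refine mlr (rle hR ?_) (by positivity)
          have : 6 / p = 2 * (3 / p) := by ring
          linarith
      _ = _ := one_mul _
  have c3 : R ^ (2 - 9/p) * a ^ 3 ≤ X ^ 3 := by
    calc _ ≤ R ^ (2 - 9/p) * (R ^ α * X) ^ 3 := by have := rp (2 - 9/p); gcongr
      _ = R ^ (2 - 9/p + (α + (α + α))) * X ^ 3 := by rw [ad, ad, ad]; ring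
      _ ≤ 1 * X ^ 3 := by
          refine mlr (rle hR ?_) (by positivity)
          have : 9 / p = 3 * (3 / p) := by ring
          linarith
      _ = _ := one_mul _
  have c2 : ∀ b k : ℝ, b ^ 2 ≤ R ^ k * M ^ 2 * G → k ≤ 2 → R ^ (-2:ℝ) * b ^ 2 ≤ M ^ 2 * G := fun b k hb hk => by
    calc _ ≤ R ^ (-2:ℝ) * (R ^ k * M ^ 2 * G) := mll hb (rp _).le
      _ = R ^ (-2 + k) * (M ^ 2 * G) := by rw [ad]; ring
      _ ≤ 1 * (M ^ 2 * G) := mlr (rle hR (by linarith)) MG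
      _ = _ := one_mul _
  have c4 : ∀ b k : ℝ, b ^ 2 ≤ R ^ k * M ^ 2 * G → α + k ≤ 1 → R ^ (-1:ℝ) * (a * b ^ 2) ≤ X * M ^ 2 * G := fun b k hb hk => by
    calc _ ≤ R ^ (-1:ℝ) * ((R ^ α * X) * (R ^ k * M ^ 2 * G)) := by have := rp (-1); gcongr
      _ = R ^ (-1 + (α + k)) * (X * M ^ 2 * G) := by rw [ad, ad]; ring
      _ ≤ 1 * (X * M ^ 2 * G) := mlr (rle hR (by linarith)) (by positivity)
      _ = _ := one_mul _
  have c5 : R ^ (-1:ℝ) * (b2 * t2) ≤ M ^ 2 * G := by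
    have : b2 * t2 ≤ R ^ (k3/2 + k4/2) * (M ^ 2 * G) := by
      refine abs_le_of_sq_le_sq' ?_ (by have := rp (k3/2+k4/2); positivity) |>.2
      calc (b2 * t2) ^ 2 = b2 ^ 2 * t2 ^ 2 := by ring
        _ ≤ (R ^ k3 * M ^ 2 * G) * (R ^ k4 * M ^ 2 * G) := by gcongr
        _ = (R ^ (k3/2 + k3/2) * M ^ 2 * G) * (R ^ (k4/2 + k4/2) * M ^ 2 * G) := by rw [add_halves, add_halves]
        _ = _ := by rw [ad, ad, ad]; ring
    calc _ ≤ R ^ (-1:ℝ) * (R ^ (k3/2 + k4/2) * (M ^ 2 * G)) := mll this (rp _).le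
      _ = R ^ (-1 + (k3/2 + k4/2)) * (M ^ 2 * G) := by rw [ad (-1) _]; ring
      _ ≤ 1 * (M ^ 2 * G) := mlr (rle hR (by linarith)) MG
      _ = _ := one_mul _
  have d3 := c2 b2 k3 h3 k3h
  have d4 := c2 t2 k4 h4 k4h
  have d1 := c4 b k1 h1 k1h
  have d2 := c4 τ k2 h2 k2h
  unfold Rhs
  rw [mul_add (R ^ (-2:ℝ)), mul_add (R ^ (-1:ℝ)), mul_add a, mul_add (R ^ (-1:ℝ))]
  linarith
lemma iter {f : ℝ → ℝ} {R C L : ℝ} (hR : 0 < R) (hC : 1 ≤ C) (f1 : ∀ s, 1 ≤ f s) (hL : ∀ s, R ≤ s → s ≤ 2 * R → f s ≤ L)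
    (h : ∀ s t, R ≤ s → s < t → t ≤ 2 * R → f s ≤ C * (R / (t - s)) ^ 17 * f t ^ (4/5 : ℝ)) :
    f (3/2 * R) ≤ Real.exp (5 * (Real.log (C * 4 ^ 17) + 4 * (17 * Real.log 2))) := by
  set A := Real.log (C * 4 ^ 17) with hA
  set B := 17 * Real.log 2 with hB
  let s : ℕ → ℝ := fun n => 2 * R - R / 2 * (1/2) ^ n
  have pw : ∀ n : ℕ, (0:ℝ) < (1/2) ^ n := fun n => by positivity
  have pw1 : ∀ n : ℕ, ((1:ℝ)/2) ^ n ≤ 1 := fun n => pow_le_one₀ (by norm_num) (by norm_num)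
  have s1 : ∀ n, R ≤ s n := fun n => by
    have := mll (pw1 n) (show 0 ≤ R/2 by positivity)
    simp only [s]; linarith
  have s2 : ∀ n, s n ≤ 2 * R := fun n => by
    have := mul_pos (show 0 < R/2 by positivity) (pw n)
    simp only [s]; linarith
  have s3 : ∀ n, s (n+1) - s n = R / 4 * (1/2) ^ n := fun n => by simp only [s, pow_succ]; ring
  have s4 : ∀ n, s n < s (n+1) := fun n => by
    have := s3 n
    have := mul_pos (show 0 < R/4 by positivity) (pw n)
    linarith
  have f0 : ∀ s, 0 < f s := fun s => by linarith [f1 s]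
  have st : ∀ n : ℕ, Real.log (f (s n)) ≤ A + B * n + 4/5 * Real.log (f (s (n+1))) := fun n => by
    have := h _ _ (s1 n) (s4 n) (s2 _)
    rw [s3] at this
    have e : R / (R / 4 * (1/2) ^ n) = 4 * 2 ^ n := by field_simp; rw [← mul_pow]; norm_num
    rw [e] at this
    refine (Real.log_le_log (f0 _) this).trans (le_of_eq ?_)
    have e2 : C * (4 * (2:ℝ) ^ n) ^ 17 * f (s (n+1)) ^ (4/5:ℝ) = (C * 4 ^ 17) * ((2 ^ 17) ^ n * f (s (n+1)) ^ (4/5:ℝ)) := by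
      rw [mul_pow, ← pow_mul, ← pow_mul, mul_comm n 17]; ring
    rw [e2, Real.log_mul (by positivity) (mul_pos (by positivity) (Real.rpow_pos_of_pos (f0 _) _)).ne', Real.log_mul (by positivity) (Real.rpow_pos_of_pos (f0 _) _).ne', Real.log_rpow (f0 _),
      Real.log_pow, Real.log_pow]
    rw [hA, hB]; push_cast; ring
  set d := 5 * B with hd
  set c := 5 * (A + 4 * B) with hc
  have hB0 : 0 ≤ B := by rw [hB]; have := Real.log_nonneg (show (1:ℝ) ≤ 2 by norm_num); positivity
  have hA0 : 0 ≤ A := Real.log_nonneg (by nlinarith)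
  let g : ℕ → ℝ := fun n => Real.log (f (s n)) - c - d * n
  have g1 : ∀ n, g n ≤ 4/5 * g (n+1) := fun n => by
    have := st n
    simp only [g]; push_cast; rw [hc, hd]; linarith
  have g2 : ∀ n, g n ≤ Real.log L := fun n => by
    have := Real.log_le_log (f0 _) (hL _ (s1 n) (s2 n))
    have : 0 ≤ d * n := by positivity
    have : 0 ≤ c := by positivity
    simp only [g]; linarith
  have g3 : ∀ n, g 0 ≤ (4/5) ^ n * g n := fun n => by
    induction n with
    | zero => simp
    | succ k ih =>
      refine ih.trans ?_
      rw [pow_succ, mul_assoc]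
      exact mll (g1 k) (by positivity)
  have g4 : g 0 ≤ 0 := by
    have t : Tendsto (fun n : ℕ => ((4:ℝ)/5) ^ n * Real.log L) atTop (nhds (0 * Real.log L)) :=
      (tendsto_pow_atTop_nhds_zero_of_lt_one (by norm_num) (by norm_num)).mul_const _
    rw [zero_mul] at t
    exact ge_of_tendsto' t fun n => (g3 n).trans (mll (g2 n) (by positivity))
  have e0 : s 0 = 3/2 * R := by simp only [s, pow_zero]; ring
  simp only [g, e0] at g4
  rw [← Real.log_le_iff_le_exp (f0 _)]
  simp at g4
  linarith
def ee (q m : ℝ) : ℝ := 2*q*(6-m)/((6-q)*m)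
lemma shell_ann {R s t : ℝ} (hs : R ≤ s) (ht : t ≤ 2 * R) : shell s t ⊆ annulus R := fun x hx => by
  rw [mem_shell] at hx
  refine ⟨mem_ball_zero_iff.2 (by linarith [hx.2]), fun h => ?_⟩
  have := mem_ball_zero_iff.1 h
  linarith [hx.1]
lemma ann_bm (R : ℝ) : BM (annulus R) := ⟨measurableSet_ball.diff measurableSet_ball, 2 * R, Set.sdiff_subset.trans ball_subset_closedBall⟩
lemma ball_bm (R : ℝ) : BM (ball (0:R3) R) := ⟨measurableSet_ball, R, ball_subset_closedBall⟩
lemma core {u v : R3 → R3} {θ : R3 → ℝ} (cu : Continuous u) (cv : Continuous v) (cθ : Continuous θ)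
    {p q r α β γ : ℝ} (hp1 : 3 ≤ p) (hp2 : p ≤ 9 / 2) (hq1 : 1 ≤ q) (hq2 : q < 2) (hr1 : 1 ≤ r) (hr2 : r < 2)
    (hα1 : 0 ≤ α) (hα2 : α ≤ 3 / p - 2 / 3) (hβ2 : β ≤ 3 / q - 1 / 2) (hγ2 : γ ≤ 3 / r - 1 / 2)
    (hc1 : α + ((4 * p - 6) * q / ((6 - q) * p)) * β ≤ 1)
    (hc2 : α + ((4 * p - 6) * r / ((6 - r) * p)) * γ ≤ 1)
    (hc3 : (2 * q / (6 - q)) * β + (2 * r / (6 - r)) * γ ≤ 1)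
    {R s t M X F G : ℝ} (hR : 1 ≤ R) (hs : R ≤ s) (ht : t ≤ 2 * R) (hM : 1 ≤ M) (X0 : 0 ≤ X) (G0 : 0 ≤ G)
    (hX : lpS (fun x => ‖u x‖) p (annulus R) ≤ R ^ α * X) (hY : lpS (fun x => ‖v x‖) q (annulus R) ≤ R ^ β * M)
    (hZ : lpS θ r (annulus R) ≤ R ^ γ * M) (hFv : lpS (fun x => ‖v x‖) 6 (shell s t) ^ 2 ≤ F) (hFt : lpS θ 6 (shell s t) ^ 2 ≤ F)
    (G1 : F ^ (1 - ee q (2*(p/(p-1))) / 2) ≤ G) (G2 : F ^ (1 - ee r (2*(p/(p-1))) / 2) ≤ G) (G3 : F ^ (1 - ee q 2 / 2) ≤ G) (G4 : F ^ (1 - ee r 2 / 2) ≤ G) :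
    Rhs p R (lpS (fun x => ‖u x‖) p (shell s t)) (lpS (fun x => ‖v x‖) (2*(p/(p-1))) (shell s t)) (lpS θ (2*(p/(p-1))) (shell s t))
      (lpS (fun x => ‖v x‖) 2 (shell s t)) (lpS θ 2 (shell s t)) ≤ X ^ 2 + X ^ 3 + 3 * M ^ 2 * G + 2 * X * M ^ 2 * G := by
  have p0 : 0 < p := by linarith
  have p1 : 0 < p - 1 := by linarith
  have q6 : 0 < 6 - q := by linarith
  have r6 : 0 < 6 - r := by linarith
  have R0 : 0 < R := by linarith
  have M0 : 0 < M := by linarith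
  have sa := shell_ann hs ht
  have sm := (shell_bm s t).1
  have ha := (lpS_mono p0 (ann_bm R) sm sa cu.norm cu.norm fun x _ => le_rfl).trans hX
  have hb := (lpS_mono (by linarith : 0 < q) (ann_bm R) sm sa cv.norm cv.norm fun x _ => le_rfl).trans hY
  have hτ := (lpS_mono (by linarith : 0 < r) (ann_bm R) sm sa cθ cθ fun x _ => le_rfl).trans hZ
  have m1 : 2 ≤ 2*(p/(p-1)) := by
    have : 1 ≤ p/(p-1) := by rw [le_div_iff₀ p1]; linarith
    linarith
  have m2 : 2*(p/(p-1)) ≤ 3 := by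
    have : p/(p-1) ≤ 3/2 := by rw [div_le_iff₀ p1]; linarith
    linarith
  have rm : ∀ k F' : ℝ, F' ≤ G → R ^ k * M ^ 2 * F' ≤ R ^ k * M ^ 2 * G := fun k F' h => mll h (mul_nonneg (Real.rpow_pos_of_pos R0 k).le (by positivity))
  have x1 : ∀ q : ℝ, 0 < 6 - q → ee q (2*(p/(p-1))) = (4 * p - 6) * q / ((6 - q) * p) := fun q hq => by
    unfold ee; field_simp; ring
  have x2 : ∀ q : ℝ, 0 < 6 - q → ee q 2 = 2 * (2 * q / (6 - q)) := fun q hq => by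
    unfold ee; field_simp; ring
  have x3 : ∀ q β : ℝ, 0 < q → 0 < 6 - q → β ≤ 3 / q - 1 / 2 → β * ee q 2 ≤ 2 := fun q β h0 hq h => by
    rw [x2 q hq]
    have : 0 < 2 * (2 * q / (6 - q)) := by positivity
    refine (mlr h this.le).trans (le_of_eq ?_)
    field_simp
    ring
  refine rhs_bd hR hp1 hα1 hα2 (lpS_nn _ _ _) (lpS_nn _ _ _) (lpS_nn _ _ _) X0 G0 hM ha
    ((ip (shell_bm s t) cv.norm hq1 hq2 m1 m2 rfl hR hM hb hFv).trans (rm _ _ G1))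
    ((ip (shell_bm s t) cθ hr1 hr2 m1 m2 rfl hR hM hτ hFt).trans (rm _ _ G2))
    ((ip (shell_bm s t) cv.norm hq1 hq2 le_rfl (by norm_num) rfl hR hM hb hFv).trans (rm _ _ G3))
    ((ip (shell_bm s t) cθ hr1 hr2 le_rfl (by norm_num) rfl hR hM hτ hFt).trans (rm _ _ G4)) ?_ ?_ ?_ ?_ ?_
  · have := x1 q q6; unfold ee at this; rw [this]; linarith
  · have := x1 r r6; unfold ee at this; rw [this]; linarith
  · exact x3 q β (by linarith) q6 hβ2
  · exact x3 r γ (by linarith) r6 hγ2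
  · have a1 := x2 q q6
    have a2 := x2 r r6
    unfold ee at a1 a2; rw [a1, a2]; linarith
lemma Nn_nn (U V : Fin 3 → R3 → ℝ) (T : R3 → ℝ) (x : R3) : 0 ≤ Nn U V T x := by
  unfold Nn
  exact add_nonneg (add_nonneg (Finset.sum_nonneg fun i _ => gr_nn _ x) (Finset.sum_nonneg fun i _ => gr_nn _ x)) (gr_nn _ x)
lemma Ph_nn (u v : R3 → R3) (θ : R3 → ℝ) (s : ℝ) : 0 ≤ Ph u v θ s := by
  unfold Ph
  have : 0 ≤ ∫ x in ball 0 s, Nn (fun i x => u x i) (fun i x => v x i) θ x := integral_nonneg fun x => Nn_nn _ _ _ x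
  positivity
lemma Nn_ct {u v : R3 → R3} {θ : R3 → ℝ} (hu : ContDiff ℝ (⊤ : ℕ∞) u) (hv : ContDiff ℝ (⊤ : ℕ∞) v) (hθ : ContDiff ℝ (⊤ : ℕ∞) θ) :
    Continuous (Nn (fun i x => u x i) (fun i x => v x i) θ) := by
  unfold Nn
  exact ((continuous_finsetSum _ fun i _ => (gr_sm (co_sm' hu i)).continuous).add (continuous_finsetSum _ fun i _ => (gr_sm (co_sm' hv i)).continuous)).add (gr_sm hθ).continuous
lemma Ph_mono {u v : R3 → R3} {θ : R3 → ℝ} (hu : ContDiff ℝ (⊤ : ℕ∞) u) (hv : ContDiff ℝ (⊤ : ℕ∞) v) (hθ : ContDiff ℝ (⊤ : ℕ∞) θ)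
    {s t : ℝ} (h : s ≤ t) : Ph u v θ s ≤ Ph u v θ t := by
  unfold Ph
  have hb : ball (0:R3) s ⊆ ball 0 t := ball_subset_ball h
  have a1 : ∫ x in ball 0 s, Nn (fun i x => u x i) (fun i x => v x i) θ x ≤ ∫ x in ball 0 t, Nn (fun i x => u x i) (fun i x => v x i) θ x :=
    setIntegral_mono_set ((ball_bm t).int (Nn_ct hu hv hθ)) (evf fun x => Nn_nn _ _ _ x) hb.eventuallyLE
  have a2 := pow_le_pow_left₀ (lpS_nn _ _ _) (lpS_mono (s := 6) (by norm_num) (ball_bm t) measurableSet_ball hb hv.continuous.norm hv.continuous.norm fun x _ => le_rfl) 2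
  have a3 := pow_le_pow_left₀ (lpS_nn _ _ _) (lpS_mono (s := 6) (by norm_num) (ball_bm t) measurableSet_ball hb hθ.continuous hθ.continuous fun x _ => le_rfl) 2
  linarith
lemma shell_ball (s t : ℝ) : shell s t ⊆ ball 0 t := Set.sdiff_subset
lemma Ph_v {u v : R3 → R3} {θ : R3 → ℝ} (s : ℝ) : lpS (fun x => ‖v x‖) 6 (ball 0 s) ^ 2 ≤ Ph u v θ s ∧ lpS θ 6 (ball 0 s) ^ 2 ≤ Ph u v θ s := by
  unfold Ph
  have : 0 ≤ ∫ x in ball 0 s, Nn (fun i x => u x i) (fun i x => v x i) θ x := integral_nonneg fun x => Nn_nn _ _ _ x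
  constructor <;> nlinarith [sq_nonneg (lpS (fun x => ‖v x‖) 6 (ball 0 s)), sq_nonneg (lpS θ 6 (ball 0 s))]
lemma tail {g : R3 → ℝ} (cg : Continuous g) {K : ℝ} (hK : ∀ s, lpS g 6 (ball 0 s) ^ 2 ≤ K) :
    Tendsto (fun s : ℝ => lpS g 6 (shell s (3/2*s)) ^ 2) atTop (nhds 0) := by
  have c6 : Continuous fun x => |g x| ^ (6:ℝ) := rpow_ct cg (by norm_num)
  let I : ℝ → ℝ := fun s => ∫ x in ball 0 s, |g x| ^ (6:ℝ)
  have mI : Monotone I := fun s t h => setIntegral_mono_set ((ball_bm t).int c6) (evf fun x => rnn (abs_nonneg _) _) (ball_subset_ball h).eventuallyLE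
  have e6 : ∀ y : ℝ, y ^ (6:ℝ) = (y ^ 2) ^ 3 := fun y => by rw [← pow_mul, ← rnc]; norm_num
  have bI : ∀ s, I s ≤ K ^ 3 := fun s => by
    simp only [I]
    rw [← lpS_pow g (by norm_num : (0:ℝ) < 6), e6]
    exact pow_le_pow_left₀ (by positivity) (hK s) 3
  have tI := tendsto_atTop_ciSup mI ⟨K ^ 3, by rintro _ ⟨s, rfl⟩; exact bI s⟩
  have tI2 : Tendsto (fun s : ℝ => I (3/2*s)) atTop (nhds (⨆ i, I i)) := tI.comp (tendsto_id.const_mul_atTop (by norm_num))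
  have td := tI2.sub tI
  rw [sub_self] at td
  have tr := td.rpow_const (p := (1/3:ℝ)) (Or.inr (by norm_num))
  rw [Real.zero_rpow (by norm_num)] at tr
  refine squeeze_zero' (evf fun s => sq_nonneg _) ?_ tr
  filter_upwards [eventually_ge_atTop 1] with s hs
  have h1 : I s + ∫ x in shell s (3/2*s), |g x| ^ (6:ℝ) ≤ I (3/2*s) := by
    simp only [I]
    have dj : Disjoint (ball (0:R3) s) (shell s (3/2*s)) := by
      rw [Set.disjoint_left]; intro x hx hx2
      have := (mem_shell.1 hx2).1
      have := mem_ball_zero_iff.1 hx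
      linarith
    rw [← setIntegral_union dj (shell_bm _ _).1 ((ball_bm s).int c6) ((shell_bm _ _).int c6)]
    exact setIntegral_mono_set ((ball_bm _).int c6) (evf fun x => rnn (abs_nonneg _) _)
      (Set.union_subset (ball_subset_ball (by linarith)) (shell_ball _ _)).eventuallyLE
  rw [← lpS_pow g (by norm_num : (0:ℝ) < 6), e6] at h1
  have h2 : (lpS g 6 (shell s (3/2*s)) ^ 2) ^ 3 ≤ I (3/2*s) - I s := by linarith
  have h3 := rle' (by positivity) h2 (show (0:ℝ) ≤ 1/3 by norm_num)
  refine le_trans (le_of_eq ?_) h3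
  rw [← rnc (_ ^ 2) 3, ← rmu (sq_nonneg _)]
  norm_num
lemma zero_of {f : R3 → ℝ} (cf : Continuous f) (f0 : ∀ x, 0 ≤ f x) (h : ∀ s : ℝ, ∫ x in ball 0 s, f x = 0) (x : R3) : f x = 0 := by
  set s := ‖x‖ + 1 with hs
  have := (setIntegral_eq_zero_iff_of_nonneg_ae (evf f0) ((ball_bm s).int cf)).1 (h s)
  exact Measure.eqOn_open_of_ae_eq this isOpen_ball cf.continuousOn continuousOn_const (mem_ball_zero_iff.2 (by linarith))
lemma unX {f : R3 → ℝ} {a p R X : ℝ} (hR : 0 < R) (h : R ^ (-a) * lpS f p (annulus R) ≤ X) : lpS f p (annulus R) ≤ R ^ a * X := by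
  rw [Real.rpow_neg hR.le, inv_mul_le_iff₀ (Real.rpow_pos_of_pos hR a)] at h
  exact h
lemma num6 {X M G : ℝ} (X0 : 0 ≤ X) (hX : X ≤ M) (hM : 1 ≤ M) (hG : 1 ≤ G) : X ^ 2 + X ^ 3 + 3 * M ^ 2 * G + 2 * X * M ^ 2 * G ≤ 7 * M ^ 3 * G := by
  have a1 : X ^ 2 ≤ M ^ 2 := pow_le_pow_left₀ X0 hX 2
  have a2 : X ^ 3 ≤ M ^ 3 := pow_le_pow_left₀ X0 hX 3
  have a3 : M ^ 2 ≤ M ^ 3 := pow_le_pow_right₀ hM (by norm_num)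
  have a4 : M ^ 3 ≤ M ^ 3 * G := le_mul_of_one_le_right (by positivity) hG
  have a5 : M ^ 2 * G ≤ M ^ 3 * G := mlr a3 (by linarith)
  have a6 : X * (M ^ 2 * G) ≤ M * (M ^ 2 * G) := mlr hX (by positivity)
  nlinarith
lemma ph_zero {u v : R3 → R3} {pr θ : R3 → ℝ}
    (hu : ContDiff ℝ (⊤ : ℕ∞) u) (hv : ContDiff ℝ (⊤ : ℕ∞) v)
    (hpr : ContDiff ℝ (⊤ : ℕ∞) pr) (hθ : ContDiff ℝ (⊤ : ℕ∞) θ)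
    (hsol : TCM u v pr θ)
    {p q r α β γ : ℝ}
    (hp1 : 3 ≤ p) (hp2 : p ≤ 9 / 2)
    (hq1 : 1 ≤ q) (hq2 : q < 2)
    (hr1 : 1 ≤ r) (hr2 : r < 2)
    (hα1 : 0 ≤ α) (hα2 : α ≤ 3 / p - 2 / 3)
    (hβ2 : β ≤ 3 / q - 1 / 2)
    (hγ2 : γ ≤ 3 / r - 1 / 2)
    (hc1 : α + ((4 * p - 6) * q / ((6 - q) * p)) * β ≤ 1)
    (hc2 : α + ((4 * p - 6) * r / ((6 - r) * p)) * γ ≤ 1)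
    (hc3 : (2 * q / (6 - q)) * β + (2 * r / (6 - r)) * γ ≤ 1)
    {Rs : ℕ → ℝ} (hRs : Tendsto Rs atTop atTop)
    (hX : Tendsto (fun j => XnV u α p (Rs j)) atTop (nhds 0))
    (hY : ∃ L : ℝ, Tendsto (fun j => XnV v β q (Rs j)) atTop (nhds L))
    (hZ : ∃ L : ℝ, Tendsto (fun j => XnS θ γ r (Rs j)) atTop (nhds L)) (s0 : ℝ) : Ph u v θ s0 = 0 := by
  obtain ⟨C, hC, H⟩ := scaled
  obtain ⟨LY, hY⟩ := hY
  obtain ⟨LZ, hZ⟩ := hZ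
  have p0 : 0 < p := by linarith
  have p1 : 0 < p - 1 := by linarith
  have m1 : 2 ≤ 2*(p/(p-1)) := by
    have : 1 ≤ p/(p-1) := by rw [le_div_iff₀ p1]; linarith
    linarith
  have m2 : 2*(p/(p-1)) ≤ 3 := by
    have : p/(p-1) ≤ 3/2 := by rw [div_le_iff₀ p1]; linarith
    linarith
  have E1 := e_bd hq1 hq2 m1 m2 (e := ee q (2*(p/(p-1)))) rfl
  have E2 := e_bd hr1 hr2 m1 m2 (e := ee r (2*(p/(p-1)))) rfl
  have E3 := e_bd hq1 hq2 le_rfl (by norm_num) (e := ee q 2) rfl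
  have E4 := e_bd hr1 hr2 le_rfl (by norm_num) (e := ee r 2) rfl
  have cu := hu.continuous
  have cv := hv.continuous
  have cθ := hθ.continuous
  set M := 1 + |LY| + |LZ| + 1 with hMd
  have aY := abs_nonneg LY
  have aZ := abs_nonneg LZ
  have hM : 1 ≤ M := by rw [hMd]; linarith
  have ev : ∀ᶠ j in atTop, 1 ≤ Rs j ∧ XnV u α p (Rs j) ≤ M ∧ XnV v β q (Rs j) ≤ M ∧ XnS θ γ r (Rs j) ≤ M := by
    filter_upwards [hRs.eventually_ge_atTop 1, hX.eventually (eventually_le_nhds (show (0:ℝ) < M by linarith)),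
      hY.eventually (eventually_le_nhds (show LY < M by linarith [le_abs_self LY])), hZ.eventually (eventually_le_nhds (show LZ < M by linarith [le_abs_self LZ]))] with j a b c d
    exact ⟨a, b, c, d⟩
  set C1 := C * (7 * M ^ 3) + 1 with hC1
  have C10 : 1 ≤ C1 := by
    have : 0 ≤ C * (7 * M ^ 3) := by positivity
    linarith
  set K := Real.exp (5 * (Real.log (C1 * 4 ^ 17) + 4 * (17 * Real.log 2))) with hK
  have bdd1 : ∀ᶠ j in atTop, Ph u v θ (3/2 * Rs j) ≤ K := by
    filter_upwards [ev] with j ⟨hR, x1, x2, x3⟩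
    have R0 : 0 < Rs j := by linarith
    have X0 : 0 ≤ XnV u α p (Rs j) := mul_nonneg (rnn R0.le _) (lpS_nn _ _ _)
    have f1 : ∀ s, 1 ≤ Ph u v θ s + 1 := fun s => by linarith [Ph_nn u v θ s]
    have := iter (f := fun s => Ph u v θ s + 1) (L := Ph u v θ (2 * Rs j) + 1) R0 C10 f1
      (fun s _ h => by have := Ph_mono hu hv hθ h; linarith) ?_
    · have t : Ph u v θ (3/2 * Rs j) + 1 ≤ K := this
      linarith
    intro s t hs hst ht
    have h1 := H u v pr θ hu hv hpr hθ hsol p (Rs j) s t hp1 hp2 R0 hs hst ht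
    set F := Ph u v θ t + 1 with hF
    have F1 : 1 ≤ F := f1 t
    have G1 : 1 ≤ F ^ (4/5:ℝ) := Real.one_le_rpow F1 (by norm_num)
    have pm : ∀ e : ℝ, 2/5 ≤ e → F ^ (1 - e/2) ≤ F ^ (4/5:ℝ) := fun e he => rlx F1 (by linarith)
    have l6 : ∀ g : R3 → ℝ, Continuous g → lpS g 6 (shell s t) ^ 2 ≤ lpS g 6 (ball 0 t) ^ 2 := fun g cg =>
      pow_le_pow_left₀ (lpS_nn _ _ _) (lpS_mono (by norm_num) (ball_bm t) (shell_bm s t).1 (shell_ball s t) cg cg fun x _ => le_rfl) 2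
    have h2 := core cu cv cθ hp1 hp2 hq1 hq2 hr1 hr2 hα1 hα2 hβ2 hγ2 hc1 hc2 hc3 hR hs ht hM X0 (by linarith) (unX R0 le_rfl) (unX R0 x2) (unX R0 x3)
      (F := F) (G := F ^ (4/5:ℝ)) ((l6 _ cv.norm).trans (by have := (Ph_v (u := u) (v := v) (θ := θ) t).1; linarith)) ((l6 _ cθ).trans (by have := (Ph_v (u := u) (v := v) (θ := θ) t).2; linarith))
      (pm _ E1.1) (pm _ E2.1) (pm _ E3.1) (pm _ E4.1)
    have h3 := h2.trans (num6 X0 x1 hM G1)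
    have ts : 0 < t - s := by linarith
    have k1 : 1 ≤ (Rs j / (t - s)) ^ 17 := one_le_pow₀ (by rw [le_div_iff₀ ts]; linarith)
    have h4 := h1.trans (mll h3 (by positivity))
    have h5 : 1 ≤ (Rs j / (t - s)) ^ 17 * F ^ (4/5:ℝ) := one_le_mul_of_one_le_of_one_le k1 G1
    rw [hC1]
    show Ph u v θ s + 1 ≤ _
    have e : (C * (7 * M ^ 3) + 1) * (Rs j / (t - s)) ^ 17 * F ^ (4/5:ℝ) = C * (Rs j / (t - s)) ^ 17 * (7 * M ^ 3 * F ^ (4/5:ℝ)) + (Rs j / (t - s)) ^ 17 * F ^ (4/5:ℝ) := by ring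
    rw [e]
    linarith
  have bdd : ∀ s, Ph u v θ s ≤ K := fun s => by
    obtain ⟨j, h1, h2, h3⟩ := (bdd1.and ((hRs.eventually_ge_atTop s).and (hRs.eventually_ge_atTop 0))).exists
    exact (Ph_mono hu hv hθ (by linarith)).trans h1
  have tv := (tail cv.norm fun s => (Ph_v (u := u) (v := v) (θ := θ) s).1.trans (bdd s)).comp hRs
  have tθ := (tail cθ fun s => (Ph_v (u := u) (v := v) (θ := θ) s).2.trans (bdd s)).comp hRs
  have tF := tv.add tθ
  rw [add_zero] at tF
  set F : ℕ → ℝ := fun j => lpS (fun x => ‖v x‖) 6 (shell (Rs j) (3/2 * Rs j)) ^ 2 + lpS θ 6 (shell (Rs j) (3/2 * Rs j)) ^ 2 with hF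
  have tF' : Tendsto F atTop (nhds 0) := tF
  have F0 : ∀ j, 0 ≤ F j := fun j => by simp only [hF]; positivity
  have tp : ∀ e : ℝ, e < 2 → Tendsto (fun j => F j ^ (1 - e/2)) atTop (nhds 0) := fun e he => by
    have := tF'.rpow_const (p := 1 - e/2) (Or.inr (by linarith))
    rwa [Real.zero_rpow (by linarith)] at this
  set G : ℕ → ℝ := fun j => F j ^ (1 - ee q (2*(p/(p-1))) / 2) + F j ^ (1 - ee r (2*(p/(p-1))) / 2) + F j ^ (1 - ee q 2 / 2) + F j ^ (1 - ee r 2 / 2) with hG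
  have tG : Tendsto G atTop (nhds 0) := by
    have := (((tp _ E1.2).add (tp _ E2.2)).add (tp _ E3.2)).add (tp _ E4.2)
    simpa using this
  have g0 : ∀ j e, 0 ≤ F j ^ (e:ℝ) := fun j e => rnn (F0 j) _
  have tB : Tendsto (fun j => C * 2 ^ 17 * (XnV u α p (Rs j) ^ 2 + XnV u α p (Rs j) ^ 3 + 3 * M ^ 2 * G j + 2 * XnV u α p (Rs j) * M ^ 2 * G j)) atTop (nhds 0) := by
    have := (((((hX.pow 2).add (hX.pow 3)).add (tG.const_mul (3 * M ^ 2))).add (((hX.const_mul 2).mul_const (M ^ 2)).mul tG))).const_mul (C * 2 ^ 17)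
    simpa using this
  refine le_antisymm (ge_of_tendsto tB ?_) (Ph_nn _ _ _ _)
  filter_upwards [ev, hRs.eventually_ge_atTop s0] with j ⟨hR, x1, x2, x3⟩ hs
  have R0 : 0 < Rs j := by linarith
  have X0 : 0 ≤ XnV u α p (Rs j) := mul_nonneg (rnn R0.le _) (lpS_nn _ _ _)
  have h1 := H u v pr θ hu hv hpr hθ hsol p (Rs j) (Rs j) (3/2 * Rs j) hp1 hp2 R0 le_rfl (by linarith) (by linarith)
  have q1 := g0 j (1 - ee q (2*(p/(p-1))) / 2)
  have q2 := g0 j (1 - ee r (2*(p/(p-1))) / 2)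
  have q3 := g0 j (1 - ee q 2 / 2)
  have q4 := g0 j (1 - ee r 2 / 2)
  have h2 := core cu cv cθ hp1 hp2 hq1 hq2 hr1 hr2 hα1 hα2 hβ2 hγ2 hc1 hc2 hc3 hR (le_refl (Rs j)) (t := 3/2 * Rs j) (by linarith) hM X0 (by simp only [hG]; linarith) (unX R0 le_rfl) (unX R0 x2) (unX R0 x3)
      (F := F j) (G := G j) (le_add_of_nonneg_right (sq_nonneg _)) (le_add_of_nonneg_left (sq_nonneg _))
      (by simp only [hG]; linarith) (by simp only [hG]; linarith) (by simp only [hG]; linarith) (by simp only [hG]; linarith)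
  have e2 : Rs j / (3/2 * Rs j - Rs j) = 2 := by
    rw [div_eq_iff (by linarith)]; ring
  rw [e2] at h1
  exact (Ph_mono hu hv hθ hs).trans (h1.trans (mll h2 (by positivity)))
lemma const_of {f : R3 → ℝ} (hf : Sm f) (h : ∀ x, gr f x = 0) (x y : R3) : f x = f y := by
  refine is_const_of_fderiv_eq_zero (𝕜 := ℝ) (hf.differentiable (by simp)) (fun x => ?_) x y
  have := fd_le f x
  rw [h x, mul_zero] at this
  exact norm_eq_zero.1 (pow_eq_zero_iff (two_ne_zero) |>.1 (le_antisymm this (sq_nonneg _)))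
lemma vol_ann {R : ℝ} (hR : 0 < R) : volume.real (annulus R) = 7 * volume.real (ball (0:R3) 1) * R ^ 3 := by
  have b : ∀ t : ℝ, 0 ≤ t → volume.real (ball (0:R3) t) = volume.real (ball (0:R3) 1) * t ^ 3 := fun t ht => by
    rw [measureReal_def, Measure.addHaar_ball _ _ ht, ENNReal.toReal_mul, ENNReal.toReal_ofReal (by positivity), mul_comm]
    simp [measureReal_def]
  unfold annulus
  rw [measureReal_sdiff (ball_subset_ball (by linarith)) measurableSet_ball, b _ (by linarith), b _ hR.le]
  ring
lemma u_zero {u : R3 → R3} {p α : ℝ} (hp1 : 3 ≤ p) (hα2 : α ≤ 3 / p - 2 / 3) {Rs : ℕ → ℝ} (hRs : Tendsto Rs atTop atTop)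
    (hX : Tendsto (fun j => XnV u α p (Rs j)) atTop (nhds 0)) (c : R3) (hc : ∀ x, u x = c) : c = 0 := by
  have p0 : 0 < p := by linarith
  set k := volume.real (ball (0:R3) 1) with hk
  have k0 : 0 < k := by
    rw [hk, measureReal_def]
    exact ENNReal.toReal_pos (measure_ball_pos _ _ one_pos).ne' measure_ball_lt_top.ne
  have : (7 * k) ^ (1/p) * ‖c‖ ≤ 0 := by
    refine ge_of_tendsto hX ?_
    filter_upwards [hRs.eventually_ge_atTop 1] with j hR
    have R0 : 0 < Rs j := by linarith
    unfold XnV lpS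
    simp_rw [hc]
    rw [setIntegral_const, vol_ann R0, ← hk, smul_eq_mul, abs_norm, Real.mul_rpow (x := 7 * k * Rs j ^ 3) (by positivity) (by positivity), Real.mul_rpow (x := 7 * k) (y := Rs j ^ 3) (by positivity) (by positivity),
      ← rmu (norm_nonneg _), mul_one_div_cancel p0.ne', Real.rpow_one, ← rnc, ← rmu R0.le]
    have e : Rs j ^ (-α) * ((7 * k) ^ (1/p) * Rs j ^ (((3:ℕ):ℝ) * (1/p)) * ‖c‖) = Rs j ^ (-α + ((3:ℕ):ℝ) * (1/p)) * ((7 * k) ^ (1/p) * ‖c‖) := by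
      rw [Real.rpow_add R0]; ring
    rw [e]
    refine le_mul_of_one_le_left (by positivity) (Real.one_le_rpow hR ?_)
    push_cast
    rw [mul_one_div]; linarith
  have h2 : 0 < (7 * k) ^ (1/p) := by positivity
  exact norm_le_zero_iff.1 (nonpos_of_mul_nonpos_right this h2)
lemma l6_zero {g : R3 → ℝ} (cg : Continuous g) (h : ∀ s, lpS g 6 (ball 0 s) ^ 2 = 0) (x : R3) : g x = 0 := by
  have := zero_of (rpow_ct cg (by norm_num : (0:ℝ) < 6)) (fun x => rnn (abs_nonneg _) _) (fun s => by
    rw [← lpS_pow g (by norm_num : (0:ℝ) < 6), pow_eq_zero_iff (two_ne_zero) |>.1 (h s), Real.zero_rpow (by norm_num)]) x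
  rw [Real.rpow_eq_zero (abs_nonneg _) (by norm_num)] at this
  exact abs_eq_zero.1 this

theorem liouville_tcm_A1 (u v : R3 → R3) (pr θ : R3 → ℝ)
    (hu : ContDiff ℝ (⊤ : ℕ∞) u) (hv : ContDiff ℝ (⊤ : ℕ∞) v)
    (hpr : ContDiff ℝ (⊤ : ℕ∞) pr) (hθ : ContDiff ℝ (⊤ : ℕ∞) θ)
    (hsol : TCM u v pr θ)
    (p q r α β γ : ℝ)
    (hp1 : 3 ≤ p) (hp2 : p ≤ 9 / 2)
    (hq1 : 1 ≤ q) (hq2 : q < 2)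
    (hr1 : 1 ≤ r) (hr2 : r < 2)
    (hα1 : 0 ≤ α) (hα2 : α ≤ 3 / p - 2 / 3)
    (hβ1 : 0 ≤ β) (hβ2 : β ≤ 3 / q - 1 / 2)
    (hγ1 : 0 ≤ γ) (hγ2 : γ ≤ 3 / r - 1 / 2)
    (hc1 : α + ((4 * p - 6) * q / ((6 - q) * p)) * β ≤ 1)
    (hc2 : α + ((4 * p - 6) * r / ((6 - r) * p)) * γ ≤ 1)
    (hc3 : (2 * q / (6 - q)) * β + (2 * r / (6 - r)) * γ ≤ 1)
    (Rs : ℕ → ℝ) (hRs : Tendsto Rs atTop atTop)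
    (hX : Tendsto (fun j => XnV u α p (Rs j)) atTop (nhds 0))
    (hY : ∃ L : ℝ, Tendsto (fun j => XnV v β q (Rs j)) atTop (nhds L))
    (hZ : ∃ L : ℝ, Tendsto (fun j => XnS θ γ r (Rs j)) atTop (nhds L)) :
    (∀ x, u x = 0) ∧ (∀ x, v x = 0) ∧ (∀ x, θ x = 0) := by
  have P0 := ph_zero hu hv hpr hθ hsol hp1 hp2 hq1 hq2 hr1 hr2 hα1 hα2 hβ2 hγ2 hc1 hc2 hc3 hRs hX hY hZ
  have z1 : ∀ s, lpS (fun x => ‖v x‖) 6 (ball 0 s) ^ 2 = 0 := fun s =>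
    le_antisymm ((Ph_v (u := u) (v := v) (θ := θ) s).1.trans (P0 s).le) (sq_nonneg _)
  have z2 : ∀ s, lpS θ 6 (ball 0 s) ^ 2 = 0 := fun s =>
    le_antisymm ((Ph_v (u := u) (v := v) (θ := θ) s).2.trans (P0 s).le) (sq_nonneg _)
  have z3 : ∀ x, Nn (fun i x => u x i) (fun i x => v x i) θ x = 0 := zero_of (Nn_ct hu hv hθ) (fun x => Nn_nn _ _ _ x) fun s => by
    have := P0 s
    unfold Ph at this
    rw [z1, z2] at this
    linarith
  have gu : ∀ i x, gr (fun x => u x i) x = 0 := fun i x => by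
    have h := z3 x
    unfold Nn at h
    have a1 := Finset.sum_nonneg fun (i : Fin 3) (_ : i ∈ Finset.univ) => gr_nn (fun x => u x i) x
    have a2 := Finset.sum_nonneg fun (i : Fin 3) (_ : i ∈ Finset.univ) => gr_nn (fun x => v x i) x
    have a3 := gr_nn θ x
    have a4 : ∑ i : Fin 3, gr (fun x => u x i) x = 0 := by linarith
    exact (Finset.sum_eq_zero_iff_of_nonneg fun i _ => gr_nn _ x).1 a4 i (Finset.mem_univ i)
  have uc : ∀ x, u x = u 0 := fun x => by
    ext i
    exact const_of (co_sm' hu i) (gu i) x 0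
  have u0 := u_zero hp1 hα2 hRs hX (u 0) uc
  exact ⟨fun x => (uc x).trans u0, fun x => norm_eq_zero.1 (l6_zero hv.continuous.norm z1 x), l6_zero hθ.continuous z2⟩
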